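/- Let m ≥ 1, θ > 1, and let f : ℝ^m → ℝ satisfy (H0) and (H1) with parameters α, f₀ > 0, and set γ = α/θ + 1. Then there exists a solution (λ, φ) of the ergodic problem (EP) with φ ∈ Φ_γ, i.e. there exists c > 1 such that c^{−1}|y|^γ − c ≤ φ(y) ≤ c(1 + |y|^γ) for all y ∈ ℝ^m. -/

import Mathlib

open Filter

noncomputable def lap {m : ℕ} (φ : EuclideanSpace ℝ (Fin m) → ℝ)
    (y : EuclideanSpace ℝ (Fin m)) : ℝ :=
  ∑ i : Fin m, iteratedFDeriv ℝ 2 φ y ![EuclideanSpace.single i 1, EuclideanSpace.single i 1]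

def IsSubsolution {m : ℕ} (θ : ℝ) (f : EuclideanSpace ℝ (Fin m) → ℝ) (lam : ℝ)
    (φ : EuclideanSpace ℝ (Fin m) → ℝ) : Prop :=
  ContDiff ℝ 2 φ ∧
    ∀ y, -(1/2) * lap φ y + (1/θ) * ‖gradient φ y‖ ^ θ ≤ f y - lam

def IsSupersolution {m : ℕ} (θ : ℝ) (f : EuclideanSpace ℝ (Fin m) → ℝ) (lam : ℝ)
    (φ : EuclideanSpace ℝ (Fin m) → ℝ) : Prop :=
  ContDiff ℝ 2 φ ∧
    ∀ y, -(1/2) * lap φ y + (1/θ) * ‖gradient φ y‖ ^ θ ≥ f y - lam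

def IsSolution {m : ℕ} (θ : ℝ) (f : EuclideanSpace ℝ (Fin m) → ℝ) (lam : ℝ)
    (φ : EuclideanSpace ℝ (Fin m) → ℝ) : Prop :=
  ContDiff ℝ 2 φ ∧
    ∀ y, -(1/2) * lap φ y + (1/θ) * ‖gradient φ y‖ ^ θ = f y - lam

noncomputable def lambdaStar {m : ℕ} (θ : ℝ) (f : EuclideanSpace ℝ (Fin m) → ℝ) : ℝ :=
  sSup {lam : ℝ | ∃ φ, IsSubsolution θ f lam φ}

def H0 {m : ℕ} (f : EuclideanSpace ℝ (Fin m) → ℝ) (α f₀ : ℝ) : Prop :=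
  LocallyLipschitz f ∧ BddBelow (Set.range f) ∧
    ∀ y, DifferentiableAt ℝ f y →
      (1 ≤ α → ‖gradient f y‖ ≤ f₀ * (1 + ‖y‖ ^ (α - 1))) ∧
      (α < 1 → ‖gradient f y‖ ≤ f₀)

def H1 {m : ℕ} (f : EuclideanSpace ℝ (Fin m) → ℝ) (α f₀ : ℝ) : Prop :=
  ∀ y, f₀⁻¹ * (‖y‖ ^ α + 1) ≤ f y ∧ f y ≤ f₀ * (‖y‖ ^ α + 1)

def MemPhi {m : ℕ} (γ : ℝ) (v : EuclideanSpace ℝ (Fin m) → ℝ) : Prop :=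
  ContDiff ℝ 2 v ∧ ∃ c > 1, ∀ y, c⁻¹ * ‖y‖ ^ γ - c ≤ v y ∧ v y ≤ c * (1 + ‖y‖ ^ γ)

def Coercive {m : ℕ} (f : EuclideanSpace ℝ (Fin m) → ℝ) : Prop :=
  Tendsto f (cocompact (EuclideanSpace ℝ (Fin m))) atTop

namespace EPP

abbrev E (m : ℕ) := EuclideanSpace ℝ (Fin m)

noncomputable abbrev ee {m : ℕ} (i : Fin m) : E m := EuclideanSpace.single i (1:ℝ)

noncomputable def pd {m : ℕ} (i : Fin m) (u : E m → ℝ) (x : E m) : ℝ := fderiv ℝ u x (ee i)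

noncomputable def gl {m : ℕ} (a : Fin m → ℝ) : E m →L[ℝ] ℝ :=
  ∑ i, a i • (EuclideanSpace.proj i : E m →L[ℝ] ℝ)

section basics
variable {m : ℕ}

lemma lap_eq {u : E m → ℝ} (hu : ContDiff ℝ 2 u) (x : E m) : lap u x = ∑ i, pd i (pd i u) x := by
  unfold lap
  refine Finset.sum_congr rfl fun i _ => ?_
  rw [iteratedFDeriv_two_apply]
  have h1 : DifferentiableAt ℝ (fderiv ℝ u) x :=
    ((hu.fderiv_right (m := 1) (by norm_num)).differentiable (by norm_num)) x
  have : pd i (pd i u) x = fderiv ℝ (fun y => fderiv ℝ u y (ee i)) x (ee i) := rfl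
  rw [this, fderiv_clm_apply h1 (by fun_prop)]
  simp

lemma gl_apply (a : Fin m → ℝ) (v : E m) : gl a v = ∑ i, a i * v i := by
  simp [gl]

lemma gl_ee (a : Fin m → ℝ) (i : Fin m) : gl a (ee i) = a i := by
  simp [gl_apply]

lemma eq_gl (l : E m →L[ℝ] ℝ) : l = gl (fun i => l (ee i)) := by
  ext v
  rw [gl_apply]
  conv_lhs => rw [← (EuclideanSpace.basisFun (Fin m) ℝ).sum_repr v]
  simp [mul_comm]

lemma fderiv_eq_gl (u : E m → ℝ) (x : E m) : fderiv ℝ u x = gl (fun i => pd i u x) :=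
  eq_gl _

lemma norm_ee (i : Fin m) : ‖(ee i : E m)‖ = 1 := by simp

lemma abs_pd_le (u : E m → ℝ) (x : E m) (i : Fin m) : |pd i u x| ≤ ‖fderiv ℝ u x‖ := by
  have := (fderiv ℝ u x).le_opNorm (ee i)
  simpa [pd, norm_ee] using this

lemma norm_gl_le (a : Fin m → ℝ) : ‖gl a‖ ≤ ∑ i, |a i| := by
  unfold gl
  refine (norm_sum_le _ _).trans (Finset.sum_le_sum fun i _ => ?_)
  rw [norm_smul]
  have : ‖(EuclideanSpace.proj i : E m →L[ℝ] ℝ)‖ ≤ 1 :=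
    ContinuousLinearMap.opNorm_le_bound _ (by norm_num) fun v => by
      simpa using EuclideanSpace.norm_eq v ▸ (PiLp.norm_apply_le v i)
  calc ‖a i‖ * _ ≤ ‖a i‖ * 1 := by gcongr
    _ = |a i| := by simp

lemma norm_gradient (u : E m → ℝ) (x : E m) : ‖gradient u x‖ = ‖fderiv ℝ u x‖ := by
  simp [gradient]

lemma norm_clm_sq (l : E m →L[ℝ] ℝ) : ‖l‖ ^ 2 = ∑ i, (l (ee i)) ^ 2 := by
  set y := (InnerProductSpace.toDual ℝ (E m)).symm l with hy
  have h : ‖l‖ = ‖y‖ := by simp [hy]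
  rw [h, EuclideanSpace.norm_sq_eq]
  refine Finset.sum_congr rfl fun i _ => ?_
  have : l (ee i) = y i := by
    have : l = InnerProductSpace.toDual ℝ (E m) y := by simp [hy]
    rw [this]
    simp [EuclideanSpace.inner_single_right]
  rw [this]; simp

lemma norm_fderiv_sq (u : E m → ℝ) (x : E m) : ‖fderiv ℝ u x‖ ^ 2 = ∑ i, (pd i u x) ^ 2 :=
  norm_clm_sq _

lemma continuous_gl {X : Type*} [TopologicalSpace X] {g : Fin m → X → ℝ} (hg : ∀ i, Continuous (g i)) :
    Continuous fun x => gl (fun i => g i x) := by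
  unfold gl; fun_prop

lemma contDiff_two_of {u : E m → ℝ} {g : Fin m → E m → ℝ}
    (h : ∀ x, HasFDerivAt u (gl fun i => g i x) x) (hg : ∀ i, ContDiff ℝ 1 (g i)) :
    ContDiff ℝ 2 u := by
  have h2 : fderiv ℝ u = fun x => gl fun i => g i x := funext fun x => (h x).fderiv
  rw [show (2 : WithTop ℕ∞) = 1 + 1 by norm_num, contDiff_succ_iff_fderiv]
  refine ⟨fun x => (h x).differentiableAt, by simp, ?_⟩
  rw [h2]
  unfold gl
  exact ContDiff.sum fun i _ => (hg i).smul contDiff_const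

lemma contDiff_one_of {u : E m → ℝ} {g : Fin m → E m → ℝ}
    (h : ∀ x, HasFDerivAt u (gl fun i => g i x) x) (hg : ∀ i, Continuous (g i)) :
    ContDiff ℝ 1 u := by
  have h2 : fderiv ℝ u = fun x => gl fun i => g i x := funext fun x => (h x).fderiv
  rw [contDiff_one_iff_fderiv]
  refine ⟨fun x => (h x).differentiableAt, ?_⟩
  rw [h2]
  exact continuous_gl hg

lemma pd_of_hasFDerivAt {u : E m → ℝ} {a : Fin m → ℝ} {x : E m}
    (h : HasFDerivAt u (gl a) x) (i : Fin m) : pd i u x = a i := by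
  rw [pd, h.fderiv, gl_ee]

lemma contDiff_pd {u : E m → ℝ} (hu : ContDiff ℝ 2 u) (i : Fin m) : ContDiff ℝ 1 (pd i u) := by
  have := hu.fderiv_right (m := 1) (by norm_num)
  unfold pd
  exact this.clm_apply contDiff_const

lemma continuous_pd {u : E m → ℝ} (hu : ContDiff ℝ 1 u) (i : Fin m) : Continuous (pd i u) := by
  have := hu.continuous_fderiv (by norm_num)
  unfold pd
  fun_prop

lemma diff_of_two {u : E m → ℝ} (hu : ContDiff ℝ 2 u) : Differentiable ℝ u :=
  hu.differentiable (by norm_num)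

lemma diff_pd {u : E m → ℝ} (hu : ContDiff ℝ 2 u) (i : Fin m) : Differentiable ℝ (pd i u) :=
  (contDiff_pd hu i).differentiable (by norm_num)

lemma continuous_lap {u : E m → ℝ} (hu : ContDiff ℝ 2 u) : Continuous (lap u) := by
  have : lap u = fun x => ∑ i, pd i (pd i u) x := funext fun x => lap_eq hu x
  rw [this]
  exact continuous_finsetSum _ fun i _ => continuous_pd (contDiff_pd hu i) i

lemma pd_add {u v : E m → ℝ} (hu : Differentiable ℝ u) (hv : Differentiable ℝ v) (i : Fin m) :
    pd i (fun x => u x + v x) = fun x => pd i u x + pd i v x := by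
  funext x
  simp only [pd]
  rw [fderiv_fun_add (hu x) (hv x)]; rfl

lemma pd_sub {u v : E m → ℝ} (hu : Differentiable ℝ u) (hv : Differentiable ℝ v) (i : Fin m) :
    pd i (fun x => u x - v x) = fun x => pd i u x - pd i v x := by
  funext x
  simp only [pd]
  rw [fderiv_fun_sub (hu x) (hv x)]; rfl

lemma pd_mul {u v : E m → ℝ} (hu : Differentiable ℝ u) (hv : Differentiable ℝ v) (i : Fin m) :
    pd i (fun x => u x * v x) = fun x => u x * pd i v x + v x * pd i u x := by
  funext x
  simp only [pd]
  rw [fderiv_fun_mul (hu x) (hv x)]; rfl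

lemma pd_const_mul {u : E m → ℝ} (hu : Differentiable ℝ u) (c : ℝ) (i : Fin m) :
    pd i (fun x => c * u x) = fun x => c * pd i u x := by
  funext x
  simp only [pd]
  rw [fderiv_const_mul (hu x)]; rfl

lemma lap_add {u v : E m → ℝ} (hu : ContDiff ℝ 2 u) (hv : ContDiff ℝ 2 v) (x : E m) :
    lap (fun x => u x + v x) x = lap u x + lap v x := by
  rw [lap_eq (hu.add hv), lap_eq hu, lap_eq hv, ← Finset.sum_add_distrib]
  refine Finset.sum_congr rfl fun i _ => ?_
  rw [pd_add (diff_of_two hu) (diff_of_two hv), pd_add (diff_pd hu i) (diff_pd hv i)]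

lemma lap_sub {u v : E m → ℝ} (hu : ContDiff ℝ 2 u) (hv : ContDiff ℝ 2 v) (x : E m) :
    lap (fun x => u x - v x) x = lap u x - lap v x := by
  rw [lap_eq (hu.sub hv), lap_eq hu, lap_eq hv, ← Finset.sum_sub_distrib]
  refine Finset.sum_congr rfl fun i _ => ?_
  rw [pd_sub (diff_of_two hu) (diff_of_two hv), pd_sub (diff_pd hu i) (diff_pd hv i)]

lemma lap_const_mul {u : E m → ℝ} (hu : ContDiff ℝ 2 u) (c : ℝ) (x : E m) :
    lap (fun x => c * u x) x = c * lap u x := by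
  rw [lap_eq (contDiff_const.mul hu), lap_eq hu, Finset.mul_sum]
  refine Finset.sum_congr rfl fun i _ => ?_
  rw [pd_const_mul (diff_of_two hu), pd_const_mul (diff_pd hu i)]

lemma lap_const (c : ℝ) (x : E m) : lap (fun _ : E m => c) x = 0 := by
  rw [lap_eq contDiff_const]
  have : ∀ i : Fin m, pd i (fun _ : E m => c) = fun _ => 0 := fun i => by
    funext y; simp [pd]
  simp [this, pd]

lemma lap_mul {u v : E m → ℝ} (hu : ContDiff ℝ 2 u) (hv : ContDiff ℝ 2 v) (x : E m) :
    lap (fun x => u x * v x) x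
      = u x * lap v x + 2 * ∑ i, pd i u x * pd i v x + v x * lap u x := by
  rw [lap_eq (hu.mul hv), lap_eq hu, lap_eq hv, Finset.mul_sum, Finset.mul_sum, Finset.mul_sum,
    ← Finset.sum_add_distrib, ← Finset.sum_add_distrib]
  refine Finset.sum_congr rfl fun i _ => ?_
  rw [pd_mul (diff_of_two hu) (diff_of_two hv),
    pd_add (u := fun x => u x * pd i v x) (v := fun x => v x * pd i u x)
      ((diff_of_two hu).mul (diff_pd hv i)) ((diff_of_two hv).mul (diff_pd hu i)),
    pd_mul (diff_of_two hu) (diff_pd hv i), pd_mul (diff_of_two hv) (diff_pd hu i)]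
  ring

lemma hasFDerivAt_normsq (x0 x : E m) :
    HasFDerivAt (fun x : E m => ‖x - x0‖ ^ 2) (gl fun i => 2 * (x i - x0 i)) x := by
  have h := ((hasFDerivAt_id (𝕜 := ℝ) x).sub_const x0).norm_sq
  have e : (gl fun i => 2 * (x i - x0 i)) =
      2 • (innerSL ℝ) (id x - x0) ∘SL ContinuousLinearMap.id ℝ (E m) := by
    ext v
    rw [gl_apply]
    simp only [id, ContinuousLinearMap.comp_id, _root_.smul_apply, innerSL_apply_apply,
      PiLp.inner_apply, nsmul_eq_mul, Finset.mul_sum]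
    refine Finset.sum_congr rfl fun i _ => by simp; ring
  rw [e]
  exact h

lemma contDiff_normsq (x0 : E m) {n : WithTop ℕ∞} : ContDiff ℝ n (fun x : E m => ‖x - x0‖ ^ 2) :=
  (contDiff_id.sub contDiff_const).norm_sq ℝ

lemma pd_normsq (x0 x : E m) (i : Fin m) :
    pd i (fun x : E m => ‖x - x0‖ ^ 2) x = 2 * (x i - x0 i) :=
  pd_of_hasFDerivAt (hasFDerivAt_normsq x0 x) i

lemma pd_coord (x0 : E m) (x : E m) (i : Fin m) :
    pd i (fun x : E m => 2 * (x i - x0 i)) x = 2 := by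
  have h : HasFDerivAt (fun x : E m => 2 * (x i - x0 i))
      ((2:ℝ) • (EuclideanSpace.proj i : E m →L[ℝ] ℝ)) x := by
    have := (EuclideanSpace.proj i : E m →L[ℝ] ℝ).hasFDerivAt (x := x)
    exact (this.sub_const (x0 i)).const_mul 2
  rw [pd, h.fderiv]
  simp

lemma lap_normsq (x0 x : E m) : lap (fun x : E m => ‖x - x0‖ ^ 2) x = 2 * m := by
  rw [lap_eq (contDiff_normsq x0)]
  have : ∀ i : Fin m, pd i (fun x : E m => ‖x - x0‖ ^ 2) = fun x => 2 * (x i - x0 i) :=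
    fun i => funext fun x => pd_normsq x0 x i
  simp [this, pd_coord, mul_comm]

lemma norm_fderiv_normsq (x0 x : E m) :
    ‖fderiv ℝ (fun x : E m => ‖x - x0‖ ^ 2) x‖ = 2 * ‖x - x0‖ := by
  have h : ‖fderiv ℝ (fun x : E m => ‖x - x0‖ ^ 2) x‖ ^ 2 = (2 * ‖x - x0‖) ^ 2 := by
    rw [norm_fderiv_sq, mul_pow, EuclideanSpace.norm_sq_eq, Finset.mul_sum]
    refine Finset.sum_congr rfl fun i _ => ?_
    rw [pd_normsq]; simp [mul_pow]
  exact (sq_eq_sq₀ (norm_nonneg _) (by positivity)).1 h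

lemma line_deriv2 {w : E m → ℝ} (hw : ContDiff ℝ 2 w) (x : E m) (i : Fin m) :
    deriv (fun t : ℝ => w (x + t • ee i)) = (fun t : ℝ => pd i w (x + t • ee i)) := by
  funext t
  have h1 : HasDerivAt (fun t : ℝ => x + t • (ee i : E m)) (ee i) t := by
    have := ((hasDerivAt_id t).smul_const (ee i : E m)).const_add x
    simpa using this
  have := ((diff_of_two hw) (x + t • ee i)).hasFDerivAt.comp_hasDerivAt t h1
  exact this.deriv

lemma line_deriv1 {w : E m → ℝ} (hw : Differentiable ℝ w) (x : E m) (i : Fin m) :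
    deriv (fun t : ℝ => w (x + t • ee i)) 0 = pd i w x := by
  have h1 : HasDerivAt (fun t : ℝ => x + t • (ee i : E m)) (ee i) 0 := by
    have := ((hasDerivAt_id (0:ℝ)).smul_const (ee i : E m)).const_add x
    simpa using this
  have := (hw (x + (0:ℝ) • ee i)).hasFDerivAt.comp_hasDerivAt 0 h1
  have := this.deriv
  simp only [zero_smul, add_zero] at this
  exact this

lemma isLocalMax_lap {w : E m → ℝ} (hw : ContDiff ℝ 2 w) {x : E m} (h : IsLocalMax w x) :
    fderiv ℝ w x = 0 ∧ lap w x ≤ 0 := by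
  refine ⟨h.fderiv_eq_zero, ?_⟩
  rw [lap_eq hw]
  refine Finset.sum_nonpos fun i _ => ?_
  by_contra! hpos
  set g : ℝ → ℝ := fun t => w (x + t • ee i) with hg
  have hc : Continuous fun t : ℝ => x + t • (ee i : E m) := by fun_prop
  have hgmax : IsLocalMax g 0 := by
    have : Tendsto (fun t : ℝ => x + t • (ee i : E m)) (nhds 0) (nhds x) := by
      have := hc.tendsto 0
      simpa using this
    have h2 := this.eventually h
    filter_upwards [h2] with t ht
    simpa [hg] using ht
  have hd1 : deriv g = fun t => pd i w (x + t • ee i) := line_deriv2 hw x i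
  have hd2 : deriv (deriv g) 0 = pd i (pd i w) x := by
    rw [hd1]; exact line_deriv1 (diff_pd hw i) x i
  have hgmin : IsLocalMin g 0 :=
    isLocalMin_of_deriv_deriv_pos (by rw [hd2]; exact hpos) hgmax.deriv_eq_zero
      (by exact (hw.continuous.comp hc).continuousAt)
  have hcst : g =ᶠ[nhds 0] fun _ => g 0 := by
    filter_upwards [hgmax, hgmin] with t h1 h2
    exact le_antisymm h1 h2
  have : deriv (deriv g) 0 = 0 := by
    have h3 : deriv g =ᶠ[nhds 0] deriv (fun _ => g 0) := hcst.deriv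
    rw [h3.deriv_eq]; simp
  rw [hd2] at this
  linarith

lemma isLocalMin_lap {w : E m → ℝ} (hw : ContDiff ℝ 2 w) {x : E m} (h : IsLocalMin w x) :
    fderiv ℝ w x = 0 ∧ 0 ≤ lap w x := by
  refine ⟨h.fderiv_eq_zero, ?_⟩
  have := (isLocalMax_lap (contDiff_const.mul hw : ContDiff ℝ 2 fun x => (-1:ℝ) * w x) (x := x)
    (by filter_upwards [h] with y hy; simpa using hy)).2
  rw [lap_const_mul hw] at this
  linarith

end basics
end EPP

namespace EPP

structure Ker {m : ℕ} (κ : E m → ℝ) : Prop where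
  smooth : ∀ n : ℕ, ContDiff ℝ n κ
  supp : ∀ z, 1 < ‖z‖ → κ z = 0

noncomputable def V {m : ℕ} (κ : E m → ℝ) (s : ℝ) (h : E m → ℝ) (x : E m) : ℝ :=
  ∫ z, κ z * h (x - s • z)

section ker
variable {m : ℕ}
open MeasureTheory Topology

lemma Ker.cont {κ : E m → ℝ} (hκ : Ker κ) : Continuous κ := (hκ.smooth 0).continuous

lemma Ker.diff {κ : E m → ℝ} (hκ : Ker κ) : Differentiable ℝ κ :=
  (hκ.smooth 1).differentiable (by norm_num)

lemma Ker.cs {κ : E m → ℝ} (hκ : Ker κ) : HasCompactSupport κ :=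
  HasCompactSupport.intro (isCompact_closedBall (0 : E m) 1) fun z hz =>
    hκ.supp z (by simpa using hz)

lemma Ker.pd {κ : E m → ℝ} (hκ : Ker κ) (i : Fin m) : Ker (pd i κ) := by
  refine ⟨fun n => ?_, fun z hz => ?_⟩
  · have := (hκ.smooth (n + 1)).fderiv_right (m := n) (by norm_cast)
    unfold EPP.pd
    exact this.clm_apply contDiff_const
  · have : κ =ᶠ[𝓝 z] fun _ => 0 := by
      filter_upwards [(isOpen_lt continuous_const continuous_norm).mem_nhds hz] with y hy
      exact hκ.supp y hy
    rw [EPP.pd, this.fderiv_eq]; simp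

lemma Ker.sum {ι : Type*} (S : Finset ι) {κ : ι → E m → ℝ} (hκ : ∀ i, Ker (κ i)) :
    Ker (fun z => ∑ i ∈ S, κ i z) :=
  ⟨fun n => ContDiff.sum fun i _ => (hκ i).smooth n, fun z hz =>
    Finset.sum_eq_zero fun i _ => (hκ i).supp z hz⟩

lemma Ker.integrable_mul {κ : E m → ℝ} (hκ : Ker κ) {g : E m → ℝ} (hg : Continuous g) :
    Integrable (fun z => κ z * g z) :=
  (hκ.cont.mul hg).integrable_of_hasCompactSupport hκ.cs.mul_right

lemma Ker.integrable {κ : E m → ℝ} (hκ : Ker κ) : Integrable κ :=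
  hκ.cont.integrable_of_hasCompactSupport hκ.cs

lemma V_integrable {κ : E m → ℝ} (hκ : Ker κ) {h : E m → ℝ} (hh : Continuous h) (s : ℝ) (x : E m) :
    Integrable (fun z => κ z * h (x - s • z)) :=
  hκ.integrable_mul (g := fun z => h (x - s • z)) (by fun_prop)

noncomputable def mass (κ : E m → ℝ) : ℝ := ∫ z, |κ z|

lemma mass_nonneg (κ : E m → ℝ) : 0 ≤ mass κ := integral_nonneg fun _ => abs_nonneg _

lemma V_bound {κ : E m → ℝ} (hκ : Ker κ) {h : E m → ℝ} {s C : ℝ} (x : E m)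
    (hs0 : 0 ≤ s) (hs : s ≤ 1) (hC : ∀ q, ‖q - x‖ ≤ 1 → |h q| ≤ C) :
    |V κ s h x| ≤ mass κ * C := by
  unfold V mass
  rw [← Real.norm_eq_abs, ← integral_mul_const]
  refine norm_integral_le_of_norm_le (hκ.integrable.abs.mul_const C) (Eventually.of_forall fun z => ?_)
  rw [Real.norm_eq_abs, abs_mul]
  by_cases hz : 1 < ‖z‖
  · simp [hκ.supp z hz]
  · push Not at hz
    refine mul_le_mul_of_nonneg_left (hC _ ?_) (abs_nonneg _)
    rw [sub_sub_cancel_left, norm_neg, norm_smul, Real.norm_eq_abs, abs_of_nonneg hs0]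
    nlinarith [norm_nonneg z]

lemma V_sub {κ : E m → ℝ} (hκ : Ker κ) {h g : E m → ℝ} (hh : Continuous h) (hg : Continuous g)
    (s : ℝ) (x : E m) : V κ s (fun y => h y - g y) x = V κ s h x - V κ s g x := by
  unfold V
  rw [← integral_sub (V_integrable hκ hh s x) (V_integrable hκ hg s x)]
  congr 1; funext z; ring

lemma V_const (κ : E m → ℝ) (s c : ℝ) (x : E m) : V κ s (fun _ => c) x = (∫ z, κ z) * c := by
  unfold V; rw [integral_mul_const]

lemma V_zero (κ : E m → ℝ) (h : E m → ℝ) (x : E m) : V κ 0 h x = (∫ z, κ z) * h x := by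
  unfold V; simp [integral_mul_const]

lemma V_hoelder {κ : E m → ℝ} (hκ : Ker κ) (hz : ∫ z, κ z = 0) {h : E m → ℝ} (hh : Continuous h)
    {s C : ℝ} (x : E m) (hs0 : 0 ≤ s) (hs : s ≤ 1)
    (hC : ∀ q, ‖q - x‖ ≤ 1 → |h q - h x| ≤ C * √‖q - x‖) :
    |V κ s h x| ≤ mass κ * (C * √s) := by
  have h1 : V κ s h x = V κ s (fun y => h y - h x) x := by
    rw [V_sub hκ hh continuous_const, V_const, hz]; simp
  by_cases hC0 : 0 ≤ C
  · rw [h1]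
    unfold V mass
    rw [← Real.norm_eq_abs, ← integral_mul_const]
    refine norm_integral_le_of_norm_le (hκ.integrable.abs.mul_const _)
      (Eventually.of_forall fun z => ?_)
    rw [Real.norm_eq_abs, abs_mul]
    by_cases hz : 1 < ‖z‖
    · simp [hκ.supp z hz]
    · push Not at hz
      have e : ‖x - s • z - x‖ = s * ‖z‖ := by
        rw [sub_sub_cancel_left, norm_neg, norm_smul, Real.norm_eq_abs, abs_of_nonneg hs0]
      have e1 : s * ‖z‖ ≤ s := by nlinarith
      refine mul_le_mul_of_nonneg_left ((hC _ ?_).trans ?_) (abs_nonneg _)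
      · rw [e]; linarith
      · rw [e]; gcongr
  · -- C < 0 forces triviality
    push Not at hC0
    by_cases hE : ∃ q : E m, ‖q - x‖ ≤ 1 ∧ q ≠ x
    · obtain ⟨q, hq1, hq2⟩ := hE
      have := hC q hq1
      have h2 : 0 < √‖q - x‖ := Real.sqrt_pos.2 (norm_pos_iff.2 (sub_ne_zero.2 hq2))
      have h3 := abs_nonneg (h q - h x)
      nlinarith
    · push Not at hE
      have e : ∀ z : E m, z = 0 := by
        intro z
        by_contra hz0
        have hn := norm_pos_iff.2 hz0
        have := hE (x + (‖z‖⁻¹) • z) (by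
          rw [add_sub_cancel_left, norm_smul, norm_inv, norm_norm, inv_mul_cancel₀ hn.ne'])
        simp [hz0] at this
      have : V κ s h x = 0 := by
        have e2 : ∀ z, κ z * h (x - s • z) = κ z * h x := fun z => by rw [e z]; simp
        unfold V
        simp_rw [e2]
        rw [integral_mul_const, hz, zero_mul]
      have hκ0 : mass κ = 0 := by
        have e2 : ∀ z, κ z = κ 0 := fun z => by rw [e z]
        have : ∫ z, |κ z| = |∫ z, κ z| := by
          simp_rw [e2]
          by_cases hp : 0 ≤ κ 0
          · rw [abs_of_nonneg hp, abs_of_nonneg (integral_nonneg fun _ => hp)]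
          · push Not at hp
            rw [abs_of_neg hp, integral_neg, abs_of_nonpos (integral_nonpos fun _ => hp.le)]
        rw [mass, this, hz, abs_zero]
      rw [this, hκ0]; simp

lemma V_cont {κ : E m → ℝ} (hκ : Ker κ) {h : E m → ℝ} (hh : Continuous h) :
    Continuous fun p : ℝ × E m => V κ p.1 h p.2 := by
  have e : (fun p : ℝ × E m => V κ p.1 h p.2) = fun p : ℝ × E m =>
      ∫ z in Metric.closedBall (0 : E m) 1, κ z * h (p.2 - p.1 • z) := by
    funext p
    rw [V, setIntegral_eq_integral_of_forall_compl_eq_zero]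
    intro z hz
    rw [hκ.supp z (by simpa using hz), zero_mul]
  rw [e]
  refine continuous_parametric_integral_of_continuous
    (f := fun (p : ℝ × E m) z => κ z * h (p.2 - p.1 • z)) ?_ (isCompact_closedBall _ _)
  have := hκ.cont
  simp only [Function.uncurry_def]
  fun_prop

lemma V_cont_s {κ : E m → ℝ} (hκ : Ker κ) {h : E m → ℝ} (hh : Continuous h) (x : E m) :
    Continuous fun s => V κ s h x :=
  (V_cont hκ hh).comp (by fun_prop : Continuous fun s : ℝ => (s, x))

lemma V_cont_x {κ : E m → ℝ} (hκ : Ker κ) {h : E m → ℝ} (hh : Continuous h) (s : ℝ) :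
    Continuous fun x => V κ s h x :=
  (V_cont hκ hh).comp (by fun_prop : Continuous fun x : E m => (s, x))

lemma V_eq_conv (κ : E m → ℝ) {h : E m → ℝ} {s : ℝ} (hs : 0 < s) (x : E m) :
    V κ s h x = (s ^ m)⁻¹ * ∫ t, h t * κ (s⁻¹ • (x - t)) := by
  have h1 : ∫ t, h t * κ (s⁻¹ • (x - t)) = ∫ t, h (x - t) * κ (s⁻¹ • t) := by
    rw [← integral_sub_left_eq_self (fun t => h t * κ (s⁻¹ • (x - t))) _ x]
    simp
  have h2 := Measure.integral_comp_smul (volume : Measure (E m))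
    (fun t => h (x - t) * κ (s⁻¹ • t)) s
  have h3 : ∀ z : E m, h (x - s • z) * κ (s⁻¹ • s • z) = κ z * h (x - s • z) := fun z => by
    rw [smul_smul, inv_mul_cancel₀ hs.ne', one_smul, mul_comm]
  simp_rw [h3] at h2
  unfold V
  rw [h1, h2]
  simp [abs_of_pos hs]

lemma V_hasFDerivAt {κ : E m → ℝ} (hκ : Ker κ) {h : E m → ℝ} (hh : Continuous h) {s : ℝ}
    (hs : 0 < s) (x : E m) :
    HasFDerivAt (fun x => V κ s h x) (gl fun i => s⁻¹ * V (pd i κ) s h x) x := by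
  set ks : E m → ℝ := fun t => κ (s⁻¹ • t) with hks
  have hksd : ContDiff ℝ 1 ks := (hκ.smooth 1).comp (contDiff_const_smul _)
  have hkcs : HasCompactSupport ks := hκ.cs.comp_smul (inv_ne_zero hs.ne')
  have hd := hkcs.hasFDerivAt_convolution_right (ContinuousLinearMap.mul ℝ ℝ)
    (hh.locallyIntegrable (μ := volume)) hksd x
  have hfd : ∀ t i, fderiv ℝ ks t (ee i) = s⁻¹ * pd i κ (s⁻¹ • t) := by
    intro t i
    have h1 : HasFDerivAt (fun t : E m => s⁻¹ • t) (s⁻¹ • ContinuousLinearMap.id ℝ (E m)) t :=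
      (s⁻¹ • ContinuousLinearMap.id ℝ (E m)).hasFDerivAt
    have := (hκ.diff (s⁻¹ • t)).hasFDerivAt.comp t h1
    rw [show ks = κ ∘ fun t => s⁻¹ • t from rfl, this.fderiv]
    simp [pd]
  have e0 : (fun x => V κ s h x) = fun x => (s ^ m)⁻¹ *
      (MeasureTheory.convolution h ks (ContinuousLinearMap.mul ℝ ℝ) volume) x := by
    funext x
    rw [V_eq_conv κ hs x]
    rfl
  rw [e0]
  have hd2 := hd.const_mul ((s ^ m)⁻¹)
  convert! hd2 using 1
  rw [eq_gl ((s ^ m)⁻¹ • _)]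
  congr 1
  funext i
  rw [_root_.smul_apply, convolution_precompR_apply (ContinuousLinearMap.mul ℝ ℝ)
    (hh.locallyIntegrable) (hkcs.fderiv ℝ) (hksd.continuous_fderiv (by norm_num)),
    V_eq_conv _ hs]
  simp only [convolution_def, hfd, smul_eq_mul, ContinuousLinearMap.mul_apply']
  rw [mul_left_comm, ← integral_const_mul]
  congr 2
  funext t
  ring

lemma V_ibp {κ : E m → ℝ} (hκ : Ker κ) {h : E m → ℝ} (hh : ContDiff ℝ 1 h) (s : ℝ)
    (x : E m) (i : Fin m) :
    s * V κ s (pd i h) x = V (pd i κ) s h x := by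
  have hd : ∀ z, fderiv ℝ (fun z => h (x - s • z)) z (ee i) = - s * pd i h (x - s • z) := by
    intro z
    have h1 : HasFDerivAt (fun t : E m => x - s • t) (-(s • ContinuousLinearMap.id ℝ (E m))) z :=
      ((hasFDerivAt_id z).const_smul s).const_sub x
    have := ((hh.differentiable (by norm_num)) (x - s • z)).hasFDerivAt.comp z h1
    rw [show (fun z => h (x - s • z)) = h ∘ fun t => x - s • t from rfl, this.fderiv]
    simp [pd]
  have hpc := continuous_pd hh i
  have hc := hh.continuous
  have := integral_mul_fderiv_eq_neg_fderiv_mul_of_integrable (μ := (volume : Measure (E m)))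
    (f := κ) (g := fun z => h (x - s • z)) (v := ee i) ?_ ?_ ?_ ?_ ?_
  · simp only [hd] at this
    unfold V
    have e : ∫ z, κ z * (-s * pd i h (x - s • z)) = - (s * ∫ z, κ z * pd i h (x - s • z)) := by
      rw [← integral_const_mul, ← integral_neg]
      congr 1; funext z; ring
    rw [e] at this
    exact neg_injective this
  · exact V_integrable (hκ.pd i) hc s x
  · simp only [hd]
    exact hκ.integrable_mul (by fun_prop)
  · exact V_integrable hκ hc s x
  · exact fun z _ => hκ.diff z
  · intro z _
    have : Differentiable ℝ h := hh.differentiable (by norm_num)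
    fun_prop

lemma integral_pd_eq_zero {κ : E m → ℝ} (hκ : Ker κ) (i : Fin m) : ∫ z, pd i κ z = 0 := by
  have := V_ibp hκ (h := fun _ => (1:ℝ)) contDiff_const 0 0 i
  simp [V] at this
  exact this.symm

end ker

/-! ### The explicit kernels -/
section kernels
variable {m : ℕ}
open MeasureTheory Topology Polynomial

noncomputable def eta (m : ℕ) (z : E m) : ℝ := expNegInvGlue (1 - ‖z‖ ^ 2)

noncomputable def rho (m : ℕ) (z : E m) : ℝ :=
  2 * (((1 - ‖z‖ ^ 2)⁻¹) ^ 2 * expNegInvGlue (1 - ‖z‖ ^ 2))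

lemma contDiff_one_sub (n : ℕ) : ContDiff ℝ n (fun z : E m => 1 - ‖z‖ ^ 2) :=
  contDiff_const.sub (contDiff_norm_sq ℝ)

lemma ker_eta : Ker (eta m) := by
  refine ⟨fun n => ?_, fun z hz => ?_⟩
  · exact (expNegInvGlue.contDiff (n := n)).comp (contDiff_one_sub n)
  · unfold eta
    exact expNegInvGlue.zero_of_nonpos (by nlinarith)

lemma ker_rho : Ker (rho m) := by
  refine ⟨fun n => ?_, fun z hz => ?_⟩
  · have h := (expNegInvGlue.contDiff_polynomial_eval_inv_mul (n := n) (X ^ 2 : ℝ[X]))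
    simp only [eval_pow, eval_X] at h
    exact contDiff_const.mul (h.comp (contDiff_one_sub n))
  · unfold rho
    rw [expNegInvGlue.zero_of_nonpos (by nlinarith)]; simp

lemma eta_nonneg (z : E m) : 0 ≤ eta m z := expNegInvGlue.nonneg _

lemma eta_le_rho (z : E m) : eta m z ≤ rho m z := by
  unfold eta rho
  rcases le_or_gt (1 - ‖z‖ ^ 2) 0 with h | h
  · rw [expNegInvGlue.zero_of_nonpos h]; simp
  · have h1 : 1 ≤ (1 - ‖z‖ ^ 2)⁻¹ := (one_le_inv₀ h).2 (by nlinarith [norm_nonneg z])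
    have h2 := expNegInvGlue.nonneg (1 - ‖z‖ ^ 2)
    have h3 : 1 ≤ ((1 - ‖z‖ ^ 2)⁻¹) ^ 2 := one_le_pow₀ h1
    nlinarith

lemma rho_nonneg (z : E m) : 0 ≤ rho m z := (eta_nonneg z).trans (eta_le_rho z)

lemma pd_eta (z : E m) (i : Fin m) : pd i (eta m) z = - (z i * rho m z) := by
  have h1 : HasFDerivAt (fun x : E m => 1 - ‖x‖ ^ 2) (- gl fun i => 2 * z i) z := by
    have := (hasFDerivAt_normsq (0 : E m) z).const_sub 1
    simpa using this
  have h2 := expNegInvGlue.hasDerivAt_polynomial_eval_inv_mul 1 (1 - ‖z‖ ^ 2)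
  have h3 := h2.comp_hasFDerivAt z h1
  have e : (eta m) = ((fun x => eval x⁻¹ (1 : ℝ[X]) * expNegInvGlue x) ∘ fun x : E m => 1 - ‖x‖ ^ 2) := by
    funext x; simp [eta]
  rw [pd, e, h3.fderiv]
  simp only [_root_.smul_apply, _root_.neg_apply, gl_ee, rho]
  simp
  ring

noncomputable def Mr (m : ℕ) : ℝ := ∫ z, rho m z
noncomputable def Ie (m : ℕ) : ℝ := ∫ z, eta m z

lemma Ie_pos : 0 < Ie m := by
  unfold Ie
  refine (ker_eta (m := m)).cont.integral_pos_of_hasCompactSupport_nonneg_nonzero ker_eta.cs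
    eta_nonneg (x := 0) ?_
  have : 0 < eta m 0 := by
    unfold eta; exact expNegInvGlue.pos_of_pos (by simp)
  exact this.ne'

lemma Ie_le_Mr : Ie m ≤ Mr m :=
  integral_mono ker_eta.integrable ker_rho.integrable eta_le_rho

lemma Mr_pos : 0 < Mr m := Ie_pos.trans_le Ie_le_Mr

lemma mass_eta : mass (eta m) = Ie m := by
  unfold mass Ie; congr 1; funext z; exact abs_of_nonneg (eta_nonneg z)
lemma mass_rho : mass (rho m) = Mr m := by
  unfold mass Mr; congr 1; funext z; exact abs_of_nonneg (rho_nonneg z)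

end kernels
end EPP

namespace EPP
section v6
variable {m : ℕ}
open MeasureTheory Topology

noncomputable def dlap (m : ℕ) (z : E m) : ℝ := ∑ i, pd i (pd i (eta m)) z

lemma ker_dlap : Ker (dlap m) := Ker.sum _ fun i => (ker_eta.pd i).pd i

lemma dlap_eq (z : E m) : dlap m z = -(m * rho m z) - fderiv ℝ (rho m) z z := by
  unfold dlap
  have h1 : ∀ i : Fin m, pd i (pd i (eta m)) z = - rho m z - z i * pd i (rho m) z := by
    intro i
    have e : pd i (eta m) = fun z => - (z i * rho m z) := funext fun z => pd_eta z i
    rw [e]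
    have hp : HasFDerivAt (fun z : E m => z i) (EuclideanSpace.proj i : E m →L[ℝ] ℝ) z :=
      (EuclideanSpace.proj i : E m →L[ℝ] ℝ).hasFDerivAt
    have := (hp.mul (ker_rho.diff z).hasFDerivAt).neg
    unfold pd
    rw [HasFDerivAt.fderiv (f := fun z : E m => - (z i * rho m z)) this]
    simp
    ring
  rw [Finset.sum_congr rfl fun i _ => h1 i, fderiv_eq_gl, gl_apply, Finset.sum_sub_distrib]
  simp [mul_comm]

lemma V_hasDerivAt {h : E m → ℝ} (hh : Continuous h) {s : ℝ} (hs : 0 < s) (x : E m) :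
    HasDerivAt (fun s => V (rho m) s h x) (s⁻¹ * V (dlap m) s h x) s := by
  set D : E m → ℝ := fun z => fderiv ℝ (rho m) z z with hD
  have hDc : Continuous D := by
    have := (ker_rho (m := m)).smooth 1 |>.continuous_fderiv (by norm_num)
    fun_prop
  have hDs : ∀ z, 1 < ‖z‖ → D z = 0 := by
    intro z hz
    have : ∀ᶠ y in 𝓝 z, rho m y = 0 := by
      filter_upwards [continuous_norm.continuousAt.eventually (lt_mem_nhds hz)] with y hy
      exact ker_rho.supp y hy
    have h2 : fderiv ℝ (rho m) z = 0 := by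
      have := Filter.EventuallyEq.fderiv_eq (𝕜 := ℝ) (f₁ := rho m) (f := fun _ => (0:ℝ)) this
      rw [this]; simp
    simp [hD, h2]
  obtain ⟨M, hM⟩ : ∃ M, ∀ z, |D z| ≤ M := by
    have hcs : HasCompactSupport D := HasCompactSupport.intro (isCompact_closedBall (0 : E m) 1)
      fun z hz => hDs z (by simpa using hz)
    obtain ⟨M, hM⟩ := hcs.exists_bound_of_continuous hDc
    exact ⟨M, hM⟩
  have hM0 : 0 ≤ M := (abs_nonneg _).trans (hM 0)
  have key : HasDerivAt (fun s => ∫ t, h t * rho m (s⁻¹ • (x - t)))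
      (∫ t, h t * (-(s⁻¹) * D (s⁻¹ • (x - t)))) s := by
    refine (hasDerivAt_integral_of_dominated_loc_of_deriv_le
      (F := fun s t => h t * rho m (s⁻¹ • (x - t)))
      (F' := fun s t => h t * (-(s⁻¹) * D (s⁻¹ • (x - t))))
      (s := Metric.ball s (s/2))
      (bound := (Metric.closedBall x (2 * s)).indicator fun t => |h t| * (2 / s * M))
      (Metric.ball_mem_nhds s (by linarith)) ?_ ?_ ?_ ?_ ?_ ?_).2
    · refine Eventually.of_forall fun s' => Continuous.aestronglyMeasurable ?_
      have := (ker_rho (m := m)).cont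
      fun_prop
    · refine Continuous.integrable_of_hasCompactSupport ?_ ?_
      · have := (ker_rho (m := m)).cont
        fun_prop
      · refine HasCompactSupport.intro (isCompact_closedBall x s) fun t ht => ?_
        rw [ker_rho.supp, mul_zero]
        rw [norm_smul, norm_inv, Real.norm_eq_abs, abs_of_pos hs]
        simp only [Metric.mem_closedBall, not_le, dist_eq_norm] at ht
        rw [norm_sub_rev]
        rw [inv_mul_eq_div, one_lt_div hs]; exact ht
    · refine Continuous.aestronglyMeasurable ?_
      fun_prop
    · refine Eventually.of_forall fun t s' hs' => ?_
      have hs'1 : s / 2 < s' ∧ s' < 2 * s := by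
        rw [Metric.mem_ball, Real.dist_eq, abs_lt] at hs'
        constructor <;> linarith [hs'.1, hs'.2]
      have hs'0 : 0 < s' := by linarith
      by_cases ht : t ∈ Metric.closedBall x (2 * s)
      · rw [Set.indicator_of_mem ht, norm_mul, norm_mul, norm_neg]
        simp only [Real.norm_eq_abs, abs_inv, abs_of_pos hs'0]
        have e1 : s'⁻¹ ≤ 2 / s := by
          rw [inv_le_comm₀ hs'0 (by positivity), inv_div]; exact hs'1.1.le
        gcongr
        exact hM _
      · rw [Set.indicator_of_notMem ht, hDs, mul_zero, mul_zero, norm_zero]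
        rw [norm_smul, norm_inv, Real.norm_eq_abs, abs_of_pos hs'0]
        simp only [Metric.mem_closedBall, not_le, dist_eq_norm] at ht
        rw [norm_sub_rev, inv_mul_eq_div, one_lt_div hs'0]; linarith
    · refine (ContinuousOn.integrableOn_compact (isCompact_closedBall x (2*s)) ?_).integrable_indicator
        measurableSet_closedBall
      fun_prop
    · refine Eventually.of_forall fun t s' hs' => ?_
      have hs'0 : 0 < s' := by
        rw [Metric.mem_ball, Real.dist_eq, abs_lt] at hs'; linarith [hs'.1]
      have h1 : HasDerivAt (fun s : ℝ => s⁻¹ • (x - t)) ((-(s' ^ 2)⁻¹) • (x - t)) s' :=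
        (hasDerivAt_inv hs'0.ne').smul_const (x - t)
      have h2 := ((ker_rho (m := m)).diff (s'⁻¹ • (x - t))).hasFDerivAt.comp_hasDerivAt s' h1
      have h3 := h2.const_mul (h t)
      convert! h3 using 1
      simp only [hD, map_smul, smul_eq_mul]
      ring
  have hp : HasDerivAt (fun s : ℝ => (s ^ m)⁻¹) (-(m * s⁻¹ * (s ^ m)⁻¹)) s := by
    have := (hasDerivAt_pow m s).inv (pow_ne_zero m hs.ne')
    convert! this using 1
    rcases Nat.eq_zero_or_pos m with rfl | hm
    · simp
    · obtain ⟨k, rfl⟩ : ∃ k, m = k + 1 := ⟨m - 1, by omega⟩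
      simp only [Nat.add_sub_cancel]
      field_simp
      ring
  have hfin := hp.mul key
  have heq : (fun s => V (rho m) s h x) =ᶠ[𝓝 s]
      fun s => (s ^ m)⁻¹ * ∫ t, h t * rho m (s⁻¹ • (x - t)) := by
    filter_upwards [lt_mem_nhds hs] with s' hs'
    exact V_eq_conv _ hs' x
  refine (HasDerivAt.congr_of_eventuallyEq hfin heq).congr_deriv ?_
  have e2 : V (dlap m) s h x = -(m * V (rho m) s h x) - V D s h x := by
    unfold V
    have : ∀ z, dlap m z * h (x - s • z)
       = -(m * (rho m z * h (x - s • z))) - D z * h (x - s • z) := by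
      intro z; rw [dlap_eq]; ring
    simp only [this]
    rw [integral_sub, integral_neg, integral_const_mul]
    · exact ((V_integrable ker_rho hh s x).const_mul _).neg
    · have : HasCompactSupport D := HasCompactSupport.intro (isCompact_closedBall (0 : E m) 1)
        fun z hz => hDs z (by simpa using hz)
      exact Continuous.integrable_of_hasCompactSupport (by fun_prop) this.mul_right
  rw [e2, V_eq_conv _ hs, V_eq_conv _ hs]
  have e3 : ∫ t, h t * (-(s⁻¹) * D (s⁻¹ • (x - t))) = -(s⁻¹) * ∫ t, h t * D (s⁻¹ • (x - t)) := by
    rw [← integral_const_mul]; congr 1; funext t; ring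
  rw [e3]
  ring

end v6
end EPP

namespace EPP
section jop
variable {m : ℕ}
open MeasureTheory Topology Set

noncomputable def J (w : ℝ → ℝ) (κ : E m → ℝ) (r : ℝ) (h : E m → ℝ) (x : E m) : ℝ :=
  ∫ s in (0:ℝ)..r, w s * V κ s h x

/-- local domination of the integrand -/
def Dom (w : ℝ → ℝ) (κ : E m → ℝ) (r : ℝ) (h : E m → ℝ) : Prop :=
  ∀ x0 : E m, ∃ b : ℝ → ℝ, IntervalIntegrable b volume 0 r ∧
    ∀ x ∈ Metric.ball x0 1, ∀ s ∈ Ioc 0 r, |w s * V κ s h x| ≤ b s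

/-- locally one-half Hoelder -/
def LH (h : E m → ℝ) : Prop :=
  ∀ R : ℝ, ∃ C : ℝ, 0 ≤ C ∧ ∀ x y : E m, ‖x‖ ≤ R → ‖y‖ ≤ R → |h x - h y| ≤ C * √‖x - y‖

lemma LH.cont {h : E m → ℝ} (hh : LH h) : Continuous h := by
  rw [continuous_iff_continuousAt]
  intro x
  obtain ⟨C, hC0, hC⟩ := hh (‖x‖ + 1)
  rw [ContinuousAt, tendsto_iff_dist_tendsto_zero]
  have hlim : Tendsto (fun y => C * √‖y - x‖) (𝓝 x) (𝓝 0) := by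
    have : Continuous fun y => C * √‖y - x‖ := by fun_prop
    simpa using this.tendsto x
  refine squeeze_zero' (Eventually.of_forall fun _ => dist_nonneg) ?_ hlim
  filter_upwards [Metric.ball_mem_nhds x one_pos] with y hy
  rw [Real.dist_eq]
  refine hC y x ?_ (by linarith)
  rw [mem_ball_iff_norm] at hy
  have := norm_add_le x (y - x)
  simp only [add_sub_cancel] at this
  linarith

lemma exists_bound_ball {h : E m → ℝ} (hh : Continuous h) (R : ℝ) :
    ∃ C, 0 ≤ C ∧ ∀ x : E m, ‖x‖ ≤ R → |h x| ≤ C := by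
  obtain ⟨C, hC⟩ := (isCompact_closedBall (0 : E m) R).exists_bound_of_continuousOn
    hh.continuousOn
  exact ⟨|C|, abs_nonneg _, fun x hx => (hC x (by simpa using hx)).trans (le_abs_self C)⟩

lemma dom_of_bounded {w : ℝ → ℝ} {κ : E m → ℝ} (hκ : Ker κ) {r : ℝ} (hr : r ≤ 1)
    {h : E m → ℝ} (hh : Continuous h) {W : ℝ} (hw : ∀ s ∈ Ioc 0 r, |w s| ≤ W) :
    Dom w κ r h := by
  intro x0
  obtain ⟨C, hC0, hC⟩ := exists_bound_ball hh (‖x0‖ + 2)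
  refine ⟨fun _ => W * (mass κ * C), intervalIntegrable_const, fun x hx s hs => ?_⟩
  rw [abs_mul]
  have hW : 0 ≤ W := (abs_nonneg _).trans (hw s hs)
  refine mul_le_mul (hw s hs) (V_bound hκ x hs.1.le (hs.2.trans hr) fun q hq => hC q ?_)
    (abs_nonneg _) hW
  rw [mem_ball_iff_norm] at hx
  have := norm_add₃_le (a := q - x) (b := x - x0) (c := x0)
  simp only [sub_add_sub_cancel, sub_add_cancel] at this
  linarith

lemma sqrt_inv_integrable (r : ℝ) : IntervalIntegrable (fun s : ℝ => (√s)⁻¹) volume 0 r := by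
  have := intervalIntegral.intervalIntegrable_rpow' (a := 0) (b := r) (r := -(1/2)) (by norm_num)
  by_cases hr : 0 ≤ r
  · refine this.congr fun s hs => ?_
    rw [uIoc_of_le hr] at hs
    rw [Real.sqrt_eq_rpow, ← Real.rpow_neg hs.1.le]
  · push Not at hr
    rw [intervalIntegrable_iff, uIoc_of_ge hr.le]
    refine (integrableOn_zero).congr_fun (f := fun _ => (0:ℝ)) (fun s hs => ?_) measurableSet_Ioc
    rw [Real.sqrt_eq_zero_of_nonpos hs.2]; simp

lemma integral_sqrt_inv {r : ℝ} (hr0 : 0 ≤ r) : ∫ s in (0:ℝ)..r, (√s)⁻¹ = 2 * √r := by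
  have h := integral_rpow (a := 0) (b := r) (r := -(1/2)) (Or.inl (by norm_num))
  have e : ∫ s in (0:ℝ)..r, (√s)⁻¹ = ∫ s in (0:ℝ)..r, s ^ (-(1/2) : ℝ) := by
    refine intervalIntegral.integral_congr fun s hs => ?_
    rw [uIcc_of_le hr0] at hs
    rw [Real.sqrt_eq_rpow, ← Real.rpow_neg hs.1]
  rw [e, h, Real.sqrt_eq_rpow]
  norm_num
  ring

lemma dom_of_hoelder {w : ℝ → ℝ} {κ : E m → ℝ} (hκ : Ker κ) (hz : ∫ z, κ z = 0) {r : ℝ}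
    (hr : r ≤ 1) {h : E m → ℝ} (hh : LH h) {W : ℝ} (hw : ∀ s ∈ Ioc 0 r, |w s| ≤ W * s⁻¹) :
    Dom w κ r h := by
  intro x0
  obtain ⟨C, hC0, hC⟩ := hh (‖x0‖ + 2)
  refine ⟨fun s => W * (mass κ * C) * (√s)⁻¹, (sqrt_inv_integrable r).const_mul _,
    fun x hx s hs => ?_⟩
  rw [abs_mul]
  have hW : 0 ≤ W * s⁻¹ := (abs_nonneg _).trans (hw s hs)
  have h1 : |V κ s h x| ≤ mass κ * (C * √s) := by
    refine V_hoelder hκ hz hh.cont x hs.1.le (hs.2.trans hr) fun q hq => hC q x ?_ ?_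
    · rw [mem_ball_iff_norm] at hx
      have := norm_add₃_le (a := q - x) (b := x - x0) (c := x0)
      simp only [sub_add_sub_cancel, sub_add_cancel] at this
      linarith
    · rw [mem_ball_iff_norm] at hx
      have := norm_add_le (x - x0) (x0)
      simp only [sub_add_cancel] at this
      linarith
  refine (mul_le_mul (hw s hs) h1 (abs_nonneg _) hW).trans (le_of_eq ?_)
  have : √s * √s = s := Real.mul_self_sqrt hs.1.le
  have h0 : 0 < √s := Real.sqrt_pos.2 hs.1
  have h2 : s⁻¹ * √s = (√s)⁻¹ := by
    rw [inv_mul_eq_div, div_eq_iff hs.1.ne', eq_comm, inv_mul_eq_div, div_eq_iff h0.ne', this]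
  simp only [← h2]; ring

lemma aesm {w : ℝ → ℝ} (hw : Measurable w) {κ : E m → ℝ} (hκ : Ker κ) {h : E m → ℝ}
    (hh : Continuous h) (x : E m) (μ : Measure ℝ) :
    AEStronglyMeasurable (fun s => w s * V κ s h x) μ :=
  hw.aestronglyMeasurable.mul (V_cont_s hκ hh x).aestronglyMeasurable

lemma Dom.integrable {w : ℝ → ℝ} (hw : Measurable w) {κ : E m → ℝ} (hκ : Ker κ) {r : ℝ}
    (hr0 : 0 ≤ r) {h : E m → ℝ} (hh : Continuous h) (hd : Dom w κ r h) (x : E m) :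
    IntervalIntegrable (fun s => w s * V κ s h x) volume 0 r := by
  obtain ⟨b, hb, hbd⟩ := hd x
  refine hb.mono_fun' (aesm hw hκ hh x _) ?_
  rw [uIoc_of_le hr0]
  filter_upwards [ae_restrict_mem measurableSet_Ioc] with s hs
  exact hbd x (Metric.mem_ball_self one_pos) s hs

lemma Dom.cont {w : ℝ → ℝ} (hw : Measurable w) {κ : E m → ℝ} (hκ : Ker κ) {r : ℝ}
    (hr0 : 0 ≤ r) {h : E m → ℝ} (hh : Continuous h) (hd : Dom w κ r h) :
    Continuous (J w κ r h) := by
  rw [continuous_iff_continuousAt]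
  intro x0
  obtain ⟨b, hb, hbd⟩ := hd x0
  refine intervalIntegral.continuousAt_of_dominated_interval (bound := b)
    (Eventually.of_forall fun x => aesm hw hκ hh x _) ?_ hb ?_
  · filter_upwards [Metric.ball_mem_nhds x0 one_pos] with x hx
    refine Eventually.of_forall fun s hs => ?_
    rw [uIoc_of_le hr0] at hs
    exact hbd x hx s hs
  · refine Eventually.of_forall fun s hs => ?_
    exact (continuous_const.mul (V_cont_x hκ hh s)).continuousAt

lemma J_hasFDerivAt {w w' : ℝ → ℝ} (hw : Measurable w) (hw' : Measurable w')
    (hww : ∀ s > 0, w s = s * w' s) {κ : E m → ℝ} (hκ : Ker κ) {r : ℝ}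
    (hr0 : 0 ≤ r) {h : E m → ℝ} (hh : Continuous h) (hd : Dom w κ r h)
    (hd' : ∀ i, Dom w' (pd i κ) r h) (x : E m) :
    HasFDerivAt (J w κ r h) (gl fun i => J w' (pd i κ) r h x) x := by
  choose b hb hbd using fun i => hd' i x
  set F' : E m → ℝ → (E m →L[ℝ] ℝ) := fun x s => gl fun i => w' s * V (pd i κ) s h x with hF'
  have hmeas : ∀ x, AEStronglyMeasurable (F' x) (volume.restrict (uIoc 0 r)) := by
    intro x
    rw [hF']
    unfold gl
    refine Finset.aestronglyMeasurable_fun_sum _ fun i _ => ?_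
    exact (aesm hw' (hκ.pd i) hh x _).smul_const _
  have hbs : IntervalIntegrable (fun s => ∑ i, b i s) volume 0 r := by
    have := IntervalIntegrable.sum Finset.univ (fun i _ => hb i)
    convert! this using 1
    funext s; simp
  have hnb : ∀ s ∈ Ioc 0 r, ∀ y ∈ Metric.ball x 1, ‖F' y s‖ ≤ ∑ i, b i s := by
    intro s hs y hy
    refine (norm_gl_le _).trans (Finset.sum_le_sum fun i _ => hbd i y hy s hs)
  have key := intervalIntegral.hasFDerivAt_integral_of_dominated_of_fderiv_le
    (F := fun x s => w s * V κ s h x) (F' := F') (bound := fun s => ∑ i, b i s) (a := 0) (b := r)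
    (μ := volume) (Metric.ball_mem_nhds x one_pos)
    (Eventually.of_forall fun y => aesm hw hκ hh y _) (hd.integrable hw hκ hr0 hh x)
    (hmeas x) (Eventually.of_forall fun s hs y hy => hnb s (by rwa [uIoc_of_le hr0] at hs) y hy)
    hbs ?_
  · have hintg : IntervalIntegrable (F' x) volume 0 r := by
      refine hbs.mono_fun' (hmeas x) ?_
      rw [uIoc_of_le hr0]
      filter_upwards [ae_restrict_mem measurableSet_Ioc] with s hs
      exact hnb s hs x (Metric.mem_ball_self one_pos)
    convert! key using 1
    rw [eq_gl (∫ t in (0:ℝ)..r, F' x t)]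
    congr 1
    funext i
    rw [ContinuousLinearMap.intervalIntegral_apply hintg]
    simp only [hF', gl_ee]
    rfl
  · refine Eventually.of_forall fun s hs y hy => ?_
    rw [uIoc_of_le hr0] at hs
    have := (V_hasFDerivAt hκ hh hs.1 y).const_mul (w s)
    convert! this using 1
    rw [eq_gl (w s • _)]
    simp only [hF']
    congr 1
    funext i
    simp only [_root_.smul_apply, gl_ee, smul_eq_mul]
    rw [hww s hs.1]
    have := hs.1.ne'
    field_simp

lemma J_bound {w : ℝ → ℝ} {κ : E m → ℝ} (hκ : Ker κ) {r : ℝ} (hr0 : 0 ≤ r) (hr : r ≤ 1)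
    {h : E m → ℝ} {W C : ℝ} (x : E m) (hw : ∀ s ∈ Ioc 0 r, |w s| ≤ W)
    (hC : ∀ q, ‖q - x‖ ≤ 1 → |h q| ≤ C) : |J w κ r h x| ≤ W * (mass κ * C) * r := by
  unfold J
  have := intervalIntegral.norm_integral_le_of_norm_le_const (a := 0) (b := r)
    (f := fun s => w s * V κ s h x) (C := W * (mass κ * C)) ?_
  · simpa [abs_of_nonneg hr0] using this
  · intro s hs
    rw [uIoc_of_le hr0] at hs
    rw [norm_mul]
    exact mul_le_mul (hw s hs) (V_bound hκ x hs.1.le (hs.2.trans hr) hC)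
      (abs_nonneg _) ((abs_nonneg _).trans (hw s hs))

noncomputable def hc (κ : E m → ℝ) : ℝ := 2 * (2 * mass κ + ∑ i, mass (pd i κ))

lemma hc_nonneg (κ : E m → ℝ) : 0 ≤ hc κ := by
  unfold hc
  have := mass_nonneg κ
  have : 0 ≤ ∑ i, mass (pd i κ) := Finset.sum_nonneg fun i _ => mass_nonneg _
  positivity

lemma V_diff {κ : E m → ℝ} (hκ : Ker κ) {s : ℝ} (hs0 : 0 < s) (hs : s ≤ 1)
    {h : E m → ℝ} (hh : Continuous h) {B : ℝ} {S : Set (E m)} (hS : Convex ℝ S)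
    (hB : ∀ x ∈ S, ∀ q, ‖q - x‖ ≤ 1 → |h q| ≤ B) {x y : E m} (hx : x ∈ S) (hy : y ∈ S) :
    |V κ s h x - V κ s h y| ≤ (2 * mass κ + ∑ i, mass (pd i κ)) * B * (√‖x - y‖ * (√s)⁻¹) := by
  have hB0 : 0 ≤ B := (abs_nonneg _).trans (hB x hx x (by simp))
  set M := ∑ i, mass (pd i κ) with hM
  have hM0 : 0 ≤ M := Finset.sum_nonneg fun i _ => mass_nonneg _
  have hm0 := mass_nonneg κ
  have b1 : |V κ s h x - V κ s h y| ≤ 2 * mass κ * B := by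
    have h1 := V_bound hκ x hs0.le hs (hB x hx)
    have h2 := V_bound hκ y hs0.le hs (hB y hy)
    have := abs_sub (V κ s h x) (V κ s h y)
    linarith
  have b2 : |V κ s h x - V κ s h y| ≤ M * B * (‖x - y‖ * s⁻¹) := by
    have := hS.norm_image_sub_le_of_norm_hasFDerivWithin_le (f := fun x => V κ s h x)
      (f' := fun x => gl fun i => s⁻¹ * V (pd i κ) s h x) (C := M * B * s⁻¹)
      (fun z _ => (V_hasFDerivAt hκ hh hs0 z).hasFDerivWithinAt) (fun z hz => ?_) hy hx
    · rw [Real.norm_eq_abs] at this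
      refine this.trans (le_of_eq (by ring))
    · refine (norm_gl_le _).trans ?_
      rw [hM, Finset.sum_mul, Finset.sum_mul]
      refine Finset.sum_le_sum fun i _ => ?_
      rw [abs_mul, abs_of_pos (inv_pos.2 hs0), mul_comm]
      exact mul_le_mul_of_nonneg_right (V_bound (hκ.pd i) z hs0.le hs (hB z hz))
        (inv_pos.2 hs0).le
  set d := ‖x - y‖
  have e : √d * (√s)⁻¹ = √(d * s⁻¹) := by
    rw [Real.sqrt_mul (norm_nonneg _), Real.sqrt_inv]
  rw [e]
  have hq : 0 ≤ d * s⁻¹ := by positivity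
  rcases le_total 1 (d * s⁻¹) with h1 | h1
  · have : 1 ≤ √(d * s⁻¹) := Real.one_le_sqrt.2 h1
    calc _ ≤ 2 * mass κ * B := b1
      _ ≤ (2 * mass κ + M) * B * 1 := by nlinarith
      _ ≤ _ := by gcongr
  · have : d * s⁻¹ ≤ √(d * s⁻¹) := Real.le_sqrt_of_sq_le (by nlinarith)
    calc _ ≤ M * B * (d * s⁻¹) := b2
      _ ≤ (2 * mass κ + M) * B * (d * s⁻¹) := by gcongr; linarith
      _ ≤ _ := by gcongr

lemma J_hoelder {w : ℝ → ℝ} (hwm : Measurable w) {κ : E m → ℝ} (hκ : Ker κ) {r : ℝ} (hr0 : 0 ≤ r)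
    (hr : r ≤ 1)
    {h : E m → ℝ} (hh : Continuous h) {W B : ℝ} (hw : ∀ s ∈ Ioc 0 r, |w s| ≤ W) (hW : 0 ≤ W)
    {S : Set (E m)} (hS : Convex ℝ S)
    (hB : ∀ x ∈ S, ∀ q, ‖q - x‖ ≤ 1 → |h q| ≤ B) {x y : E m} (hx : x ∈ S) (hy : y ∈ S) :
    |J w κ r h x - J w κ r h y| ≤ hc κ * W * B * √‖x - y‖ := by
  have hB0 : 0 ≤ B := (abs_nonneg _).trans (hB x hx x (by simp))
  have hd := dom_of_bounded hκ hr hh hw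
  unfold J
  rw [← intervalIntegral.integral_sub (hd.integrable hwm hκ hr0 hh x)
    (hd.integrable hwm hκ hr0 hh y)]
  set A := W * ((2 * mass κ + ∑ i, mass (pd i κ)) * B * √‖x - y‖) with hA
  have hA0 : 0 ≤ A := by
    have h1 := mass_nonneg κ
    have h2 : 0 ≤ ∑ i, mass (pd i κ) := Finset.sum_nonneg fun i _ => mass_nonneg _
    positivity
  have := intervalIntegral.norm_integral_le_of_norm_le (a := 0) (b := r) (μ := volume)
    (f := fun s => w s * V κ s h x - w s * V κ s h y) (g := fun s => A * (√s)⁻¹) hr0 ?_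
    ((sqrt_inv_integrable r).const_mul _)
  · rw [Real.norm_eq_abs, intervalIntegral.integral_const_mul, integral_sqrt_inv hr0] at this
    refine this.trans ?_
    have : √r ≤ 1 := Real.sqrt_le_one.2 hr
    calc A * (2 * √r) ≤ A * (2 * 1) := by gcongr
      _ = _ := by rw [hA, hc]; ring
  · refine Eventually.of_forall fun s hs => ?_
    rw [← mul_sub, norm_mul]
    calc ‖w s‖ * ‖V κ s h x - V κ s h y‖
        ≤ W * ((2 * mass κ + ∑ i, mass (pd i κ)) * B * (√‖x - y‖ * (√s)⁻¹)) :=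
          mul_le_mul (hw s hs) (V_diff hκ hs.1 (hs.2.trans hr) hh hS hB hx hy) (norm_nonneg _) hW
      _ = _ := by rw [hA]; ring

end jop
end EPP

namespace EPP
section tq
variable {m : ℕ}
open MeasureTheory Topology Set

structure Wt (w w1 w0 : ℝ → ℝ) (r : ℝ) : Prop where
  hm : Measurable w
  hm1 : Measurable w1
  hm0 : Measurable w0
  e1 : ∀ s > 0, w s = s * w1 s
  e0 : ∀ s > 0, w1 s = s * w0 s
  r0 : 0 < r
  r1 : r ≤ 1
  b1 : ∀ s ∈ Ioc 0 r, |w1 s| ≤ 1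

lemma Wt.b {w w1 w0 : ℝ → ℝ} {r : ℝ} (H : Wt w w1 w0 r) : ∀ s ∈ Ioc 0 r, |w s| ≤ 1 := by
  intro s hs
  rw [H.e1 s hs.1, abs_mul, abs_of_pos hs.1]
  have := H.b1 s hs
  have := H.r1
  have := hs.2
  have := hs.1
  have := abs_nonneg (w1 s)
  nlinarith

lemma Wt.br {w w1 w0 : ℝ → ℝ} {r : ℝ} (H : Wt w w1 w0 r) : ∀ s ∈ Ioc 0 r, |w s| ≤ r := by
  intro s hs
  rw [H.e1 s hs.1, abs_mul, abs_of_pos hs.1]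
  have := H.b1 s hs
  have := H.r1
  have := hs.2
  have := hs.1
  have := abs_nonneg (w1 s)
  nlinarith

lemma Wt.b0 {w w1 w0 : ℝ → ℝ} {r : ℝ} (H : Wt w w1 w0 r) : ∀ s ∈ Ioc 0 r, |w0 s| ≤ 1 * s⁻¹ := by
  intro s hs
  have h1 := H.b1 s hs
  rw [H.e0 s hs.1, abs_mul, abs_of_pos hs.1] at h1
  rw [one_mul, ← one_div, le_div_iff₀ hs.1]
  linarith

lemma Wt.J_c1 {w w1 w0 : ℝ → ℝ} {r : ℝ} (H : Wt w w1 w0 r) {κ : E m → ℝ} (hκ : Ker κ)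
    {h : E m → ℝ} (hh : Continuous h) (x : E m) :
    HasFDerivAt (J w κ r h) (gl fun i => J w1 (pd i κ) r h x) x :=
  J_hasFDerivAt H.hm H.hm1 H.e1 hκ H.r0.le hh (dom_of_bounded hκ H.r1 hh H.b)
    (fun i => dom_of_bounded (hκ.pd i) H.r1 hh H.b1) x

lemma Wt.J_cont {w w1 w0 : ℝ → ℝ} {r : ℝ} (H : Wt w w1 w0 r) {κ : E m → ℝ} (hκ : Ker κ)
    {h : E m → ℝ} (hh : Continuous h) : Continuous (J w κ r h) :=
  (dom_of_bounded hκ H.r1 hh H.b).cont H.hm hκ H.r0.le hh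

lemma Wt.J1_cont {w w1 w0 : ℝ → ℝ} {r : ℝ} (H : Wt w w1 w0 r) {κ : E m → ℝ} (hκ : Ker κ)
    {h : E m → ℝ} (hh : Continuous h) : Continuous (J w1 κ r h) :=
  (dom_of_bounded hκ H.r1 hh H.b1).cont H.hm1 hκ H.r0.le hh

lemma Wt.J_pd {w w1 w0 : ℝ → ℝ} {r : ℝ} (H : Wt w w1 w0 r) {κ : E m → ℝ} (hκ : Ker κ)
    {h : E m → ℝ} (hh : Continuous h) (i : Fin m) : pd i (J w κ r h) = J w1 (pd i κ) r h :=
  funext fun x => pd_of_hasFDerivAt (H.J_c1 hκ hh x) i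

lemma Wt.J1_d {w w1 w0 : ℝ → ℝ} {r : ℝ} (H : Wt w w1 w0 r) {κ : E m → ℝ} (hκ : Ker κ)
    {h : E m → ℝ} (hh : LH h) (x : E m) :
    HasFDerivAt (J w1 κ r h) (gl fun i => J w0 (pd i κ) r h x) x :=
  J_hasFDerivAt H.hm1 H.hm0 H.e0 hκ H.r0.le hh.cont (dom_of_bounded hκ H.r1 hh.cont H.b1)
    (fun i => dom_of_hoelder (hκ.pd i) (integral_pd_eq_zero hκ i) H.r1 hh H.b0) x

lemma Wt.J_c2 {w w1 w0 : ℝ → ℝ} {r : ℝ} (H : Wt w w1 w0 r) {κ : E m → ℝ} (hκ : Ker κ)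
    {h : E m → ℝ} (hh : LH h) : ContDiff ℝ 2 (J w κ r h) := by
  refine contDiff_two_of (H.J_c1 hκ hh.cont) fun i => ?_
  refine contDiff_one_of (H.J1_d (hκ.pd i) hh) fun j => ?_
  exact (dom_of_hoelder ((hκ.pd i).pd j) (integral_pd_eq_zero (hκ.pd i) j) H.r1 hh H.b0).cont
    H.hm0 ((hκ.pd i).pd j) H.r0.le hh.cont

lemma Wt.J_lap {w w1 w0 : ℝ → ℝ} {r : ℝ} (H : Wt w w1 w0 r) {κ : E m → ℝ} (hκ : Ker κ)
    {h : E m → ℝ} (hh : LH h) (x : E m) :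
    lap (J w κ r h) x = ∑ i, J w0 (pd i (pd i κ)) r h x := by
  rw [lap_eq (H.J_c2 hκ hh)]
  refine Finset.sum_congr rfl fun i _ => ?_
  rw [H.J_pd hκ hh.cont]
  exact pd_of_hasFDerivAt (H.J1_d (hκ.pd i) hh x) i

structure KR (k r : ℝ) : Prop where
  r0 : 0 < r
  r1 : r ≤ 1
  e : k * r ^ 2 = 1

lemma KR.k1 {k r : ℝ} (h : KR k r) : 1 ≤ k := by
  have := h.e; have := h.r0; have := h.r1
  by_contra hk
  push Not at hk
  have : r ^ 2 ≤ 1 := by nlinarith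
  have : 0 < r ^ 2 := by positivity
  nlinarith

noncomputable def T (k r : ℝ) (h : E m → ℝ) : E m → ℝ := J (fun s => s * (1 - k * s ^ 2)) (eta m) r h
noncomputable def Q (r : ℝ) (h : E m → ℝ) : E m → ℝ := J (fun s => s) (rho m) r h

lemma KR.cb {k r : ℝ} (h : KR k r) {s : ℝ} (hs : s ∈ Icc 0 r) :
    0 ≤ 1 - k * s ^ 2 ∧ 1 - k * s ^ 2 ≤ 1 := by
  have h1 := h.k1
  have h2 : k * s ^ 2 ≤ k * r ^ 2 := by
    have := hs.1; have := hs.2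
    gcongr
  have h3 : 0 ≤ k * s ^ 2 := by positivity
  have := h.e
  constructor <;> linarith

lemma KR.wtT {k r : ℝ} (h : KR k r) :
    Wt (fun s => s * (1 - k * s ^ 2)) (fun s => 1 - k * s ^ 2) (fun s => s⁻¹ * (1 - k * s ^ 2)) r where
  hm := by fun_prop
  hm1 := by fun_prop
  hm0 := by fun_prop
  e1 := fun s _ => rfl
  e0 := fun s hs => by field_simp
  r0 := h.r0
  r1 := h.r1
  b1 := fun s hs => by
    have := h.cb (Ioc_subset_Icc_self hs)
    rw [abs_of_nonneg this.1]; exact this.2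

lemma wtQ {r : ℝ} (h0 : 0 < r) (h1 : r ≤ 1) : Wt (fun s => s) (fun _ => 1) (fun s => s⁻¹) r where
  hm := by fun_prop
  hm1 := by fun_prop
  hm0 := by fun_prop
  e1 := fun s _ => by simp
  e0 := fun s hs => by field_simp
  r0 := h0
  r1 := h1
  b1 := fun s hs => by simp

lemma J_dlap {k r : ℝ} (H : KR k r) {h : E m → ℝ} (hh : Continuous h) (x : E m)
    (hintg : IntervalIntegrable (fun s => s⁻¹ * (1 - k * s ^ 2) * V (dlap m) s h x) volume 0 r) :
    J (fun s => s⁻¹ * (1 - k * s ^ 2)) (dlap m) r h x = - (Mr m * h x) + 2 * k * Q r h x := by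
  have hV := V_cont_s ker_rho hh x
  have h1 := intervalIntegral.integral_eq_sub_of_hasDerivAt_of_le H.r0.le
    (f := fun s => (1 - k * s ^ 2) * V (rho m) s h x)
    (f' := fun s => -(2 * k) * (s * V (rho m) s h x) + s⁻¹ * (1 - k * s ^ 2) * V (dlap m) s h x)
    (by fun_prop) ?_ ?_
  · rw [intervalIntegral.integral_add _ hintg, intervalIntegral.integral_const_mul, H.e, V_zero] at h1
    · unfold J Q J Mr
      simp at h1
      linarith
    · exact Continuous.intervalIntegrable (by fun_prop) _ _
  · intro s hs
    have hp : HasDerivAt (fun s : ℝ => 1 - k * s ^ 2) (-(2 * k * s)) s := by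
      have := ((hasDerivAt_pow 2 s).const_mul k).const_sub 1
      convert! this using 1
      simp; ring
    have := hp.mul (V_hasDerivAt hh hs.1 x)
    convert! this using 1
    ring
  · exact (Continuous.intervalIntegrable (by fun_prop) _ _).add hintg

lemma V_dlap (s : ℝ) {h : E m → ℝ} (hh : Continuous h) (x : E m) :
    V (dlap m) s h x = ∑ i, V (pd i (pd i (eta m))) s h x := by
  unfold V dlap
  rw [← integral_finsetSum _ fun i _ => V_integrable ((ker_eta.pd i).pd i) hh s x]
  congr 1; funext z; rw [Finset.sum_mul]

lemma T_c2 {k r : ℝ} (H : KR k r) {h : E m → ℝ} (hh : LH h) : ContDiff ℝ 2 (T k r h) :=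
  H.wtT.J_c2 ker_eta hh

lemma Q_c2 {r : ℝ} (h0 : 0 < r) (h1 : r ≤ 1) {h : E m → ℝ} (hh : LH h) : ContDiff ℝ 2 (Q r h) :=
  (wtQ h0 h1).J_c2 ker_rho hh

lemma T_lap {k r : ℝ} (H : KR k r) {h : E m → ℝ} (hh : LH h) (x : E m) :
    lap (T k r h) x = - (Mr m * h x) + 2 * k * Q r h x := by
  have hi : ∀ i, IntervalIntegrable
      (fun s => s⁻¹ * (1 - k * s ^ 2) * V (pd i (pd i (eta m))) s h x) volume 0 r := fun i =>
    (dom_of_hoelder ((ker_eta.pd i).pd i) (integral_pd_eq_zero (ker_eta.pd i) i) H.r1 hh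
      H.wtT.b0).integrable H.wtT.hm0 ((ker_eta.pd i).pd i) H.r0.le hh.cont x
  have he : (fun s => s⁻¹ * (1 - k * s ^ 2) * V (dlap m) s h x)
      = fun s => ∑ i, s⁻¹ * (1 - k * s ^ 2) * V (pd i (pd i (eta m))) s h x := by
    funext s; rw [V_dlap s hh.cont, Finset.mul_sum]
  rw [← J_dlap H hh.cont x, T, H.wtT.J_lap ker_eta hh]
  · unfold J
    rw [he, intervalIntegral.integral_finsetSum fun i _ => hi i]
  · rw [he]
    have := IntervalIntegrable.sum Finset.univ (fun i _ => hi i)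
    convert! this using 1
    funext s; simp

/-- representation formula -/
lemma rep {k r : ℝ} (H : KR k r) {v : E m → ℝ} (hv : ContDiff ℝ 2 v) (x : E m) :
    Mr m * v x = 2 * k * Q r v x - T k r (lap v) x := by
  have hl := continuous_lap hv
  have hk : ∀ s > 0, s⁻¹ * (1 - k * s ^ 2) * V (dlap m) s v x
      = s * (1 - k * s ^ 2) * V (eta m) s (lap v) x := by
    intro s hs
    have e1 : V (eta m) s (lap v) x = ∑ i, V (eta m) s (pd i (pd i v)) x := by
      unfold V
      rw [← integral_finsetSum _ fun i _ =>
        V_integrable ker_eta (continuous_pd (contDiff_pd hv i) i) s x]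
      congr 1; funext z; rw [lap_eq hv, Finset.mul_sum]
    have e2 : ∀ i, V (pd i (pd i (eta m))) s v x = s * (s * V (eta m) s (pd i (pd i v)) x) := by
      intro i
      rw [V_ibp ker_eta (contDiff_pd hv i), V_ibp (ker_eta.pd i) (hv.of_le (by norm_num))]
    rw [V_dlap s hv.continuous, Finset.sum_congr rfl fun i _ => e2 i, e1, Finset.mul_sum,
      Finset.mul_sum]
    refine Finset.sum_congr rfl fun i _ => ?_
    field_simp
  have hc := V_cont_s ker_eta hl x
  have hintg : IntervalIntegrable (fun s => s⁻¹ * (1 - k * s ^ 2) * V (dlap m) s v x) volume 0 r := by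
    have : IntervalIntegrable (fun s => s * (1 - k * s ^ 2) * V (eta m) s (lap v) x) volume 0 r :=
      Continuous.intervalIntegrable (by fun_prop) _ _
    refine this.congr fun s hs => ?_
    rw [uIoc_of_le H.r0.le] at hs
    exact (hk s hs.1).symm
  have h1 := J_dlap H hv.continuous x hintg
  have h2 : J (fun s => s⁻¹ * (1 - k * s ^ 2)) (dlap m) r v x = T k r (lap v) x := by
    unfold T J
    refine intervalIntegral.integral_congr_ae (Eventually.of_forall fun s hs => ?_)
    rw [uIoc_of_le H.r0.le] at hs
    exact hk s hs.1
  linarith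

end tq
end EPP

namespace EPP
section mp
variable {m : ℕ}
open MeasureTheory Topology Set

lemma penal {w : E m → ℝ} (hw : Continuous w) {B : ℝ} (hB : ∀ x, -B ≤ w x) {β : ℝ} (hβ : 0 < β)
    (x0 : E m) : ∃ xh, (∀ x, w xh + β * ‖xh - x0‖ ^ 2 ≤ w x + β * ‖x - x0‖ ^ 2) ∧
      β * ‖xh - x0‖ ^ 2 ≤ w x0 + B := by
  have hc : Continuous fun x => w x + β * ‖x - x0‖ ^ 2 := by fun_prop
  have hlim : Tendsto (fun x => w x + β * ‖x - x0‖ ^ 2) (cocompact (E m)) atTop := by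
    refine tendsto_atTop_add_left_of_le _ (-B) hB ?_
    refine Tendsto.const_mul_atTop hβ ?_
    refine (tendsto_pow_atTop (by norm_num)).comp ?_
    have := tendsto_norm_cocompact_atTop (E := E m)
    refine tendsto_atTop_mono (fun x => ?_) (tendsto_atTop_add_const_right _ (-‖x0‖) this)
    linarith [norm_sub_norm_le x x0]
  obtain ⟨xh, hxh⟩ := hc.exists_forall_le hlim
  refine ⟨xh, hxh, ?_⟩
  have h1 := hxh x0
  have h2 := hB xh
  simp at h1
  linarith

lemma omori {w : E m → ℝ} (hw : ContDiff ℝ 2 w) {B : ℝ} (hB : ∀ x, -B ≤ w x) (x0 : E m) {e : ℝ}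
    (he : 0 < e) : ∃ xh, w xh ≤ w x0 ∧ ‖fderiv ℝ w xh‖ ≤ e ∧ -e ≤ lap w xh := by
  set D := w x0 + B with hD
  have hD0 : 0 ≤ D := by have := hB x0; linarith
  obtain ⟨β, hβ, h1, h2⟩ : ∃ β > 0, 4 * β * D ≤ e ^ 2 ∧ β * (2 * m) ≤ e := by
    refine ⟨min (e ^ 2 / (4 * (D + 1))) (e / (2 * m + 1)), by positivity, ?_, ?_⟩
    · have := min_le_left (e ^ 2 / (4 * (D + 1))) (e / (2 * m + 1))
      calc 4 * min (e ^ 2 / (4 * (D + 1))) (e / (2 * m + 1)) * D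
          ≤ 4 * (e ^ 2 / (4 * (D + 1))) * D := by gcongr
        _ = e ^ 2 * (D / (D + 1)) := by field_simp
        _ ≤ e ^ 2 * 1 := by gcongr; exact (div_le_one (by linarith)).2 (by linarith)
        _ = e ^ 2 := mul_one _
    · have := min_le_right (e ^ 2 / (4 * (D + 1))) (e / (2 * m + 1))
      calc min (e ^ 2 / (4 * (D + 1))) (e / (2 * m + 1)) * (2 * m)
          ≤ (e / (2 * m + 1)) * (2 * m) := by gcongr
        _ = e * ((2 * m) / (2 * m + 1)) := by field_simp
        _ ≤ e * 1 := by gcongr; exact (div_le_one (by positivity)).2 (by linarith)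
        _ = e := mul_one _
  obtain ⟨xh, hx1, hx2⟩ := penal hw.continuous hB hβ x0
  have hq : ContDiff ℝ 2 fun x : E m => β * ‖x - x0‖ ^ 2 := contDiff_const.mul (contDiff_normsq x0)
  have hmin : IsLocalMin (fun x => w x + β * ‖x - x0‖ ^ 2) xh := Eventually.of_forall hx1
  obtain ⟨g1, g2⟩ := isLocalMin_lap (hw.add hq) hmin
  refine ⟨xh, ?_, ?_, ?_⟩
  · have := hx1 x0
    simp at this
    have : 0 ≤ β * ‖xh - x0‖ ^ 2 := by positivity
    linarith
  · have e1 : fderiv ℝ w xh = - (β • fderiv ℝ (fun x : E m => ‖x - x0‖ ^ 2) xh) := by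
      have h3 : HasFDerivAt (fun x => w x + β * ‖x - x0‖ ^ 2) (fderiv ℝ w xh +
        β • fderiv ℝ (fun x : E m => ‖x - x0‖ ^ 2) xh) xh :=
        (diff_of_two hw xh).hasFDerivAt.add
          ((diff_of_two (contDiff_normsq x0) xh).hasFDerivAt.const_mul β)
      rw [h3.fderiv] at g1
      exact eq_neg_of_add_eq_zero_left g1
    rw [e1, norm_neg, norm_smul, norm_fderiv_normsq, Real.norm_eq_abs, abs_of_pos hβ]
    refine abs_le_of_sq_le_sq' ?_ he.le |>.2
    calc (β * (2 * ‖xh - x0‖)) ^ 2 = 4 * β * (β * ‖xh - x0‖ ^ 2) := by ring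
      _ ≤ 4 * β * D := by gcongr
      _ ≤ e ^ 2 := h1
  · rw [lap_add hw hq, lap_const_mul (contDiff_normsq x0), lap_normsq] at g2
    linarith

lemma max_principle {u v : E m → ℝ} (hu : ContDiff ℝ 2 u) (hv : ContDiff ℝ 2 v) {B : ℝ}
    (hB : ∀ x, u x - v x ≤ B) {H : (E m →L[ℝ] ℝ) → ℝ} {L : ℝ}
    (hH : ∀ p q, |H p - H q| ≤ L * ‖p - q‖) {k δ : ℝ} (hk : 0 < k)
    (h : ∀ x, (k * u x - 1 / 2 * lap u x + H (fderiv ℝ u x))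
      - (k * v x - 1 / 2 * lap v x + H (fderiv ℝ v x)) ≤ δ) (x0 : E m) :
    k * (u x0 - v x0) ≤ δ := by
  by_contra hcon
  push Not at hcon
  have hL : 0 ≤ |L| := abs_nonneg L
  set e := (k * (u x0 - v x0) - δ) / (1 + |L|) with he
  have he0 : 0 < e := div_pos (by linarith) (by positivity)
  have hmul : e * (1 + |L|) = k * (u x0 - v x0) - δ := by rw [he]; field_simp
  have hw : ContDiff ℝ 2 fun x => v x - u x := hv.sub hu
  obtain ⟨xh, h1, h2, h3⟩ := omori hw (B := B) (fun x => by linarith [hB x]) x0 he0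
  rw [lap_sub hv hu] at h3
  have e2 : fderiv ℝ (fun x => v x - u x) xh = fderiv ℝ v xh - fderiv ℝ u xh :=
    fderiv_fun_sub (diff_of_two hv xh) (diff_of_two hu xh)
  rw [e2] at h2
  have h4 := (abs_le.1 (hH (fderiv ℝ v xh) (fderiv ℝ u xh))).2
  have h5 : L * ‖fderiv ℝ v xh - fderiv ℝ u xh‖ ≤ |L| * e :=
    mul_le_mul (le_abs_self L) h2 (norm_nonneg _) hL
  have h6 := h xh
  have h7 : k * (v xh - u xh) ≤ k * (v x0 - u x0) := by gcongr
  nlinarith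

lemma J_sub {w : ℝ → ℝ} (hw : Measurable w) {κ : E m → ℝ} (hκ : Ker κ) {r : ℝ}
    (hr0 : 0 ≤ r) {h g : E m → ℝ} (hh : Continuous h) (hg : Continuous g) (hd : Dom w κ r h)
    (hd' : Dom w κ r g) (x : E m) :
    J w κ r (fun y => h y - g y) x = J w κ r h x - J w κ r g x := by
  unfold J
  rw [← intervalIntegral.integral_sub (hd.integrable hw hκ hr0 hh x)
    (hd'.integrable hw hκ hr0 hg x)]
  congr 1; funext s; rw [V_sub hκ hh hg]; ring

noncomputable def KK (k r : ℝ) (h : E m → ℝ) (x : E m) : ℝ := 2 * k / Mr m * (T k r h x - Q r h x)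

noncomputable def DA (k r : ℝ) (h : E m → ℝ) (x : E m) : E m →L[ℝ] ℝ :=
  gl fun i => 2 / Mr m * J (fun s => 1 - k * s ^ 2) (pd i (eta m)) r h x

lemma KK_sub {k r : ℝ} (H : KR k r) {h g : E m → ℝ} (hh : Continuous h) (hg : Continuous g)
    (x : E m) : KK k r (fun y => h y - g y) x = KK k r h x - KK k r g x := by
  unfold KK T Q
  rw [J_sub H.wtT.hm ker_eta H.r0.le hh hg (dom_of_bounded ker_eta H.r1 hh H.wtT.b)
    (dom_of_bounded ker_eta H.r1 hg H.wtT.b),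
    J_sub (wtQ H.r0 H.r1).hm ker_rho H.r0.le hh hg (dom_of_bounded ker_rho H.r1 hh (wtQ H.r0 H.r1).b)
    (dom_of_bounded ker_rho H.r1 hg (wtQ H.r0 H.r1).b)]
  ring

lemma DA_sub {k r : ℝ} (H : KR k r) {h g : E m → ℝ} (hh : Continuous h) (hg : Continuous g)
    (x : E m) : DA k r (fun y => h y - g y) x = DA k r h x - DA k r g x := by
  unfold DA
  rw [eq_gl (gl _ - gl _)]
  congr 1
  funext i
  rw [_root_.sub_apply, gl_ee, gl_ee,
    J_sub H.wtT.hm1 (ker_eta.pd i) H.r0.le hh hg (dom_of_bounded (ker_eta.pd i) H.r1 hh H.wtT.b1)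
    (dom_of_bounded (ker_eta.pd i) H.r1 hg H.wtT.b1)]
  ring

noncomputable def cA (m : ℕ) : ℝ := ∑ i : Fin m, 2 / Mr m * mass (pd i (eta m))

lemma cA_nonneg : 0 ≤ cA m := Finset.sum_nonneg fun i _ =>
  mul_nonneg (div_nonneg (by norm_num) Mr_pos.le) (mass_nonneg _)

lemma DA_bound {k r : ℝ} (H : KR k r) {h : E m → ℝ} {C : ℝ} (hC : ∀ x, |h x| ≤ C) (x : E m) :
    ‖DA k r h x‖ ≤ cA m * r * C := by
  unfold DA cA
  refine (norm_gl_le _).trans ?_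
  rw [Finset.sum_mul, Finset.sum_mul]
  refine Finset.sum_le_sum fun i _ => ?_
  have hM := Mr_pos (m := m)
  rw [abs_mul, abs_of_pos (by positivity)]
  have := J_bound (ker_eta.pd i) H.r0.le H.r1 x H.wtT.b1 (C := C) (fun q _ => hC q)
  calc 2 / Mr m * |J (fun s => 1 - k * s ^ 2) (pd i (eta m)) r h x|
      ≤ 2 / Mr m * (1 * (mass (pd i (eta m)) * C) * r) := by gcongr
    _ = _ := by ring

noncomputable def qq (m : ℕ) : ℝ := Ie m / (2 * Mr m)
lemma qq_pos : 0 < qq m := div_pos Ie_pos (mul_pos two_pos Mr_pos)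
lemma qq_le : qq m ≤ 1 / 2 := by
  unfold qq
  rw [div_le_iff₀ (mul_pos two_pos Mr_pos)]
  linarith [Ie_le_Mr (m := m)]

lemma KK_bound {k r : ℝ} (H : KR k r) {h : E m → ℝ} (hh : Continuous h) {C : ℝ}
    (hC : ∀ x, |h x| ≤ C) (x : E m) : |KK k r h x| ≤ (1 - qq m) * C := by
  have hM := Mr_pos (m := m)
  have hk := H.k1
  have hT := (dom_of_bounded ker_eta H.r1 hh H.wtT.b).integrable H.wtT.hm ker_eta H.r0.le hh x
  have hQ := (dom_of_bounded ker_rho H.r1 hh (wtQ H.r0 H.r1).b).integrable (wtQ H.r0 H.r1).hm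
    ker_rho H.r0.le hh x
  have key : |T k r h x - Q r h x| ≤ ∫ s in (0:ℝ)..r, s * ((Mr m - (1 - k * s ^ 2) * Ie m) * C) := by
    unfold T Q J
    rw [← intervalIntegral.integral_sub hT hQ]
    have hgi : IntervalIntegrable (fun s : ℝ => s * ((Mr m - (1 - k * s ^ 2) * Ie m) * C))
      volume 0 r := Continuous.intervalIntegrable (by fun_prop) _ _
    rw [← Real.norm_eq_abs]
    refine intervalIntegral.norm_integral_le_of_norm_le H.r0.le (Eventually.of_forall fun s hs => ?_)
      hgi
    have hcb := H.cb (Ioc_subset_Icc_self hs)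
    rw [mul_assoc, ← mul_sub, norm_mul, Real.norm_eq_abs s, abs_of_pos hs.1]
    refine mul_le_mul_of_nonneg_left ?_ hs.1.le
    unfold V
    rw [← integral_const_mul, ← integral_sub ((V_integrable ker_eta hh s x).const_mul _)
      (V_integrable ker_rho hh s x)]
    have e : (Mr m - (1 - k * s ^ 2) * Ie m) * C
        = ∫ z, (rho m z - (1 - k * s ^ 2) * eta m z) * C := by
      rw [integral_mul_const, integral_sub ker_rho.integrable (ker_eta.integrable.const_mul _),
        integral_const_mul]
      rfl
    rw [e]
    refine norm_integral_le_of_norm_le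
      ((ker_rho.integrable.sub (ker_eta.integrable.const_mul _)).mul_const _)
      (Eventually.of_forall fun z => ?_)
    have e2 : (1 - k * s ^ 2) * (eta m z * h (x - s • z)) - rho m z * h (x - s • z)
      = - ((rho m z - (1 - k * s ^ 2) * eta m z) * h (x - s • z)) := by ring
    have h0 : 0 ≤ rho m z - (1 - k * s ^ 2) * eta m z := by
      have := eta_le_rho z; have := eta_nonneg z
      nlinarith [hcb.1, hcb.2]
    rw [e2, norm_neg, norm_mul, Real.norm_eq_abs, Real.norm_eq_abs, abs_of_nonneg h0]
    exact mul_le_mul_of_nonneg_left (hC _) h0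
  have hintg : ∫ s in (0:ℝ)..r, s * ((Mr m - (1 - k * s ^ 2) * Ie m) * C)
      = (Mr m * r ^ 2 / 2 - Ie m * (r ^ 2 / 2 - k * r ^ 4 / 4)) * C := by
    have := intervalIntegral.integral_eq_sub_of_hasDerivAt (a := 0) (b := r)
      (f := fun s => (Mr m * s ^ 2 / 2 - Ie m * (s ^ 2 / 2 - k * s ^ 4 / 4)) * C)
      (f' := fun s => s * ((Mr m - (1 - k * s ^ 2) * Ie m) * C)) (fun s _ => ?_)
      (Continuous.intervalIntegrable (by fun_prop) _ _)
    · rw [this]; ring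
    · have h2 := hasDerivAt_pow 2 s
      have h4 := hasDerivAt_pow 4 s
      have := ((((h2.const_mul (Mr m)).div_const 2)).sub
        ((((h2.div_const 2)).sub (((h4.const_mul k).div_const 4))).const_mul (Ie m))).mul_const C
      convert! this using 1
      simp
      ring
  rw [hintg] at key
  unfold KK
  rw [abs_mul, abs_of_pos (by positivity)]
  calc 2 * k / Mr m * |T k r h x - Q r h x|
      ≤ 2 * k / Mr m * ((Mr m * r ^ 2 / 2 - Ie m * (r ^ 2 / 2 - k * r ^ 4 / 4)) * C) := by gcongr
    _ = ((k * r ^ 2) - Ie m / Mr m * ((k * r ^ 2) - (k * r ^ 2) ^ 2 / 2)) * C := by field_simp; ring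
    _ = (1 - qq m) * C := by rw [H.e, qq]; field_simp; ring

end mp
end EPP

namespace EPP
section ex
variable {m : ℕ}
open MeasureTheory Topology Set BoundedContinuousFunction

lemma LH.add {h g : E m → ℝ} (hh : LH h) (hg : LH g) : LH fun x => h x + g x := by
  intro R
  obtain ⟨C, h0, h1⟩ := hh R
  obtain ⟨D, g0, g1⟩ := hg R
  refine ⟨C + D, by positivity, fun x y hx hy => ?_⟩
  have := abs_add_le (h x - h y) (g x - g y)
  have a := h1 x y hx hy
  have b := g1 x y hx hy
  rw [show h x + g x - (h y + g y) = h x - h y + (g x - g y) by ring]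
  linarith

lemma LH.const_mul {h : E m → ℝ} (hh : LH h) (c : ℝ) : LH fun x => c * h x := by
  intro R
  obtain ⟨C, h0, h1⟩ := hh R
  refine ⟨|c| * C, by positivity, fun x y hx hy => ?_⟩
  rw [← mul_sub, abs_mul, mul_assoc]
  exact mul_le_mul_of_nonneg_left (h1 x y hx hy) (abs_nonneg _)

lemma LH.of_loclip {h : E m → ℝ} (hh : ∀ R, ∃ C, 0 ≤ C ∧ ∀ x y : E m, ‖x‖ ≤ R → ‖y‖ ≤ R →
    |h x - h y| ≤ C * ‖x - y‖) : LH h := by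
  intro R
  obtain ⟨C, h0, h1⟩ := hh R
  refine ⟨C * √(2 * R), by positivity, fun x y hx hy => ?_⟩
  refine (h1 x y hx hy).trans ?_
  rw [mul_assoc]
  refine mul_le_mul_of_nonneg_left ?_ h0
  have : ‖x - y‖ ≤ 2 * R := (norm_sub_le x y).trans (by linarith)
  calc ‖x - y‖ = √‖x - y‖ * √‖x - y‖ := (Real.mul_self_sqrt (norm_nonneg _)).symm
    _ ≤ _ := by gcongr

lemma LH.of_c1 {h : E m → ℝ} (hh : ContDiff ℝ 1 h) : LH h := by
  refine LH.of_loclip fun R => ?_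
  have hc : Continuous fun x => ‖fderiv ℝ h x‖ := (hh.continuous_fderiv (by norm_num)).norm
  obtain ⟨C, C0, hC⟩ := exists_bound_ball hc R
  refine ⟨C, C0, fun x y hx hy => ?_⟩
  have := (convex_closedBall (0 : E m) R).norm_image_sub_le_of_norm_fderiv_le (𝕜 := ℝ) (f := h)
    (C := C)
    (fun z _ => (hh.differentiable (by norm_num)) z) (fun z hz => ?_) (x := y) (y := x)
    (by simpa using hy) (by simpa using hx)
  · simpa using this
  · have := hC z (by simpa using hz)
    rwa [abs_of_nonneg (norm_nonneg _)] at this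

lemma ball_hB {h : E m → ℝ} {R C : ℝ} (hC : ∀ x : E m, ‖x‖ ≤ R + 1 → |h x| ≤ C) :
    ∀ x ∈ Metric.closedBall (0 : E m) R, ∀ q, ‖q - x‖ ≤ 1 → |h q| ≤ C := by
  intro x hx q hq
  refine hC q ?_
  have := norm_add_le (q - x) x
  simp only [sub_add_cancel] at this
  simp only [mem_closedBall_zero_iff] at hx
  linarith

lemma LH.of_J {w w1 w0 : ℝ → ℝ} {r : ℝ} (H : Wt w w1 w0 r) {κ : E m → ℝ} (hκ : Ker κ)
    {h : E m → ℝ} (hh : Continuous h) : LH (J w κ r h) := by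
  intro R
  obtain ⟨C, C0, hC⟩ := exists_bound_ball hh (R + 1)
  refine ⟨hc κ * 1 * C, by have := hc_nonneg κ; positivity, fun x y hx hy => ?_⟩
  exact J_hoelder H.hm hκ H.r0.le H.r1 hh H.b zero_le_one (convex_closedBall 0 R) (ball_hB hC)
    (by simpa using hx) (by simpa using hy)

lemma LH.of_J1 {w w1 w0 : ℝ → ℝ} {r : ℝ} (H : Wt w w1 w0 r) {κ : E m → ℝ} (hκ : Ker κ)
    {h : E m → ℝ} (hh : Continuous h) : LH (J w1 κ r h) := by
  intro R
  obtain ⟨C, C0, hC⟩ := exists_bound_ball hh (R + 1)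
  refine ⟨hc κ * 1 * C, by have := hc_nonneg κ; positivity, fun x y hx hy => ?_⟩
  exact J_hoelder H.hm1 hκ H.r0.le H.r1 hh H.b1 zero_le_one (convex_closedBall 0 R) (ball_hB hC)
    (by simpa using hx) (by simpa using hy)

lemma gl_sub (a b : Fin m → ℝ) : gl a - gl b = gl fun i => a i - b i := by
  rw [eq_gl (gl a - gl b)]
  congr 1; funext i
  rw [_root_.sub_apply, gl_ee, gl_ee]

lemma LH.comp_gl {a : Fin m → E m → ℝ} (ha : ∀ i, LH (a i)) {H : (E m →L[ℝ] ℝ) → ℝ} {L : ℝ}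
    (hL : 0 ≤ L) (hH : ∀ p q, |H p - H q| ≤ L * ‖p - q‖) : LH fun x => H (gl fun i => a i x) := by
  intro R
  choose C C0 hC using fun i => ha i R
  refine ⟨L * ∑ i, C i, mul_nonneg hL (Finset.sum_nonneg fun i _ => C0 i), fun x y hx hy => ?_⟩
  refine (hH _ _).trans ?_
  rw [mul_assoc]
  refine mul_le_mul_of_nonneg_left ?_ hL
  rw [gl_sub]
  refine (norm_gl_le _).trans ?_
  rw [Finset.sum_mul]
  exact Finset.sum_le_sum fun i _ => hC i x y hx hy

lemma exist_big {H : (E m →L[ℝ] ℝ) → ℝ} {L : ℝ}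
    (hL : 0 ≤ L) (hH : ∀ p q, |H p - H q| ≤ L * ‖p - q‖) (K0 : ℝ) :
    ∃ k, K0 ≤ k ∧ 0 < k ∧ ∀ f : E m → ℝ, LH f → (∃ B, ∀ x, |f x| ≤ B) →
      ∃ u : E m → ℝ, ContDiff ℝ 2 u ∧ (∃ B, ∀ x, |u x| ≤ B) ∧
        ∀ x, k * u x - 1 / 2 * lap u x + H (fderiv ℝ u x) = f x := by
  have hq := qq_pos (m := m)
  have hq2 := qq_le (m := m)
  have hcA := cA_nonneg (m := m)
  have hM := Mr_pos (m := m)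
  obtain ⟨r, hr0, hr1, hrL, hrK⟩ : ∃ r : ℝ, 0 < r ∧ r ≤ 1 ∧ L * cA m * r ≤ qq m / 2 ∧
      |K0| * r ≤ 1 := by
    refine ⟨min 1 (min (qq m / 2 / (L * cA m + 1)) (1 / (|K0| + 1))), by positivity,
      min_le_left _ _, ?_, ?_⟩
    · have h1 : min 1 (min (qq m / 2 / (L * cA m + 1)) (1 / (|K0| + 1)))
        ≤ qq m / 2 / (L * cA m + 1) := (min_le_right _ _).trans (min_le_left _ _)
      calc _ ≤ L * cA m * (qq m / 2 / (L * cA m + 1)) := by gcongr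
        _ = qq m / 2 * ((L * cA m) / (L * cA m + 1)) := by ring
        _ ≤ qq m / 2 * 1 := by
          gcongr; exact (div_le_one (by positivity)).2 (by linarith)
        _ = _ := mul_one _
    · have h1 : min 1 (min (qq m / 2 / (L * cA m + 1)) (1 / (|K0| + 1)))
        ≤ 1 / (|K0| + 1) := (min_le_right _ _).trans (min_le_right _ _)
      calc _ ≤ |K0| * (1 / (|K0| + 1)) := by gcongr
        _ = |K0| / (|K0| + 1) := by ring
        _ ≤ 1 := (div_le_one (by positivity)).2 (by linarith)
  set k := (r ^ 2)⁻¹ with hk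
  have KRk : KR k r := ⟨hr0, hr1, by rw [hk]; field_simp⟩
  refine ⟨k, ?_, by positivity, ?_⟩
  · refine (le_abs_self K0).trans ?_
    rw [hk, ← one_div, le_div_iff₀ (by positivity)]
    nlinarith [abs_nonneg K0]
  intro f hf ⟨B, hB⟩
  have hfc := hf.cont
  have hKc : ∀ h : E m → ℝ, Continuous h → Continuous (KK k r h) := fun h hh =>
    continuous_const.mul ((KRk.wtT.J_cont ker_eta hh).sub ((wtQ hr0 hr1).J_cont ker_rho hh))
  have hDc : ∀ h : E m → ℝ, Continuous h → Continuous (DA k r h) := fun h hh =>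
    continuous_gl fun i => continuous_const.mul (KRk.wtT.J1_cont (ker_eta.pd i) hh)
  have hHc : Continuous H := by
    have : LipschitzWith (Real.toNNReal L) H := LipschitzWith.of_dist_le_mul fun p q => by
      rw [Real.dist_eq, dist_eq_norm, Real.coe_toNNReal _ hL]; exact hH p q
    exact this.continuous
  have hnorm : ∀ (h : E m →ᵇ ℝ) x, |h x| ≤ ‖h‖ := fun h x => h.norm_coe_le_norm x
  let Φ : (E m →ᵇ ℝ) → (E m →ᵇ ℝ) := fun h =>
    BoundedContinuousFunction.ofNormedAddCommGroup
      (fun x => f x - KK k r h x - H (DA k r h x))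
      ((hfc.sub (hKc _ h.continuous)).sub (hHc.comp (hDc _ h.continuous)))
      (B + (1 - qq m) * ‖h‖ + (|H 0| + L * (cA m * r * ‖h‖))) (by
        intro x
        have a1 := KK_bound KRk h.continuous (hnorm h) x
        have a2 := DA_bound KRk (hnorm h) x
        have a3 := hH (DA k r h x) 0
        rw [sub_zero] at a3
        have a4 : L * ‖DA k r h x‖ ≤ L * (cA m * r * ‖h‖) := by gcongr
        have a5 := hB x
        rw [abs_le] at a1 a3 a5
        have a6 := neg_abs_le (H 0)
        have a7 := le_abs_self (H 0)
        rw [Real.norm_eq_abs, abs_le]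
        constructor <;> linarith)
  have hΦ : ∀ (h : E m →ᵇ ℝ) x, Φ h x = f x - KK k r h x - H (DA k r h x) := fun h x => rfl
  have hcon : ContractingWith (Real.toNNReal (1 - qq m / 2)) Φ := by
    constructor
    · rw [Real.toNNReal_lt_one]; linarith
    · refine LipschitzWith.of_dist_le_mul fun h g => ?_
      rw [Real.coe_toNNReal _ (by linarith)]
      refine (BoundedContinuousFunction.dist_le (by
        have : (0:ℝ) ≤ dist h g := dist_nonneg
        have : 0 ≤ 1 - qq m / 2 := by linarith
        positivity)).2 fun x => ?_
      rw [hΦ, hΦ, Real.dist_eq]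
      have hd : ∀ y, |h y - g y| ≤ dist h g := fun y => by
        rw [← Real.dist_eq]; exact BoundedContinuousFunction.dist_coe_le_dist y
      have a1 := KK_bound KRk (h := fun y => h y - g y) (h.continuous.sub g.continuous) hd x
      have a2 := DA_bound KRk (h := fun y => h y - g y) hd x
      rw [KK_sub KRk h.continuous g.continuous] at a1
      rw [DA_sub KRk h.continuous g.continuous] at a2
      have a3 := hH (DA k r h x) (DA k r g x)
      have a4 : L * ‖DA k r h x - DA k r g x‖ ≤ L * (cA m * r * dist h g) := by gcongr
      have a5 : L * (cA m * r * dist h g) ≤ qq m / 2 * dist h g := by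
        rw [← mul_assoc, ← mul_assoc]
        exact mul_le_mul_of_nonneg_right hrL dist_nonneg
      rw [abs_le] at a1 a3 ⊢
      constructor <;> linarith
  obtain ⟨h, hh⟩ : ∃ h, Φ h = h := ⟨_, hcon.fixedPoint_isFixedPt⟩
  have hfix : ∀ x, h x = f x - KK k r h x - H (DA k r h x) := fun x => by
    rw [← hΦ, hh]
  have hLH : LH h := by
    have e : (h : E m → ℝ) = fun x => f x + (-1) * KK k r h x + (-1) * H (DA k r h x) := by
      funext x; rw [hfix x]; ring_nf
    rw [e]
    have h1 : LH (KK k r h) := by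
      have := ((LH.of_J KRk.wtT ker_eta h.continuous).add
        ((LH.of_J (wtQ hr0 hr1) ker_rho h.continuous).const_mul (-1))).const_mul (2 * k / Mr m)
      convert! this using 1
      funext x; unfold KK T Q; ring
    have h2 : LH fun x => H (DA k r h x) := by
      refine LH.comp_gl (fun i => ?_) hL hH
      exact (LH.of_J1 KRk.wtT (ker_eta.pd i) h.continuous).const_mul _
    exact (hf.add (h1.const_mul _)).add (h2.const_mul _)
  have hTc2 := T_c2 KRk hLH
  refine ⟨fun x => 2 / Mr m * T k r h x, contDiff_const.mul hTc2, ?_, fun x => ?_⟩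
  · refine ⟨2 / Mr m * (1 * (mass (eta m) * ‖h‖) * r), fun x => ?_⟩
    rw [abs_mul, abs_of_pos (by positivity)]
    refine mul_le_mul_of_nonneg_left ?_ (by positivity)
    exact J_bound ker_eta hr0.le hr1 x KRk.wtT.b (fun q _ => hnorm h q)
  · have e1 : fderiv ℝ (fun x => 2 / Mr m * T k r h x) x = DA k r h x := by
      have := (KRk.wtT.J_c1 ker_eta h.continuous x).const_mul (2 / Mr m)
      rw [HasFDerivAt.fderiv (f := fun x => 2 / Mr m * T k r h x) this, eq_gl ((2 / Mr m) • _)]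
      unfold DA
      congr 1
      funext i
      rw [_root_.smul_apply, gl_ee, smul_eq_mul]
    rw [lap_const_mul hTc2, T_lap KRk hLH, e1]
    have := hfix x
    unfold KK at this
    rw [show H (DA k r h x) = f x - 2 * k / Mr m * (T k r h x - Q r h x) - h x by linarith]
    field_simp
    ring

end ex
end EPP

namespace EPP
section ex2
variable {m : ℕ}
open MeasureTheory Topology Set BoundedContinuousFunction

lemma pd_shift (u : E m → ℝ) (z : E m) (i : Fin m) :
    pd i (fun x => u (x + z)) = fun x => pd i u (x + z) := by
  funext x; unfold pd; rw [fderiv_comp_add_right]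

lemma lap_shift {u : E m → ℝ} (hu : ContDiff ℝ 2 u) (z x : E m) :
    lap (fun x => u (x + z)) x = lap u (x + z) := by
  have h2 : ContDiff ℝ 2 fun x => u (x + z) := hu.comp (contDiff_id.add contDiff_const)
  rw [lap_eq h2, lap_eq hu]
  refine Finset.sum_congr rfl fun i _ => ?_
  rw [pd_shift, pd_shift]

lemma lip_of_sol {H : (E m →L[ℝ] ℝ) → ℝ} {L : ℝ} (hH : ∀ p q, |H p - H q| ≤ L * ‖p - q‖)
    {k Λ : ℝ} (hk : 0 < k) {g u : E m → ℝ} (hg : ∀ x y, |g x - g y| ≤ Λ * ‖x - y‖)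
    (hu : ContDiff ℝ 2 u) {B : ℝ} (hB : ∀ x, |u x| ≤ B)
    (h : ∀ x, k * u x - 1 / 2 * lap u x + H (fderiv ℝ u x) = g x) (x y : E m) :
    |u x - u y| ≤ Λ / k * ‖x - y‖ := by
  have key : ∀ x y, u x - u y ≤ Λ / k * ‖x - y‖ := by
    intro x y
    have := max_principle (u := fun q => u (q + (x - y))) (v := u) (δ := Λ * ‖x - y‖)
      (hu.comp (contDiff_id.add contDiff_const)) hu (B := 2 * B) (fun q => ?_) hH hk (fun q => ?_) y
    · simp only [add_sub_cancel] at this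
      rw [div_mul_eq_mul_div, le_div_iff₀ hk]; linarith
    · have a := abs_le.1 (hB (q + (x - y)))
      have b := abs_le.1 (hB q)
      linarith [a.2, b.1]
    · rw [lap_shift hu, fderiv_comp_add_right, h, h]
      have := (abs_le.1 (hg (q + (x - y)) q)).2
      simpa using this
  rw [abs_le]
  have a := key x y
  have b := key y x
  rw [norm_sub_rev] at b
  constructor <;> linarith

lemma exist_eps {H : (E m →L[ℝ] ℝ) → ℝ} {L : ℝ}
    (hL : 0 ≤ L) (hH : ∀ p q, |H p - H q| ≤ L * ‖p - q‖) {ε Λ : ℝ} (hε : 0 < ε) (hΛ : 0 ≤ Λ)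
    {f : E m → ℝ} {B : ℝ} (hB : ∀ x, |f x| ≤ B) (hf : ∀ x y, |f x - f y| ≤ Λ * ‖x - y‖) :
    ∃ u : E m → ℝ, ContDiff ℝ 2 u ∧ (∃ B, ∀ x, |u x| ≤ B) ∧
      (∀ x y, |u x - u y| ≤ Λ / ε * ‖x - y‖) ∧
        ∀ x, ε * u x - 1 / 2 * lap u x + H (fderiv ℝ u x) = f x := by
  obtain ⟨k, hkε, hk0, hk⟩ := exist_big hL hH (m := m) ε
  let X := {u : E m →ᵇ ℝ // ∀ x y, |u x - u y| ≤ Λ / ε * ‖x - y‖}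
  have hX : IsClosed {u : E m →ᵇ ℝ | ∀ x y, |u x - u y| ≤ Λ / ε * ‖x - y‖} := by
    simp only [ofPred_forall]
    refine isClosed_iInter fun x => isClosed_iInter fun y => ?_
    refine isClosed_le ?_ continuous_const
    have h1 : Continuous fun u : E m →ᵇ ℝ => u x := continuous_eval_const x
    have h2 : Continuous fun u : E m →ᵇ ℝ => u y := continuous_eval_const y
    exact (h1.sub h2).abs
  have : CompleteSpace X := hX.completeSpace_coe
  have : Nonempty X := ⟨⟨0, fun x y => by simp; positivity⟩⟩
  have hgl : ∀ u : X, ∀ x y, |(f x + (k - ε) * u.1 x) - (f y + (k - ε) * u.1 y)|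
      ≤ (k * Λ / ε) * ‖x - y‖ := by
    intro u x y
    have a := hf x y
    have b := u.2 x y
    have e : (f x + (k - ε) * u.1 x) - (f y + (k - ε) * u.1 y)
      = (f x - f y) + (k - ε) * (u.1 x - u.1 y) := by ring
    rw [e]
    refine (abs_add_le _ _).trans ?_
    rw [abs_mul, abs_of_nonneg (by linarith : 0 ≤ k - ε)]
    calc _ ≤ Λ * ‖x - y‖ + (k - ε) * (Λ / ε * ‖x - y‖) := by
          gcongr
      _ = _ := by field_simp; ring
  have hsol : ∀ u : X, ∃ v : X, ContDiff ℝ 2 v.1 ∧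
      ∀ x, k * v.1 x - 1 / 2 * lap v.1 x + H (fderiv ℝ v.1 x) = f x + (k - ε) * u.1 x := by
    intro u
    obtain ⟨v, hv, ⟨B', hB'⟩, hv2⟩ := hk (fun x => f x + (k - ε) * u.1 x)
      (LH.of_loclip fun R => ⟨_, by positivity, fun x y _ _ => hgl u x y⟩)
      ⟨B + (k - ε) * ‖u.1‖, fun x => by
        refine (abs_add_le _ _).trans ?_
        rw [abs_mul, abs_of_nonneg (by linarith : 0 ≤ k - ε)]
        have := u.1.norm_coe_le_norm x
        rw [Real.norm_eq_abs] at this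
        have := hB x
        have : 0 ≤ k - ε := by linarith
        gcongr⟩
    have hlip := lip_of_sol hH hk0 (hgl u) hv hB' hv2
    refine ⟨⟨BoundedContinuousFunction.ofNormedAddCommGroup v hv.continuous B' hB', fun x y => ?_⟩,
      hv, hv2⟩
    refine (hlip x y).trans (le_of_eq ?_)
    field_simp
  choose F hF1 hF2 using hsol
  have hcon : ContractingWith (Real.toNNReal ((k - ε) / k)) F := by
    have h0 : 0 ≤ (k - ε) / k := div_nonneg (by linarith) hk0.le
    constructor
    · rw [Real.toNNReal_lt_one, div_lt_one hk0]; linarith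
    · refine LipschitzWith.of_dist_le_mul fun u v => ?_
      rw [Real.coe_toNNReal _ h0, Subtype.dist_eq, Subtype.dist_eq]
      have key : ∀ u v : X, ∀ x, (F u).1 x - (F v).1 x ≤ (k - ε) / k * dist u.1 v.1 := by
        intro u v x
        have := max_principle (hF1 u) (hF1 v) (B := ‖(F u).1‖ + ‖(F v).1‖) (fun y => ?_) hH hk0
          (δ := (k - ε) * dist u.1 v.1) (fun y => ?_) x
        · rw [div_mul_eq_mul_div, le_div_iff₀ hk0]; linarith
        · have a := abs_le.1 ((F u).1.norm_coe_le_norm y)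
          have b := abs_le.1 ((F v).1.norm_coe_le_norm y)
          linarith [a.2, b.1]
        · rw [hF2, hF2]
          have : u.1 y - v.1 y ≤ dist u.1 v.1 := by
            refine (le_abs_self _).trans ?_
            rw [← Real.dist_eq]; exact BoundedContinuousFunction.dist_coe_le_dist y
          have : (k - ε) * (u.1 y - v.1 y) ≤ (k - ε) * dist u.1 v.1 :=
            mul_le_mul_of_nonneg_left this (by linarith)
          linarith
      refine (BoundedContinuousFunction.dist_le (mul_nonneg h0 dist_nonneg)).2 fun x => ?_
      rw [Real.dist_eq, abs_le]
      have a := key u v x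
      have b := key v u x
      rw [dist_comm] at b
      constructor <;> linarith
  obtain ⟨u, hu⟩ : ∃ u, F u = u := ⟨_, hcon.fixedPoint_isFixedPt⟩
  have h1 := hF1 u
  have h2 := hF2 u
  rw [hu] at h1 h2
  refine ⟨u.1, h1, ⟨‖u.1‖, fun x => u.1.norm_coe_le_norm x⟩, u.2, fun x => ?_⟩
  linarith [h2 x]

lemma rpow_lip {θ R a b : ℝ} (hθ : 1 < θ) (ha : a ∈ Icc 0 R) (hb : b ∈ Icc 0 R) :
    |a ^ θ - b ^ θ| ≤ θ * R ^ (θ - 1) * |a - b| := by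
  have := (convex_Icc (0:ℝ) R).norm_image_sub_le_of_norm_hasDerivWithin_le
    (f := fun t : ℝ => t ^ θ) (f' := fun t => θ * t ^ (θ - 1)) (C := θ * R ^ (θ - 1))
    (fun t _ => (Real.hasDerivAt_rpow_const (Or.inr hθ.le)).hasDerivWithinAt)
    (fun t ht => ?_) hb ha
  · simpa using this
  · rw [Real.norm_eq_abs, abs_of_nonneg (mul_nonneg (by linarith) (Real.rpow_nonneg ht.1 _))]
    have := Real.rpow_le_rpow ht.1 ht.2 (by linarith : 0 ≤ θ - 1)
    gcongr

lemma exist_disc {θ : ℝ} (hθ : 1 < θ) {ε Λ : ℝ} (hε : 0 < ε) (hΛ : 0 ≤ Λ)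
    {f : E m → ℝ} {B : ℝ} (hB : ∀ x, |f x| ≤ B) (hf : ∀ x y, |f x - f y| ≤ Λ * ‖x - y‖) :
    ∃ u : E m → ℝ, ContDiff ℝ 2 u ∧ (∃ B, ∀ x, |u x| ≤ B) ∧
        ∀ x, ε * u x - 1 / 2 * lap u x + 1 / θ * ‖fderiv ℝ u x‖ ^ θ = f x := by
  set R := Λ / ε with hR
  have hR0 : 0 ≤ R := by positivity
  have hmem : ∀ p : E m →L[ℝ] ℝ, min ‖p‖ R ∈ Icc 0 R := fun p =>
    ⟨le_min (norm_nonneg _) hR0, min_le_right _ _⟩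
  have hHl : ∀ p q : E m →L[ℝ] ℝ, |1 / θ * (min ‖p‖ R) ^ θ - 1 / θ * (min ‖q‖ R) ^ θ|
      ≤ R ^ (θ - 1) * ‖p - q‖ := by
    intro p q
    have := rpow_lip hθ (hmem p) (hmem q)
    rw [← mul_sub, abs_mul, abs_of_pos (by positivity)]
    have h6 : |min ‖p‖ R - min ‖q‖ R| ≤ ‖p - q‖ := by
      have h7 := abs_min_sub_min_le_max ‖p‖ R ‖q‖ R
      simp only [sub_self, abs_zero] at h7
      refine h7.trans (max_le (abs_norm_sub_norm_le p q) (norm_nonneg _))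
    calc 1 / θ * |(min ‖p‖ R) ^ θ - (min ‖q‖ R) ^ θ|
        ≤ 1 / θ * (θ * R ^ (θ - 1) * |min ‖p‖ R - min ‖q‖ R|) := by gcongr
      _ = R ^ (θ - 1) * |min ‖p‖ R - min ‖q‖ R| := by field_simp
      _ ≤ _ := by gcongr
  obtain ⟨u, h1, h2, h3, h4⟩ := exist_eps (H := fun p : E m →L[ℝ] ℝ => 1 / θ * (min ‖p‖ R) ^ θ)
    (L := R ^ (θ - 1)) (by positivity) hHl hε hΛ hB hf
  refine ⟨u, h1, h2, fun x => ?_⟩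
  have : ‖fderiv ℝ u x‖ ≤ R := by
    refine norm_fderiv_le_of_lip' ℝ hR0 (Eventually.of_forall fun y => ?_)
    exact h3 y x
  have h5 := h4 x
  simp only [min_eq_left this] at h5
  exact h5

end ex2
end EPP

namespace EPP
section bern
variable {m : ℕ}
open Topology Set

lemma pd_comm {u : E m → ℝ} (hu : ContDiff ℝ 2 u) (i j : Fin m) (x : E m) :
    pd i (pd j u) x = pd j (pd i u) x := by
  have hs := (hu.contDiffAt (x := x)).isSymmSndFDerivAt (by simp)
  have hd : DifferentiableAt ℝ (fderiv ℝ u) x :=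
    (hu.fderiv_right (m := 1) (by norm_num)).differentiable (by norm_num) x
  have e : ∀ a b : Fin m, pd a (pd b u) x = fderiv ℝ (fderiv ℝ u) x (ee a) (ee b) := by
    intro a b
    have : HasFDerivAt (fun y => fderiv ℝ u y (ee b))
      ((ContinuousLinearMap.apply ℝ ℝ (ee b : E m)).comp (fderiv ℝ (fderiv ℝ u) x)) x :=
      (ContinuousLinearMap.apply ℝ ℝ (ee b : E m)).hasFDerivAt.comp x hd.hasFDerivAt
    unfold pd
    rw [this.fderiv]; rfl
  rw [e, e]
  exact hs _ _

lemma pd_sum {ι : Type*} (S : Finset ι) {d : ι → E m → ℝ} (hd : ∀ i, Differentiable ℝ (d i))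
    (j : Fin m) : pd j (fun x => ∑ i ∈ S, d i x) = fun x => ∑ i ∈ S, pd j (d i) x := by
  funext x
  unfold pd
  rw [fderiv_fun_sum fun i _ => hd i x]
  simp

lemma lap_sum {ι : Type*} (S : Finset ι) {d : ι → E m → ℝ} (hd : ∀ i, ContDiff ℝ 2 (d i))
    (x : E m) : lap (fun x => ∑ i ∈ S, d i x) x = ∑ i ∈ S, lap (d i) x := by
  have h2 : ContDiff ℝ 2 fun x => ∑ i ∈ S, d i x := ContDiff.sum fun i _ => hd i
  rw [lap_eq h2, Finset.sum_congr rfl fun i _ => lap_eq (hd i) x, Finset.sum_comm]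
  refine Finset.sum_congr rfl fun j _ => ?_
  rw [pd_sum S (fun i => diff_of_two (hd i)), pd_sum S (fun i => diff_pd (hd i) j)]

noncomputable def W2 (d : Fin m → E m → ℝ) (x : E m) : ℝ := 1 / 2 * ∑ i, d i x * d i x

lemma W2_c1 {d : Fin m → E m → ℝ} (hd : ∀ i, ContDiff ℝ 1 (d i)) : ContDiff ℝ 1 (W2 d) :=
  contDiff_const.mul (ContDiff.sum fun i _ => (hd i).mul (hd i))

lemma W2_c2 {d : Fin m → E m → ℝ} (hd : ∀ i, ContDiff ℝ 2 (d i)) : ContDiff ℝ 2 (W2 d) :=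
  contDiff_const.mul (ContDiff.sum fun i _ => (hd i).mul (hd i))

lemma W2_pd {d : Fin m → E m → ℝ} (hd : ∀ i, Differentiable ℝ (d i)) (j : Fin m) (x : E m) :
    pd j (W2 d) x = ∑ i, d i x * pd j (d i) x := by
  have hm : ∀ i, Differentiable ℝ fun x => d i x * d i x := fun i => (hd i).mul (hd i)
  have hs : Differentiable ℝ fun x => ∑ i, d i x * d i x := Differentiable.fun_sum fun i _ => hm i
  unfold W2
  rw [pd_const_mul hs, pd_sum _ (d := fun i x => d i x * d i x) hm]
  simp only [pd_mul (hd _) (hd _)]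
  rw [Finset.mul_sum]
  refine Finset.sum_congr rfl fun i _ => by ring

lemma W2_lap {d : Fin m → E m → ℝ} (hd : ∀ i, ContDiff ℝ 2 (d i)) (x : E m) :
    lap (W2 d) x = ∑ i, (d i x * lap (d i) x + ∑ j, (pd j (d i) x) ^ 2) := by
  unfold W2
  rw [lap_const_mul (ContDiff.sum fun i _ => (hd i).mul (hd i)),
    lap_sum _ (d := fun i x => d i x * d i x) (fun i => (hd i).mul (hd i)), Finset.mul_sum]
  refine Finset.sum_congr rfl fun i _ => ?_
  rw [lap_mul (hd i) (hd i)]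
  simp only [pow_two]
  ring

lemma W2_nonneg (d : Fin m → E m → ℝ) (x : E m) : 0 ≤ W2 d x := by
  unfold W2
  have : 0 ≤ ∑ i, d i x * d i x := Finset.sum_nonneg fun i _ => mul_self_nonneg _
  positivity

lemma dq_tendsto {a : E m → ℝ} {a' : E m →L[ℝ] ℝ} {xh : E m} (ha : HasStrictFDerivAt a a' xh)
    {x : ℕ → E m} (hx : Tendsto x atTop (𝓝 xh)) {s : ℕ → ℝ} (hs : Tendsto s atTop (𝓝 0))
    (hs0 : ∀ n, 0 < s n) (i : Fin m) :
    Tendsto (fun n => (s n)⁻¹ * (a (x n + s n • ee i) - a (x n))) atTop (𝓝 (a' (ee i))) := by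
  have h1 : Tendsto (fun n => (x n + s n • (ee i : E m), x n)) atTop (𝓝 (xh, xh)) := by
    have : Tendsto (fun n => x n + s n • (ee i : E m)) atTop (𝓝 (xh + (0:ℝ) • ee i)) :=
      hx.add (hs.smul_const _)
    rw [zero_smul, add_zero] at this
    exact this.prodMk_nhds hx
  have h2 := ha.isLittleO.comp_tendsto h1
  have h3 : (fun n => a (x n + s n • (ee i : E m)) - a (x n) - s n * a' (ee i))
      =o[atTop] fun n => s n := by
    have h4 := h2.norm_right
    refine (h4.congr (fun n => ?_) (fun n => ?_))
    · simp
    · simp [norm_smul, abs_of_pos (hs0 n)]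
  have h5 := h3.tendsto_div_nhds_zero
  have h6 := h5.add_const (a' (ee i))
  rw [zero_add] at h6
  refine h6.congr fun n => ?_
  have := (hs0 n).ne'
  field_simp
  ring

lemma dq_c2 {u : E m → ℝ} (hu : ContDiff ℝ 2 u) (s : ℝ) (i : Fin m) :
    ContDiff ℝ 2 fun x => s⁻¹ * (u (x + s • ee i) - u x) :=
  contDiff_const.mul ((hu.comp (contDiff_id.add contDiff_const)).sub hu)

lemma dq_pd {u : E m → ℝ} (hu : Differentiable ℝ u) (s : ℝ) (i j : Fin m) (x : E m) :
    pd j (fun x => s⁻¹ * (u (x + s • ee i) - u x)) x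
      = s⁻¹ * (pd j u (x + s • ee i) - pd j u x) := by
  have h1 : Differentiable ℝ fun x => u (x + s • ee i) := hu.comp (by fun_prop)
  have h2 : Differentiable ℝ fun x => u (x + s • ee i) - u x := h1.sub hu
  rw [pd_const_mul h2, pd_sub h1 hu, pd_shift]

lemma dq_lap {u : E m → ℝ} (hu : ContDiff ℝ 2 u) (s : ℝ) (i : Fin m) (x : E m) :
    lap (fun x => s⁻¹ * (u (x + s • ee i) - u x)) x
      = s⁻¹ * (lap u (x + s • ee i) - lap u x) := by
  have h1 : ContDiff ℝ 2 fun x => u (x + s • ee i) := hu.comp (contDiff_id.add contDiff_const)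
  rw [lap_const_mul (h1.sub hu), lap_sub h1 hu, lap_shift hu]

lemma bern_pt {u f g : E m → ℝ} (hu : ContDiff ℝ 2 u) {ε Λ : ℝ} (x0 : E m)
    (hf : ∀ x y, ‖x - x0‖ ≤ 2 → ‖y - x0‖ ≤ 2 → |f x - f y| ≤ Λ * ‖x - y‖)
    (heq : ∀ x, 1 / 2 * lap u x = ε * u x + g x - f x)
    (hg : ∀ x, W2 (fun i => pd i u) x ≠ 0 → HasStrictFDerivAt g (fderiv ℝ g x) x)
    {ζ : E m → ℝ} (hζ : ContDiff ℝ 2 ζ) (hζ0 : ∀ x, ‖x - x0‖ ≤ 1 → 0 ≤ ζ x)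
    (hζ1 : ∀ x, ‖x - x0‖ = 1 → ζ x = 0) (hζx : ζ x0 = 1)
    (hW : 0 < W2 (fun i => pd i u) x0) :
    ∃ x, ‖x - x0‖ < 1 ∧ W2 (fun i => pd i u) x0 ≤ ζ x * W2 (fun i => pd i u) x ∧
      (∀ j, ζ x * pd j (W2 fun i => pd i u) x + W2 (fun i => pd i u) x * pd j ζ x = 0) ∧
      ζ x * (∑ i, (2 * ε * (pd i u x) ^ 2 + 2 * (pd i u x * pd i g x) - 2 * Λ * |pd i u x|
        + ∑ j, (pd j (pd i u) x) ^ 2)) + 2 * ∑ j, pd j ζ x * pd j (W2 fun i => pd i u) x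
        + W2 (fun i => pd i u) x * lap ζ x ≤ 0 := by
  set W := W2 fun i => pd i u with hWdef
  set s : ℕ → ℝ := fun n => 1 / ((n:ℝ) + 1) with hsdef
  have hs0 : ∀ n, 0 < s n := fun n => by rw [hsdef]; positivity
  have hs1 : ∀ n, s n ≤ 1 := fun n => by
    rw [hsdef]; simp only; rw [div_le_one (by positivity)]; linarith [(Nat.cast_nonneg n : (0:ℝ) ≤ n)]
  have hs : Tendsto s atTop (𝓝 0) := tendsto_one_div_add_atTop_nhds_zero_nat
  set d : ℕ → Fin m → E m → ℝ := fun n i x => (s n)⁻¹ * (u (x + s n • ee i) - u x) with hd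
  have hdc : ∀ n i, ContDiff ℝ 2 (d n i) := fun n i => dq_c2 hu _ i
  have hWc : ∀ n, ContDiff ℝ 2 (W2 (d n)) := fun n => W2_c2 (hdc n)
  have hmax : ∀ n, ∃ x ∈ Metric.closedBall x0 1,
      IsMaxOn (fun x => ζ x * W2 (d n) x) (Metric.closedBall x0 1) x := fun n =>
    (isCompact_closedBall x0 1).exists_isMaxOn ⟨x0, by simp⟩
      (hζ.continuous.mul (hWc n).continuous).continuousOn
  choose xs hxs hxm using hmax
  obtain ⟨xh, hxh, φ, hφ, hlim⟩ := (isCompact_closedBall x0 1).tendsto_subseq hxs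
  have hsφ : Tendsto (fun n => s (φ n)) atTop (𝓝 0) := hs.comp hφ.tendsto_atTop
  have hsφ0 : ∀ n, 0 < s (φ n) := fun n => hs0 _
  have hstrict : ∀ {a : E m → ℝ} (y : E m), ContDiff ℝ 1 a → HasStrictFDerivAt a (fderiv ℝ a y) y :=
    fun y ha => ha.contDiffAt.hasStrictFDerivAt (by norm_num)
  have hu1 : ContDiff ℝ 1 u := hu.of_le (by norm_num)
  have l1 : ∀ i, Tendsto (fun n => d (φ n) i (xs (φ n))) atTop (𝓝 (pd i u xh)) := fun i =>
    dq_tendsto (hstrict xh hu1) hlim hsφ hsφ0 i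
  have l10 : ∀ i, Tendsto (fun n => d (φ n) i x0) atTop (𝓝 (pd i u x0)) := fun i =>
    dq_tendsto (hstrict x0 hu1) tendsto_const_nhds hsφ hsφ0 i
  have l2 : ∀ i j, Tendsto (fun n => pd j (d (φ n) i) (xs (φ n))) atTop (𝓝 (pd j (pd i u) xh)) := by
    intro i j
    rw [pd_comm hu j i]
    simp only [hd, dq_pd (diff_of_two hu)]
    exact dq_tendsto (hstrict xh (contDiff_pd hu j)) hlim hsφ hsφ0 i
  have lW : Tendsto (fun n => W2 (d (φ n)) (xs (φ n))) atTop (𝓝 (W xh)) :=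
    (tendsto_finsetSum _ fun i _ => (l1 i).mul (l1 i)).const_mul _
  have lW0 : Tendsto (fun n => W2 (d (φ n)) x0) atTop (𝓝 (W x0)) :=
    (tendsto_finsetSum _ fun i _ => (l10 i).mul (l10 i)).const_mul _
  have lζ : Tendsto (fun n => ζ (xs (φ n))) atTop (𝓝 (ζ xh)) := (hζ.continuous.tendsto xh).comp hlim
  have lpζ : ∀ j, Tendsto (fun n => pd j ζ (xs (φ n))) atTop (𝓝 (pd j ζ xh)) := fun j =>
    ((continuous_pd (hζ.of_le (by norm_num)) j).tendsto xh).comp hlim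
  have llζ : Tendsto (fun n => lap ζ (xs (φ n))) atTop (𝓝 (lap ζ xh)) :=
    ((continuous_lap hζ).tendsto xh).comp hlim
  have lpW : ∀ j, Tendsto (fun n => pd j (W2 (d (φ n))) (xs (φ n))) atTop (𝓝 (pd j W xh)) := by
    intro j
    simp only [W2_pd (fun i => diff_of_two (hdc _ i))]
    rw [hWdef, W2_pd (fun i => diff_pd hu i)]
    exact tendsto_finsetSum _ fun i _ => (l1 i).mul (l2 i j)
  have hge : W x0 ≤ ζ xh * W xh := by
    refine le_of_tendsto_of_tendsto' lW0 (lζ.mul lW) fun n => ?_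
    have := hxm (φ n) (show x0 ∈ Metric.closedBall x0 1 by simp)
    simp only [mem_ofPred_eq, hζx, one_mul] at this
    exact this
  have hxh1 : ‖xh - x0‖ ≤ 1 := by simpa [dist_eq_norm] using hxh
  have hpos : 0 < ζ xh * W xh := hW.trans_le hge
  have hxhlt : ‖xh - x0‖ < 1 := by
    refine lt_of_le_of_ne hxh1 fun h => ?_
    rw [hζ1 xh h, zero_mul] at hpos
    exact lt_irrefl _ hpos
  have hWx : W xh ≠ 0 := fun h => by rw [h, mul_zero] at hpos; exact lt_irrefl _ hpos
  have hev : ∀ᶠ n in atTop, ‖xs (φ n) - x0‖ < 1 := by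
    have : Tendsto (fun n => ‖xs (φ n) - x0‖) atTop (𝓝 ‖xh - x0‖) := (hlim.sub_const x0).norm
    exact this.eventually (gt_mem_nhds hxhlt)
  have lg : ∀ i, Tendsto (fun n => (s (φ n))⁻¹ * (g (xs (φ n) + s (φ n) • ee i) - g (xs (φ n)))) atTop
      (𝓝 (pd i g xh)) := fun i => dq_tendsto (hg xh hWx) hlim hsφ hsφ0 i
  have hloc : ∀ n, ‖xs n - x0‖ < 1 → fderiv ℝ (fun x => ζ x * W2 (d n) x) (xs n) = 0 ∧
      lap (fun x => ζ x * W2 (d n) x) (xs n) ≤ 0 := by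
    intro n hn
    refine isLocalMax_lap (hζ.mul (hWc n)) ((hxm n).isLocalMax ?_)
    exact Metric.closedBall_mem_nhds_of_mem (by simpa [dist_eq_norm] using hn)
  refine ⟨xh, hxhlt, hge, fun j => ?_, ?_⟩
  · refine tendsto_nhds_unique ((lζ.mul (lpW j)).add (lW.mul (lpζ j))) ?_
    refine tendsto_const_nhds.congr' ?_
    filter_upwards [hev] with n hn
    have h1 := (hloc _ hn).1
    have h2 := congrFun (pd_mul (diff_of_two hζ) (diff_of_two (hWc (φ n))) j) (xs (φ n))
    rw [← h2, pd, h1]; rfl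
  · refine le_of_tendsto (((lζ.mul (tendsto_finsetSum _ fun i _ =>
      ((((l1 i).pow 2).const_mul (2 * ε)).add (((l1 i).mul (lg i)).const_mul 2)).sub
        ((l1 i).abs.const_mul (2 * Λ)) |>.add (tendsto_finsetSum _ fun j _ => (l2 i j).pow 2))).add
      ((tendsto_finsetSum _ fun j _ => (lpζ j).mul (lpW j)).const_mul 2)).add (lW.mul llζ)) ?_
    filter_upwards [hev] with n hn
    have h1 := (hloc _ hn).2
    rw [lap_mul hζ (hWc _), W2_lap (hdc _)] at h1
    have h0 := hζ0 _ hn.le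
    refine le_trans ?_ h1
    gcongr with i _
    set x := xs (φ n)
    set t := s (φ n)
    have ht : 0 < t := hsφ0 n
    have e1 : lap (d (φ n) i) x = 2 * (ε * d (φ n) i x + t⁻¹ * (g (x + t • ee i) - g x)
        - t⁻¹ * (f (x + t • ee i) - f x)) := by
      simp only [hd]
      rw [dq_lap hu]
      have a := heq (x + t • ee i)
      have b := heq x
      change t⁻¹ * _ = 2 * (ε * (t⁻¹ * _) + _ - _)
      linear_combination (2 * t⁻¹) * a - (2 * t⁻¹) * b
    have e2 : |t⁻¹ * (f (x + t • ee i) - f x)| ≤ Λ := by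
      have hts : ‖t • (ee i : E m)‖ = t := by rw [norm_smul, norm_ee]; simp [abs_of_pos ht]
      have := hf (x + t • ee i) x ?_ (by linarith)
      · rw [add_sub_cancel_left, hts] at this
        rw [abs_mul, abs_of_pos (inv_pos.2 ht), inv_mul_le_iff₀ ht]
        linarith
      · have h3 := norm_add_le (x - x0) (t • ee i)
        rw [show x + t • ee i - x0 = x - x0 + t • ee i by abel]
        have := hs1 (φ n)
        rw [hts] at h3
        linarith
    rw [e1]
    have e3 : d (φ n) i x * (t⁻¹ * (f (x + t • ee i) - f x)) ≤ Λ * |d (φ n) i x| := by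
      refine (le_abs_self _).trans ?_
      rw [abs_mul, mul_comm]
      gcongr
    linear_combination 2 * e3

end bern
end EPP

namespace EPP
section bern2
variable {m : ℕ}
open Topology Set

lemma pd_pow {w : E m → ℝ} (hw : Differentiable ℝ w) (n : ℕ) (i : Fin m) :
    pd i (fun x => w x ^ (n + 1)) = fun x => (n + 1) * w x ^ n * pd i w x := by
  funext x
  have h := (hw x).hasFDerivAt.pow (n + 1)
  rw [pd, h.fderiv]
  simp [pd, nsmul_eq_mul]

lemma lap_pow {w : E m → ℝ} (hw : ContDiff ℝ 2 w) (n : ℕ) (x : E m) :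
    lap (fun x => w x ^ (n + 2)) x = (n + 2) * w x ^ (n + 1) * lap w x
      + (n + 2) * (n + 1) * w x ^ n * ∑ i, (pd i w x) ^ 2 := by
  rw [lap_eq (hw.pow _), lap_eq hw, Finset.mul_sum, Finset.mul_sum, ← Finset.sum_add_distrib]
  refine Finset.sum_congr rfl fun i _ => ?_
  have hd := diff_of_two hw
  have h1 := pd_pow hd (n + 1) i
  have h2 : (fun x => (((n + 1 : ℕ) : ℝ) + 1) * w x ^ (n + 1) * pd i w x)
    = fun x => (((n + 1 : ℕ) : ℝ) + 1) * (w x ^ (n + 1) * pd i w x) := by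
    funext x; ring
  have h3 : Differentiable ℝ fun x => w x ^ (n + 1) := hd.pow _
  have h4 : Differentiable ℝ fun x => w x ^ (n + 1) * pd i w x := h3.mul (diff_pd hw i)
  rw [h1, h2, pd_const_mul h4, pd_mul h3 (diff_pd hw i), pd_pow hd n i]
  push_cast
  ring

set_option maxHeartbeats 1000000 in
lemma real_bern {θ C P M N X D A1 A2 A3 μ : ℝ} {q : ℕ} (hθ : 1 < θ) (hμ : 0 < μ) (hq : 0 < q)
    (hqθ : 2 / (q:ℝ) ≤ θ - 1) (hA1 : 0 ≤ A1) (hA2 : 0 ≤ A2) (hA3 : 0 ≤ A3)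
    (hC : 2 * θ ≤ C) (hK : (A1 + A2 + A3) * μ * θ ^ 2 < C ^ (θ - 1)) (hP : 1 ≤ P) (hM : C * P < M)
    (hN : 0 ≤ N) (hX : 0 < X) (hX1 : X ≤ 1) (hMN : M ^ 2 ≤ X ^ q * N ^ 2)
    (hD : 2 * (N ^ θ / θ - P ^ θ) ≤ D)
    (hineq : D ^ 2 / μ ≤ A1 * (N ^ (θ - 1) * N ^ 2 / X) + A2 * (P ^ (2 * θ - 1) * N)
      + A3 * (N ^ 2 / X ^ 2)) : False := by
  have hC1 : 1 ≤ C := by linarith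
  have hC0 : 0 < C := by linarith
  have hM0 : 0 < M := lt_of_le_of_lt (by positivity) hM
  have hMN' : M ≤ N := by
    have : M ^ 2 ≤ N ^ 2 := hMN.trans (by
      exact mul_le_of_le_one_left (sq_nonneg N) (pow_le_one₀ hX.le hX1))
    exact abs_le_of_sq_le_sq' this hN |>.2
  have hN0 : 0 < N := hM0.trans_le hMN'
  have hPN : C * P ≤ N := hM.le.trans hMN'
  set K := C ^ (θ - 1) with hKdef
  have hK1 : 1 ≤ K := Real.one_le_rpow hC1 (by linarith)
  have hMK : K ≤ M ^ (θ - 1) := Real.rpow_le_rpow hC0.le ((le_mul_of_one_le_right hC0.le hP).trans hM.le) (by linarith)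
  set t := N ^ (θ - 1) with ht
  have ht0 : 0 < t := Real.rpow_pos_of_pos hN0 _
  -- X lower bound
  have hXl : K / t ≤ X := by
    have h1 : (M / N) ^ 2 ≤ X ^ q := by
      rw [div_pow, div_le_iff₀ (by positivity)]; exact hMN
    have h2 : (M / N) ^ (2 / (q:ℝ)) ≤ X := by
      have := Real.rpow_le_rpow (by positivity) h1 (show (0:ℝ) ≤ 1 / q by positivity)
      rw [← Real.rpow_natCast (M/N), ← Real.rpow_natCast X, ← Real.rpow_mul (by positivity),
        ← Real.rpow_mul hX.le] at this
      have hq' : (q:ℝ) ≠ 0 := by positivity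
      rw [mul_one_div_cancel hq', Real.rpow_one] at this
      convert! this using 2
      push_cast; ring
    have h3 : (M / N) ^ (θ - 1) ≤ (M / N) ^ (2 / (q:ℝ)) :=
      Real.rpow_le_rpow_of_exponent_ge (by positivity) ((div_le_one hN0).2 hMN') hqθ
    rw [Real.div_rpow hM0.le hN0.le] at h3
    refine le_trans ?_ (h3.trans h2)
    gcongr
  have hXi : 1 / X ≤ t / K := by
    rw [div_le_div_iff₀ hX (by linarith)]
    rw [div_le_iff₀ ht0] at hXl; linarith
  have hK0 : 0 < K := by linarith
  set Z := N ^ 2 * t ^ 2 with hZ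
  have hZ0 : 0 < Z := by positivity
  have e1 : t * N ^ 2 / X ≤ Z / K := by
    calc t * N ^ 2 / X = t * N ^ 2 * (1 / X) := by ring
      _ ≤ t * N ^ 2 * (t / K) := by gcongr
      _ = Z / K := by rw [hZ]; ring
  have e3 : N ^ 2 / X ^ 2 ≤ Z / K := by
    calc N ^ 2 / X ^ 2 = N ^ 2 * (1 / X) ^ 2 := by field_simp
      _ ≤ N ^ 2 * (t / K) ^ 2 := by gcongr
      _ = Z / K ^ 2 := by rw [hZ]; ring
      _ ≤ Z / K := by gcongr; exact le_self_pow₀ hK1 (by norm_num)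
  have hZ' : Z = N ^ (2 * θ - 1) * N := by
    rw [hZ, ht, ← Real.rpow_natCast (N ^ (θ - 1)), ← Real.rpow_mul hN, ← Real.rpow_natCast N 2,
      ← Real.rpow_add hN0]
    nth_rewrite 3 [← Real.rpow_one N]
    rw [← Real.rpow_add hN0]
    congr 1; push_cast; ring
  have e2 : P ^ (2 * θ - 1) * N ≤ Z / K := by
    rw [le_div_iff₀ hK0, hZ']
    have h1 : (C * P) ^ (2 * θ - 1) ≤ N ^ (2 * θ - 1) :=
      Real.rpow_le_rpow (by positivity) hPN (by linarith)
    rw [Real.mul_rpow hC0.le (by linarith)] at h1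
    have h2 : K ≤ C ^ (2 * θ - 1) := Real.rpow_le_rpow_of_exponent_le hC1 (by linarith)
    have h3 : 0 ≤ P ^ (2 * θ - 1) := Real.rpow_nonneg (by linarith) _
    have h4 : P ^ (2 * θ - 1) * K ≤ N ^ (2 * θ - 1) :=
      (by rw [mul_comm]; exact mul_le_mul_of_nonneg_right h2 h3 : _ ≤ _).trans h1
    calc P ^ (2 * θ - 1) * N * K = P ^ (2 * θ - 1) * K * N := by ring
      _ ≤ _ := mul_le_mul_of_nonneg_right h4 hN
  have hPθ : P ^ θ ≤ N ^ θ / (2 * θ) := by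
    have h1 : (C * P) ^ θ ≤ N ^ θ := Real.rpow_le_rpow (by positivity) hPN (by linarith)
    rw [Real.mul_rpow hC0.le (by linarith)] at h1
    have h2 : C ^ (1:ℝ) ≤ C ^ θ := Real.rpow_le_rpow_of_exponent_le hC1 (by linarith)
    rw [Real.rpow_one] at h2
    rw [le_div_iff₀ (by linarith)]
    have h3 : 0 ≤ P ^ θ := Real.rpow_nonneg (by linarith) _
    calc P ^ θ * (2 * θ) = 2 * θ * P ^ θ := by ring
      _ ≤ C ^ θ * P ^ θ := mul_le_mul_of_nonneg_right (hC.trans h2) h3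
      _ ≤ _ := h1
  have hNθ : N ^ θ = N * t := by
    rw [ht]; nth_rewrite 2 [← Real.rpow_one N]; rw [← Real.rpow_add hN0]; congr 1; ring
  have hD2 : N * t / θ ≤ D := by
    rw [hNθ] at hPθ hD
    have : N * t / (2 * θ) = N * t / θ / 2 := by field_simp
    linarith
  have hD3 : Z / θ ^ 2 ≤ D ^ 2 := by
    have := pow_le_pow_left₀ (by positivity) hD2 2
    calc Z / θ ^ 2 = (N * t / θ) ^ 2 := by rw [hZ]; ring
      _ ≤ _ := this
  have fin : Z / θ ^ 2 / μ ≤ (A1 + A2 + A3) * (Z / K) := by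
    have : Z / θ ^ 2 / μ ≤ D ^ 2 / μ := by gcongr
    have := mul_le_mul_of_nonneg_left e1 hA1
    have := mul_le_mul_of_nonneg_left e2 hA2
    have := mul_le_mul_of_nonneg_left e3 hA3
    linarith
  have f2 : K ≤ (A1 + A2 + A3) * μ * θ ^ 2 := by
    have h : 0 < Z / (θ ^ 2 * μ * K) := by positivity
    have : K * (Z / (θ ^ 2 * μ * K)) ≤ ((A1 + A2 + A3) * μ * θ ^ 2) * (Z / (θ ^ 2 * μ * K)) := by
      calc _ = Z / θ ^ 2 / μ := by field_simp
        _ ≤ _ := fin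
        _ = _ := by field_simp
    exact le_of_mul_le_mul_right this h
  linarith

lemma W2_eq (u : E m → ℝ) (x : E m) : 2 * W2 (fun i => pd i u) x = ‖fderiv ℝ u x‖ ^ 2 := by
  rw [norm_fderiv_sq, W2]; simp only [pow_two]; ring

lemma g_eq {θ : ℝ} (u : E m → ℝ) (x : E m) :
    1 / θ * ‖fderiv ℝ u x‖ ^ θ = 1 / θ * (2 * W2 (fun i => pd i u) x) ^ (θ / 2) := by
  rw [W2_eq, ← Real.rpow_natCast, ← Real.rpow_mul (norm_nonneg _)]
  congr 2; push_cast; ring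

lemma g_deriv {θ : ℝ} (hθ : 1 < θ) {u : E m → ℝ} (hu : ContDiff ℝ 2 u) {x : E m}
    (hx : W2 (fun i => pd i u) x ≠ 0) :
    HasStrictFDerivAt (fun x => 1 / θ * ‖fderiv ℝ u x‖ ^ θ)
      (‖fderiv ℝ u x‖ ^ (θ - 2) • fderiv ℝ (W2 fun i => pd i u) x) x := by
  have h0 : ContDiff ℝ 1 (W2 fun i => pd i u) := W2_c1 fun i => contDiff_pd hu i
  have h1 : HasStrictFDerivAt (W2 fun i => pd i u) (fderiv ℝ (W2 fun i => pd i u) x) x :=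
    h0.contDiffAt.hasStrictFDerivAt (by norm_num)
  have h2 := ((h1.const_mul 2).rpow_const (p := θ / 2) (Or.inl (by simpa using hx))).const_mul (1 / θ)
  have e : (fun x => 1 / θ * ‖fderiv ℝ u x‖ ^ θ)
      = fun x => 1 / θ * (2 * W2 (fun i => pd i u) x) ^ (θ / 2) := funext fun x => g_eq u x
  rw [e]
  convert! h2 using 1
  rw [smul_smul, smul_smul, W2_eq, ← Real.rpow_natCast, ← Real.rpow_mul (norm_nonneg _)]
  congr 1
  have : ((2:ℕ):ℝ) * (θ / 2 - 1) = θ - 2 := by push_cast; ring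
  rw [this]
  field_simp

lemma sum_abs_le (u : E m → ℝ) (x : E m) : ∑ i, |pd i u x| ≤ m * ‖fderiv ℝ u x‖ := by
  refine (Finset.sum_le_sum fun i _ => abs_pd_le u x i).trans ?_
  simp

lemma sq_lap_le {u : E m → ℝ} (hu : ContDiff ℝ 2 u) (x : E m) (hm : 1 ≤ m) :
    (lap u x) ^ 2 / m ≤ ∑ i, ∑ j, (pd j (pd i u) x) ^ 2 := by
  have hm0 : (0:ℝ) < m := by exact_mod_cast hm
  rw [lap_eq hu, div_le_iff₀ hm0]
  have h1 := sq_sum_le_card_mul_sum_sq (s := (Finset.univ : Finset (Fin m)))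
    (f := fun i => pd i (pd i u) x)
  simp only [Finset.card_univ, Fintype.card_fin] at h1
  refine h1.trans ?_
  rw [mul_comm]
  refine mul_le_mul_of_nonneg_right (Finset.sum_le_sum fun i _ => ?_) hm0.le
  exact Finset.single_le_sum (f := fun j => (pd j (pd i u) x) ^ 2) (fun j _ => sq_nonneg _)
    (Finset.mem_univ i)

set_option maxHeartbeats 2000000 in
lemma bernstein (hm : 1 ≤ m) {θ : ℝ} (hθ : 1 < θ) : ∃ C : ℝ, 1 ≤ C ∧
    ∀ (u f : E m → ℝ) (ε P : ℝ) (x0 : E m), ContDiff ℝ 2 u → 0 ≤ ε → 1 ≤ P →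
    (∀ x, ε * u x - 1 / 2 * lap u x + 1 / θ * ‖fderiv ℝ u x‖ ^ θ = f x) →
    (∀ x, ‖x - x0‖ ≤ 1 → |f x - ε * u x| ≤ P ^ θ) →
    (∀ x y, ‖x - x0‖ ≤ 2 → ‖y - x0‖ ≤ 2 → |f x - f y| ≤ P ^ (2 * θ - 1) * ‖x - y‖) →
    ‖fderiv ℝ u x0‖ ≤ C * P := by
  have hm0 : (0:ℝ) < m := by exact_mod_cast hm
  obtain ⟨n, hn⟩ := exists_nat_gt (2 / (θ - 1))
  set q : ℝ := (n:ℝ) + 2 with hq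
  have hq0 : 0 < q := by positivity
  set A1 := 2 * q
  set A2 := 2 * (m:ℝ)
  set A3 := 4 * q ^ 2 + m * q
  set B := (A1 + A2 + A3) * m * θ ^ 2 with hB
  have hB0 : 0 ≤ B := by positivity
  have hθ0 : 0 < θ - 1 := by linarith
  set C := max (2 * θ) ((B + 1) ^ (1 / (θ - 1))) with hC
  have hCB : B < C ^ (θ - 1) := by
    have h1 : ((B + 1) ^ (1 / (θ - 1))) ^ (θ - 1) ≤ C ^ (θ - 1) :=
      Real.rpow_le_rpow (by positivity) (le_max_right _ _) hθ0.le
    rw [← Real.rpow_mul (by positivity), one_div_mul_cancel hθ0.ne', Real.rpow_one] at h1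
    linarith
  have hC2 : 2 * θ ≤ C := le_max_left _ _
  refine ⟨C, by linarith, ?_⟩
  intro u f ε P x0 hu hε hP heq hfb hfl
  by_contra! hcon
  set N0 := ‖fderiv ℝ u x0‖ with hN0
  have hN0pos : 0 < N0 := lt_of_le_of_lt (by nlinarith) hcon
  set χ : E m → ℝ := fun x => 1 - ‖x - x0‖ ^ 2 with hχ
  have hχ2 : ContDiff ℝ 2 χ := contDiff_const.sub (contDiff_normsq x0)
  have hχp : ∀ j x, pd j χ x = -(2 * (x j - x0 j)) := by
    intro j x
    rw [hχ, pd_sub (differentiable_const _) (diff_of_two (contDiff_normsq x0))]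
    simp only
    rw [pd_normsq]
    simp [pd]
  have hχs : ∀ x, ∑ j, (pd j χ x) ^ 2 = 4 * ‖x - x0‖ ^ 2 := by
    intro x
    rw [EuclideanSpace.norm_sq_eq, Finset.mul_sum]
    refine Finset.sum_congr rfl fun i _ => ?_
    rw [hχp]; simp; ring
  have hχl : ∀ x, lap χ x = -(2 * m) := by
    intro x
    rw [hχ, lap_sub contDiff_const (contDiff_normsq x0), lap_const, lap_normsq]; ring
  have hWx0 : 0 < W2 (fun i => pd i u) x0 := by
    have := W2_eq u x0
    have : 0 < N0 ^ 2 := by positivity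
    linarith
  obtain ⟨x, hx1, hxW, hxg, hxin⟩ := bern_pt (ε := ε) (Λ := P ^ (2 * θ - 1)) (g := fun x => 1 / θ * ‖fderiv ℝ u x‖ ^ θ) hu x0 hfl
    (fun x => by linarith [heq x]) (fun x hx => by
      have := g_deriv hθ hu hx
      rw [this.hasFDerivAt.fderiv]; exact this) (ζ := fun x => χ x ^ (n + 2)) (hχ2.pow _)
    (fun x hx => by
      have : 0 ≤ χ x := by
        have := pow_le_one₀ (n := 2) (norm_nonneg _) hx
        simp only [hχ]; linarith
      positivity)
    (fun x hx => by simp [hχ, hx]) (by simp [hχ]) hWx0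
  set W := W2 fun i => pd i u with hWd
  set N := ‖fderiv ℝ u x‖ with hN
  set X := χ x with hX
  have hxx : ‖x - x0‖ ^ 2 < 1 := pow_lt_one₀ (norm_nonneg _) hx1 (by norm_num)
  have hXpos : 0 < X := by simp only [hX, hχ]; linarith
  have hX1 : X ≤ 1 := by simp only [hX, hχ]; linarith [sq_nonneg ‖x - x0‖]
  have hWN : 2 * W x = N ^ 2 := W2_eq u x
  have hWN0 : 2 * W x0 = N0 ^ 2 := W2_eq u x0
  have hWpos : 0 < W x := by
    by_contra! h
    have : 0 < X ^ (n + 2) * W x := hWx0.trans_le hxW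
    have h2 : X ^ (n + 2) * W x ≤ 0 := mul_nonpos_of_nonneg_of_nonpos (by positivity) h
    linarith
  have hNpos : 0 < N := by
    have : 0 < N ^ 2 := by linarith
    exact lt_of_le_of_ne (norm_nonneg _) fun h => by rw [← h] at this; norm_num at this
  have hζp : ∀ j, pd j (fun x => χ x ^ (n + 2)) x = q * X ^ (n + 1) * pd j χ x := by
    intro j
    rw [pd_pow (diff_of_two hχ2) (n + 1) j]
    push_cast
    rw [hq]; ring
  have hWj : ∀ j, X * pd j W x = -(W x * q * pd j χ x) := by
    intro j
    have h := hxg j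
    rw [hζp] at h
    have h2 : X ^ (n + 1) * (X * pd j W x + W x * q * pd j χ x) = 0 := by
      rw [← h]; ring
    have := (mul_eq_zero.1 h2).resolve_left (by positivity)
    linarith
  have hWj' : ∀ j, pd j W x = -(W x * q * pd j χ x) / X := fun j => by
    rw [eq_div_iff hXpos.ne', mul_comm]; exact hWj j
  set S := ∑ j, (pd j χ x) ^ 2 with hS
  have hS4 : S ≤ 4 := by rw [hS, hχs]; linarith
  have hS0 : 0 ≤ S := Finset.sum_nonneg fun _ _ => sq_nonneg _
  rw [lap_pow hχ2] at hxin
  have t1 : ∑ j, pd j (fun x => χ x ^ (n + 2)) x * pd j W x = -(q ^ 2 * X ^ n * W x * S) := by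
    rw [hS, Finset.mul_sum, ← Finset.sum_neg_distrib]
    refine Finset.sum_congr rfl fun j _ => ?_
    rw [hζp, hWj']
    field_simp
    ring
  rw [t1, hχl] at hxin
  set T := ∑ i, (2 * ε * (pd i u x) ^ 2 + 2 * (pd i u x * pd i (fun x => 1 / θ * ‖fderiv ℝ u x‖ ^ θ) x)
    - 2 * P ^ (2 * θ - 1) * |pd i u x| + ∑ j, (pd j (pd i u) x) ^ 2) with hT
  have hTX : T ≤ A3 * (N ^ 2 / X ^ 2) := by
    rw [← mul_div_assoc, le_div_iff₀ (by positivity)]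
    have h1 : X ^ n * (T * X ^ 2) ≤ X ^ n * (A3 * N ^ 2) := by
      have hm1 : X ^ (n + 1) * (q * m * W x * 2) ≤ X ^ n * (q * m * W x * 2) := by
        refine mul_le_mul_of_nonneg_right ?_ (by positivity)
        exact pow_le_pow_of_le_one hXpos.le hX1 (by omega)
      have hm2 : X ^ n * (2 * q ^ 2 * W x) * S ≤ X ^ n * (2 * q ^ 2 * W x) * 4 :=
        mul_le_mul_of_nonneg_left hS4 (by positivity)
      have hm3 : 0 ≤ W x * (((n:ℝ) + 2) * (n + 1) * X ^ n * S) := by positivity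
      have e0 : χ x = X := rfl
      rw [e0] at hxin
      have e1 : X ^ n * (A3 * N ^ 2) = X ^ n * (q * m * W x * 2) + X ^ n * (2 * q ^ 2 * W x) * 4 := by
        rw [← hWN]; simp only [A3]; ring
      rw [e1]
      have e2 : X ^ n * (T * X ^ 2) = X ^ (n + 2) * T := by ring
      rw [e2]
      have e3 : (n:ℝ) + 2 = q := rfl
      rw [e3] at hxin hm3
      linear_combination hxin + hm1 + hm2 + hm3
    exact le_of_mul_le_mul_left h1 (by positivity)
  have hgi : ∀ i, pd i (fun x => 1 / θ * ‖fderiv ℝ u x‖ ^ θ) x = N ^ (θ - 2) * pd i W x := by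
    intro i
    rw [pd, (g_deriv hθ hu hWpos.ne').hasFDerivAt.fderiv]; rfl
  have hcs : ∑ i, pd i u x * pd i χ x ≤ N * 2 := by
    have h1 := Finset.sum_mul_sq_le_sq_mul_sq Finset.univ (fun i => pd i u x) (fun i => pd i χ x)
    rw [← norm_fderiv_sq] at h1
    refine (abs_le_of_sq_le_sq' (h1.trans ?_) (by positivity)).2
    rw [mul_pow]
    refine mul_le_mul_of_nonneg_left ?_ (by positivity)
    linarith
  have hNN : N ^ (θ - 2) * N ^ 3 = N ^ (θ - 1) * N ^ 2 := by
    rw [← Real.rpow_natCast N 3, ← Real.rpow_natCast N 2, ← Real.rpow_add hNpos,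
      ← Real.rpow_add hNpos]
    congr 1; push_cast; ring
  have hgs : -(q * (N ^ (θ - 1) * N ^ 2 / X)) ≤ ∑ i, pd i u x *
      pd i (fun x => 1 / θ * ‖fderiv ℝ u x‖ ^ θ) x := by
    have e : ∑ i, pd i u x * pd i (fun x => 1 / θ * ‖fderiv ℝ u x‖ ^ θ) x
        = -(N ^ (θ - 2) * W x * q / X * ∑ i, pd i u x * pd i χ x) := by
      rw [Finset.mul_sum, ← Finset.sum_neg_distrib]
      refine Finset.sum_congr rfl fun i _ => ?_
      rw [hgi, hWj']; ring
    rw [e]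
    refine neg_le_neg ?_
    calc _ ≤ N ^ (θ - 2) * W x * q / X * (N * 2) := mul_le_mul_of_nonneg_left hcs (by positivity)
      _ = q * (N ^ (θ - 2) * N ^ 3 / X) := by
        rw [show N ^ 3 = N * (2 * W x) by rw [hWN]; ring]; ring
      _ = _ := by rw [hNN]
  have hTl : (lap u x) ^ 2 / m - 2 * (q * (N ^ (θ - 1) * N ^ 2 / X))
      - 2 * P ^ (2 * θ - 1) * (m * N) ≤ T := by
    rw [hT, Finset.sum_add_distrib, Finset.sum_sub_distrib, Finset.sum_add_distrib,
      ← Finset.mul_sum, ← Finset.mul_sum, ← Finset.mul_sum]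
    have h1 := sq_lap_le hu x hm
    have h2 := sum_abs_le u x
    have h3 : 0 ≤ ∑ i, (pd i u x) ^ 2 := Finset.sum_nonneg fun _ _ => sq_nonneg _
    have h4 : 0 ≤ 2 * ε * ∑ i, (pd i u x) ^ 2 := by positivity
    have h5 : 2 * P ^ (2 * θ - 1) * ∑ i, |pd i u x| ≤ 2 * P ^ (2 * θ - 1) * (m * N) :=
      mul_le_mul_of_nonneg_left h2 (by positivity)
    linarith
  refine real_bern (q := n + 2) (D := lap u x) (A1 := A1) (A2 := A2) (A3 := A3) hθ hm0 (by omega) ?_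
    (by positivity) (by positivity)
    (by positivity) hC2 hCB hP hcon hNpos.le hXpos hX1 ?_ ?_ ?_
  · push_cast
    rw [div_lt_iff₀ hθ0] at hn
    rw [div_le_iff₀ (by positivity)]
    linarith
  · rw [← hWN0, ← hWN]; linarith
  · have h1 := heq x
    have h2 := (abs_le.1 (hfb x hx1.le)).2
    have e : 1 / θ * N ^ θ = N ^ θ / θ := by ring
    rw [e] at h1
    linarith
  · have e : A1 * (N ^ (θ - 1) * N ^ 2 / X) + A2 * (P ^ (2 * θ - 1) * N)
      = 2 * (q * (N ^ (θ - 1) * N ^ 2 / X)) + 2 * P ^ (2 * θ - 1) * (m * N) := by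
        simp only [A1, A2]; ring
    rw [e]; linarith

end bern2
end EPP

namespace EPP
section approx
variable {m : ℕ}
open Topology Set

lemma lip_ball {f : E m → ℝ} (hf : LocallyLipschitz f) (R : ℝ) : ∃ C : ℝ, 0 ≤ C ∧
    ∀ x y : E m, ‖x‖ ≤ R → ‖y‖ ≤ R → |f x - f y| ≤ C * ‖x - y‖ := by
  obtain ⟨K, hK⟩ := (hf.locallyLipschitzOn (s := Metric.closedBall (0 : E m) R)).exists_lipschitzOnWith_of_compact
    (isCompact_closedBall 0 R)
  refine ⟨K, K.2, fun x y hx hy => ?_⟩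
  have := hK.dist_le_mul x (by simpa using hx) y (by simpa using hy)
  rwa [Real.dist_eq, dist_eq_norm] at this

lemma abs_min_sub_le (a b c : ℝ) : |min a c - min b c| ≤ |a - b| := by
  have := abs_min_sub_min_le_max a c b c
  simpa using this

lemma trunc_lip {f : E m → ℝ} (hf : LocallyLipschitz f) (h0 : ∀ x, 0 ≤ f x)
    (hco : ∀ C, ∃ ρ, ∀ x, f x ≤ C → ‖x‖ ≤ ρ) {n : ℝ} (hn : 0 ≤ n) :
    ∃ Λ, 0 ≤ Λ ∧ ∀ x y, |min (f x) n - min (f y) n| ≤ Λ * ‖x - y‖ := by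
  obtain ⟨ρ, hρ⟩ := hco n
  obtain ⟨L, L0, hL⟩ := lip_ball hf (ρ + 1)
  have hb : ∀ x, 0 ≤ min (f x) n ∧ min (f x) n ≤ n := fun x => ⟨le_min (h0 x) hn, min_le_right _ _⟩
  have hout : ∀ x, ρ < ‖x‖ → min (f x) n = n := fun x hx =>
    min_eq_right (le_of_lt (not_le.1 fun h => absurd (hρ x h) (not_le.2 hx)))
  have key : ∀ x y : E m, ‖x‖ ≤ ρ → ρ + 1 < ‖y‖ → |min (f x) n - min (f y) n| ≤ (L + n) * ‖x - y‖ := by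
    intro x y hx hy
    have h1 : 1 ≤ ‖x - y‖ := by
      have := norm_sub_norm_le y x
      rw [norm_sub_rev] at this; linarith
    have h2 : |min (f x) n - min (f y) n| ≤ n := by
      rw [abs_le]; constructor <;> linarith [hb x, hb y]
    nlinarith
  refine ⟨L + n, by positivity, fun x y => ?_⟩
  by_cases hx : ‖x‖ ≤ ρ + 1 <;> by_cases hy : ‖y‖ ≤ ρ + 1
  · refine (abs_min_sub_le _ _ _).trans ((hL x y hx hy).trans ?_)
    nlinarith [norm_nonneg (x - y)]
  · by_cases hx2 : ‖x‖ ≤ ρ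
    · exact key x y hx2 (not_le.1 hy)
    · rw [hout x (not_le.1 hx2), hout y (by linarith), sub_self, abs_zero]; positivity
  · by_cases hy2 : ‖y‖ ≤ ρ
    · rw [abs_sub_comm, norm_sub_rev]; exact key y x hy2 (not_le.1 hx)
    · rw [hout y (not_le.1 hy2), hout x (by linarith), sub_self, abs_zero]; positivity
  · rw [hout y (by linarith), hout x (by linarith), sub_self, abs_zero]; positivity

lemma barrier {θ α f₀ : ℝ} (hθ : 1 < θ) (hα : 0 < α) (hf₀ : 0 < f₀) :
    ∃ (ψ : E m → ℝ) (A : ℝ), ContDiff ℝ 2 ψ ∧ 0 ≤ A ∧ (∀ y, 0 ≤ ψ y) ∧ (∀ y, ‖y‖ - 1 ≤ ψ y) ∧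
      ∀ y, f₀ * (‖y‖ ^ α + 1) + 1 / 2 * lap ψ y - 1 / θ * ‖fderiv ℝ ψ y‖ ^ θ ≤ A := by
  obtain ⟨n, hn⟩ := exists_nat_gt α
  set c : ℝ := (n + 2) * (2 * m + 4 * (n + 1)) with hc
  have hc0 : 0 ≤ c := by positivity
  have hθ0 : 0 < θ - 1 := by linarith
  set B := θ * (f₀ + c) + 1
  have hB1 : 1 ≤ B := by
    have : 0 ≤ θ * (f₀ + c) := by positivity
    simp only [B]; linarith
  set K := B ^ (1 / (θ - 1)) with hK
  have hK1 : 1 ≤ K := Real.one_le_rpow hB1 (by positivity)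
  have hK0 : 0 < K := by linarith
  have hKB : K ^ (θ - 1) = B := by
    rw [hK, ← Real.rpow_mul (by linarith), one_div_mul_cancel hθ0.ne', Real.rpow_one]
  have hKθ : K ^ θ = K * B := by
    rw [← hKB]
    nth_rewrite 2 [← Real.rpow_one K]
    rw [← Real.rpow_add hK0]; congr 1; ring
  have hw2 : ContDiff ℝ 2 fun x : E m => ‖x - 0‖ ^ 2 := contDiff_normsq 0
  have hp2 : ContDiff ℝ 2 fun x : E m => (‖x - 0‖ ^ 2) ^ (n + 2) := hw2.pow _
  have hs : ∀ y : E m, ∑ i, (pd i (fun x : E m => ‖x - 0‖ ^ 2) y) ^ 2 = 4 * ‖y‖ ^ 2 := by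
    intro y
    rw [← norm_fderiv_sq, norm_fderiv_normsq, sub_zero]; ring
  refine ⟨fun x => K * (‖x - 0‖ ^ 2) ^ (n + 2), 2 * f₀ + K * c, contDiff_const.mul hp2,
    by positivity, fun y => by positivity, fun y => ?_, fun y => ?_⟩
  · simp only [sub_zero]
    have h1 : ‖y‖ - 1 ≤ (‖y‖ ^ 2) ^ (n + 2) := by
      rcases le_total ‖y‖ 1 with h | h
      · have : 0 ≤ (‖y‖ ^ 2) ^ (n + 2) := by positivity
        linarith
      · rw [← pow_mul]
        have : ‖y‖ ≤ ‖y‖ ^ (2 * (n + 2)) := le_self_pow₀ h (by omega)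
        linarith
    have h2 : (‖y‖ ^ 2) ^ (n + 2) ≤ K * (‖y‖ ^ 2) ^ (n + 2) :=
      le_mul_of_one_le_left (by positivity) hK1
    linarith
  · set t := ‖y‖ with ht
    have ht0 : 0 ≤ t := norm_nonneg _
    have hl : lap (fun x : E m => K * (‖x - 0‖ ^ 2) ^ (n + 2)) y = K * c * t ^ (2 * n + 2) := by
      rw [lap_const_mul hp2, lap_pow hw2, lap_normsq, hs, sub_zero, hc]
      ring
    have hD : K * t ^ (2 * n + 3) ≤ ‖fderiv ℝ (fun x : E m => K * (‖x - 0‖ ^ 2) ^ (n + 2)) y‖ := by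
      have h1 : ‖fderiv ℝ (fun x : E m => K * (‖x - 0‖ ^ 2) ^ (n + 2)) y‖ ^ 2
          = (K * (n + 2) * t ^ (2 * n + 2)) ^ 2 * (4 * t ^ 2) := by
        rw [norm_fderiv_sq, ← hs y, Finset.mul_sum]
        refine Finset.sum_congr rfl fun i _ => ?_
        rw [pd_const_mul (diff_of_two hp2)]
        simp only
        rw [pd_pow (diff_of_two hw2) (n + 1) i]
        simp only [sub_zero]
        push_cast; ring
      refine abs_le_of_sq_le_sq' ?_ (norm_nonneg _) |>.2
      rw [h1]
      have e : (K * (n + 2) * t ^ (2 * n + 2)) ^ 2 * (4 * t ^ 2)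
        = (K * t ^ (2 * n + 3)) ^ 2 * (4 * ((n:ℝ) + 2) ^ 2) := by ring
      rw [e]
      refine le_mul_of_one_le_right (by positivity) ?_
      nlinarith [(Nat.cast_nonneg n : (0:ℝ) ≤ n)]
    rw [hl]
    rcases le_total t 1 with h | h
    · have h1 : t ^ α ≤ 1 := Real.rpow_le_one ht0 h hα.le
      have h2 : t ^ (2 * n + 2) ≤ 1 := pow_le_one₀ ht0 h
      have h3 : 0 ≤ 1 / θ * ‖fderiv ℝ (fun x : E m => K * (‖x - 0‖ ^ 2) ^ (n + 2)) y‖ ^ θ := by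
        positivity
      have h4 : f₀ * t ^ α ≤ f₀ * 1 := by gcongr
      have h5 : K * c * t ^ (2 * n + 2) ≤ K * c * 1 := by gcongr
      have h6 : 0 ≤ K * c := by positivity
      linarith
    · set Tt := t ^ (2 * n + 3) with hTt
      have hT1 : 1 ≤ Tt := one_le_pow₀ h
      have h1 : t ^ α ≤ Tt := by
        rw [hTt, ← Real.rpow_natCast]
        refine Real.rpow_le_rpow_of_exponent_le h ?_
        push_cast; linarith [(Nat.cast_nonneg n : (0:ℝ) ≤ n)]
      have h2 : t ^ (2 * n + 2) ≤ Tt := pow_le_pow_right₀ h (by omega)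
      have h3 : (K * Tt) ^ θ ≤ ‖fderiv ℝ (fun x : E m => K * (‖x - 0‖ ^ 2) ^ (n + 2)) y‖ ^ θ :=
        Real.rpow_le_rpow (by positivity) hD (by linarith)
      rw [Real.mul_rpow hK0.le (by positivity), hKθ] at h3
      have h4 : Tt ≤ Tt ^ θ := Real.self_le_rpow_of_one_le hT1 hθ.le
      have h5 : K * B * Tt ≤ ‖fderiv ℝ (fun x : E m => K * (‖x - 0‖ ^ 2) ^ (n + 2)) y‖ ^ θ := by
        refine le_trans ?_ h3
        gcongr
      have h6 : 1 / θ * (K * B * Tt) ≤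
          1 / θ * ‖fderiv ℝ (fun x : E m => K * (‖x - 0‖ ^ 2) ^ (n + 2)) y‖ ^ θ := by gcongr
      have h7 : K * (f₀ + c) * Tt ≤ 1 / θ * (K * B * Tt) := by
        have : 1 / θ * (K * B * Tt) = K * (f₀ + c) * Tt + 1 / θ * (K * Tt) := by
          simp only [B]; field_simp
        rw [this]
        have : 0 ≤ 1 / θ * (K * Tt) := by positivity
        linarith
      have h8 : f₀ * t ^ α ≤ f₀ * Tt := by gcongr
      have h9 : K * c * t ^ (2 * n + 2) ≤ K * c * Tt := by gcongr
      have h10 : f₀ * Tt ≤ K * f₀ * Tt := by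
        have : 0 ≤ f₀ * Tt := by positivity
        nlinarith
      have h11 : 0 ≤ K * c * Tt := by positivity
      have h12 : 0 ≤ K * c := by positivity
      linarith

/-- upper bound through the barrier -/
lemma upper_bd {θ f₀ α A B : ℝ} {ψ u g : E m → ℝ} {ε : ℝ} (hε : 0 < ε)
    (hψ : ContDiff ℝ 2 ψ) (hψ0 : ∀ y, 0 ≤ ψ y) (hψ1 : ∀ y, ‖y‖ - 1 ≤ ψ y)
    (hψA : ∀ y, f₀ * (‖y‖ ^ α + 1) + 1 / 2 * lap ψ y - 1 / θ * ‖fderiv ℝ ψ y‖ ^ θ ≤ A)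
    (hu : ContDiff ℝ 2 u) (hB : ∀ x, |u x| ≤ B)
    (heq : ∀ x, ε * u x - 1 / 2 * lap u x + 1 / θ * ‖fderiv ℝ u x‖ ^ θ = g x)
    (hg : ∀ x, g x ≤ f₀ * (‖x‖ ^ α + 1)) (y : E m) : ε * u y ≤ ε * ψ y + A := by
  have hw : ContDiff ℝ 2 fun x => ψ x - u x := hψ.sub hu
  have ht : Tendsto (fun x => ψ x - u x) (cocompact (E m)) atTop := by
    refine tendsto_atTop_mono (f := fun x => ‖x‖ + (-1 - B)) (fun x => ?_)
      (tendsto_atTop_add_const_right _ _ (tendsto_norm_cocompact_atTop (E := E m)))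
    have := hψ1 x
    have := (abs_le.1 (hB x)).2
    linarith
  obtain ⟨x, hx⟩ := hw.continuous.exists_forall_le ht
  have hm := isLocalMin_lap hw (x := x) (Eventually.of_forall hx)
  rw [lap_sub hψ hu] at hm
  have h1 : fderiv ℝ u x = fderiv ℝ ψ x := by
    have := hm.1
    rw [fderiv_fun_sub (diff_of_two hψ x) (diff_of_two hu x)] at this
    exact (sub_eq_zero.1 this).symm
  have h2 := heq x
  rw [h1] at h2
  have h3 := hψA x
  have h4 := hg x
  have h5 : ε * u x ≤ A := by linarith [hm.2]
  have h6 := mul_le_mul_of_nonneg_left (hx y) hε.le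
  have h7 := mul_nonneg hε.le (hψ0 x)
  linarith

lemma low_pt {θ B : ℝ} (hθ : 1 < θ) {u g : E m → ℝ} {ε : ℝ}
    (hu : ContDiff ℝ 2 u) (hB : ∀ x, |u x| ≤ B)
    (heq : ∀ x, ε * u x - 1 / 2 * lap u x + 1 / θ * ‖fderiv ℝ u x‖ ^ θ = g x)
    (x0 : E m) {e : ℝ} (he : 0 < e) (he1 : e ≤ 1) :
    ∃ x, u x ≤ u x0 ∧ g x ≤ ε * u x + 2 * e := by
  obtain ⟨x, h1, h2, h3⟩ := omori hu (B := B) (fun x => (abs_le.1 (hB x)).1) x0 he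
  refine ⟨x, h1, ?_⟩
  have h4 : ‖fderiv ℝ u x‖ ^ θ ≤ e := by
    calc _ ≤ e ^ θ := Real.rpow_le_rpow (norm_nonneg _) h2 (by linarith)
      _ ≤ e ^ (1:ℝ) := Real.rpow_le_rpow_of_exponent_ge he he1 hθ.le
      _ = e := Real.rpow_one e
  have h5 : 1 / θ * ‖fderiv ℝ u x‖ ^ θ ≤ 1 * e := by
    refine mul_le_mul ?_ h4 (by positivity) (by norm_num)
    rw [div_le_one (by linarith)]; exact hθ.le
  linarith [heq x]

lemma coer {f : E m → ℝ} {α f₀ : ℝ} (hα : 0 < α) (hf₀ : 0 < f₀) (h1 : H1 f α f₀) (C : ℝ) :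
    ∃ ρ, 0 ≤ ρ ∧ ∀ x, f x ≤ C → ‖x‖ ≤ ρ := by
  refine ⟨(max (f₀ * C) 0) ^ (1 / α), by positivity, fun x hx => ?_⟩
  have h := (h1 x).1.trans hx
  rw [inv_mul_le_iff₀ hf₀] at h
  have h2 : ‖x‖ ^ α ≤ max (f₀ * C) 0 := le_trans (by linarith) (le_max_left _ _)
  have h3 := Real.rpow_le_rpow (by positivity) h2 (show 0 ≤ 1 / α by positivity)
  rwa [← Real.rpow_mul (norm_nonneg _), mul_one_div_cancel hα.ne', Real.rpow_one] at h3

lemma mvt_ball {v : E m → ℝ} (hv : ContDiff ℝ 2 v) {R G : ℝ}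
    (hG : ∀ x : E m, ‖x‖ ≤ R → ‖fderiv ℝ v x‖ ≤ G) {x y : E m} (hx : ‖x‖ ≤ R) (hy : ‖y‖ ≤ R) :
    |v x - v y| ≤ G * ‖x - y‖ := by
  have := (convex_closedBall (0 : E m) R).norm_image_sub_le_of_norm_fderiv_le (𝕜 := ℝ) (f := v)
    (C := G) (fun z _ => diff_of_two hv z) (fun z hz => hG z (by simpa using hz)) (x := y) (y := x)
    (by simpa using hy) (by simpa using hx)
  simpa using this

lemma approx_data (hm : 1 ≤ m) {θ α f₀ : ℝ} (hθ : 1 < θ) (hα : 0 < α) (hf₀ : 0 < f₀) {f : E m → ℝ}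
    (hf : LocallyLipschitz f) (h1 : H1 f α f₀) :
    ∃ (v : ℕ → E m → ℝ) (ε l : ℕ → ℝ), (∀ n, ContDiff ℝ 2 (v n)) ∧ Tendsto ε atTop (𝓝 0) ∧
      (∀ n, |ε n| ≤ 1) ∧
      (∀ n, v n 0 = 0) ∧ (∀ n x, lap (v n) x = 2 * (ε n * v n x + l n
        + 1 / θ * ‖fderiv ℝ (v n) x‖ ^ θ - min (f x) n)) ∧
      (∃ L, ∀ n, |l n| ≤ L) ∧
      (∀ R, ∃ G, 0 ≤ G ∧ ∀ n (x : E m), ‖x‖ ≤ R → ‖fderiv ℝ (v n) x‖ ≤ G) ∧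
      ∃ C, ∀ᶠ n in atTop, ∀ x, -C ≤ v n x := by
  have hf0 : ∀ x, 0 ≤ f x := fun x => le_trans (by positivity) (h1 x).1
  obtain ⟨ψ, A, hψ, hA, hψ0, hψ1, hψA⟩ := barrier (m := m) hθ hα hf₀
  set ε : ℕ → ℝ := fun n => 1 / ((n:ℝ) + 1) with hε
  have hε0 : ∀ n, 0 < ε n := fun n => by rw [hε]; positivity
  have hε1 : ∀ n, ε n ≤ 1 := fun n => by
    rw [hε]; simp only; rw [div_le_one (by positivity)]; linarith [(Nat.cast_nonneg n : (0:ℝ) ≤ n)]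
  have hex : ∀ n : ℕ, ∃ u : E m → ℝ, ContDiff ℝ 2 u ∧ (∃ B, ∀ x, |u x| ≤ B) ∧
      ∀ x, ε n * u x - 1 / 2 * lap u x + 1 / θ * ‖fderiv ℝ u x‖ ^ θ = min (f x) n := by
    intro n
    obtain ⟨Λ, hΛ, hL⟩ := trunc_lip hf hf0 (fun C => by
      obtain ⟨ρ, -, h⟩ := coer hα hf₀ h1 C; exact ⟨ρ, h⟩) (n := (n:ℝ)) (Nat.cast_nonneg n)
    refine exist_disc hθ (hε0 n) hΛ (B := n) (fun x => ?_) hL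
    rw [abs_of_nonneg (le_min (hf0 x) (Nat.cast_nonneg n))]
    exact min_le_right _ _
  choose u hu hub heq using hex
  choose B hB using hub
  have hup : ∀ n y, ε n * u n y ≤ ψ y + A := by
    intro n y
    have := upper_bd (hε0 n) hψ hψ0 hψ1 hψA (hu n) (hB n) (heq n)
      (fun x => (min_le_left _ _).trans (h1 x).2) y
    have h2 : ε n * ψ y ≤ 1 * ψ y := mul_le_mul_of_nonneg_right (hε1 n) (hψ0 y)
    linarith
  have hlow : ∀ n y, 0 ≤ ε n * u n y := by
    intro n y
    by_contra! h
    obtain ⟨x, hx1, hx2⟩ := low_pt hθ (hu n) (hB n) (heq n) y (e := min 1 (-(ε n * u n y) / 4))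
      (lt_min one_pos (by linarith)) (min_le_left _ _)
    have h3 : 0 ≤ min (f x) n := le_min (hf0 x) (Nat.cast_nonneg n)
    have h4 := mul_le_mul_of_nonneg_left hx1 (hε0 n).le
    have h5 := min_le_right 1 (-(ε n * u n y) / 4)
    linarith
  have hgrad : ∀ n x, fderiv ℝ (fun x => u n x - u n 0) x = fderiv ℝ (u n) x := fun n x =>
    fderiv_sub_const _
  have hlap : ∀ n x, lap (fun x => u n x - u n 0) x = lap (u n) x := fun n x => by
    rw [lap_sub (hu n) contDiff_const, lap_const, sub_zero]
  obtain ⟨Cb, hCb1, hbern⟩ := bernstein hm hθ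
  have hG : ∀ R, ∃ G, 0 ≤ G ∧ ∀ n (x : E m), ‖x‖ ≤ R → ‖fderiv ℝ (u n) x‖ ≤ G := by
    intro R
    obtain ⟨b1, hb10, hb1⟩ := exists_bound_ball hf.continuous (R + 1)
    obtain ⟨b2, hb20, hb2⟩ := exists_bound_ball hψ.continuous (R + 1)
    obtain ⟨L, hL0, hL⟩ := lip_ball hf (R + 2)
    set P := 1 + b1 + b2 + A + L with hP
    have hP1 : 1 ≤ P := by rw [hP]; linarith
    have hPθ : ∀ s : ℝ, 1 ≤ s → P ≤ P ^ s := fun s hs => Real.self_le_rpow_of_one_le hP1 hs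
    refine ⟨Cb * P, by positivity, fun n x0 hx0 => ?_⟩
    have hnn : ∀ (x : E m) r, ‖x - x0‖ ≤ r → ‖x‖ ≤ R + r := fun x r hx => by
      have := norm_add_le (x - x0) x0
      rw [sub_add_cancel] at this
      linarith
    refine hbern (u n) (fun x => min (f x) n) (ε n) P x0 (hu n) (hε0 n).le hP1 (heq n) ?_ ?_
    · intro x hx
      have hxR := hnn x 1 hx
      refine le_trans ?_ (hPθ θ hθ.le)
      have a1 := hup n x
      have a2 := hlow n x
      have a3 := (abs_le.1 (hb1 x hxR)).2
      have a4 := (abs_le.1 (hb2 x hxR)).2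
      have a5 : 0 ≤ min (f x) n := le_min (hf0 x) (Nat.cast_nonneg n)
      have a6 := min_le_left (f x) n
      rw [abs_le]
      constructor <;> linarith
    · intro x y hx hy
      refine (abs_min_sub_le _ _ _).trans ((hL x y (hnn x 2 hx) (hnn y 2 hy)).trans ?_)
      have := hPθ (2 * θ - 1) (by linarith)
      exact mul_le_mul_of_nonneg_right (by linarith) (norm_nonneg _)
  refine ⟨fun n x => u n x - u n 0, ε, fun n => ε n * u n 0, fun n => (hu n).sub contDiff_const,
    tendsto_one_div_add_atTop_nhds_zero_nat,
    fun n => by rw [abs_of_pos (hε0 n)]; exact hε1 n, fun n => sub_self _, fun n x => ?_,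
    ⟨ψ 0 + A, fun n => ?_⟩, fun R => ?_, ?_⟩
  · rw [hgrad, hlap]
    linarith [heq n x]
  · rw [abs_of_nonneg (hlow n 0)]; exact hup n 0
  · simp only [hgrad]; exact hG R
  · obtain ⟨ρ, hρ0, hρ⟩ := coer hα hf₀ h1 (ψ 0 + A + 2)
    obtain ⟨G, hG0, hG⟩ := hG ρ
    obtain ⟨n0, hn0⟩ := exists_nat_gt (ψ 0 + A + 2)
    refine ⟨G * ρ, ?_⟩
    filter_upwards [eventually_ge_atTop n0] with n hn x
    obtain ⟨y, hy1, hy2⟩ : ∃ y, u n y ≤ u n x ∧ u n y ≤ u n 0 := by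
      rcases le_total (u n x) (u n 0) with h | h
      · exact ⟨x, le_rfl, h⟩
      · exact ⟨0, h, le_rfl⟩
    obtain ⟨z, hz1, hz2⟩ := low_pt hθ (hu n) (hB n) (heq n) y one_pos le_rfl
    have h3 := mul_le_mul_of_nonneg_left (hz1.trans hy2) (hε0 n).le
    have h4 := hup n 0
    have hn' : (n0:ℝ) ≤ n := by exact_mod_cast hn
    have h5 : f z ≤ ψ 0 + A + 2 := by
      rcases min_le_iff.1 (show min (f z) n ≤ ψ 0 + A + 2 by linarith) with h | h
      · exact h
      · linarith
    have hz := hρ z h5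
    have h6 := mvt_ball (hu n) (fun x hx => hG n x hx) hz (by simpa using hρ0 : ‖(0 : E m)‖ ≤ ρ)
    rw [sub_zero] at h6
    have h7 : G * ‖z‖ ≤ G * ρ := by gcongr
    have h8 := (abs_le.1 h6).1
    linarith

end approx
end EPP

namespace EPP
section limit
variable {m : ℕ}
open Topology Set MeasureTheory

noncomputable abbrev UU : Ultrafilter ℕ := Filter.hyperfilter ℕ

def EH (a : ℕ → E m → ℝ) : Prop :=
  ∀ R : ℝ, ∃ C : ℝ, 0 ≤ C ∧ ∀ n x, ‖x‖ ≤ R → |a n x| ≤ C ∧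
    ∀ y, ‖y‖ ≤ R → |a n x - a n y| ≤ C * √‖x - y‖

def UC (a : ℕ → E m → ℝ) (b : E m → ℝ) : Prop :=
  ∀ R e : ℝ, 0 < e → ∀ᶠ n in (UU : Filter ℕ), ∀ x, ‖x‖ ≤ R → |a n x - b x| ≤ e

lemma UC.tendsto {a : ℕ → E m → ℝ} {b : E m → ℝ} (h : UC a b) (x : E m) :
    Tendsto (fun n => a n x) UU (𝓝 (b x)) := by
  rw [Metric.tendsto_nhds]
  intro e he
  filter_upwards [h ‖x‖ (e / 2) (by positivity)] with n hn
  rw [Real.dist_eq]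
  have := hn x le_rfl
  linarith

lemma bdd_lim {a : ℕ → ℝ} {C : ℝ} (h : ∀ n, |a n| ≤ C) : ∃ b, Tendsto a UU (𝓝 b) := by
  obtain ⟨b, -, hb⟩ := (isCompact_Icc (a := -C) (b := C)).ultrafilter_le_nhds'
    (UU.map a) (by
      rw [Ultrafilter.mem_map]
      exact univ_mem' fun n => abs_le.1 (h n))
  exact ⟨b, hb⟩

lemma lim_le {a : ℕ → ℝ} {b C : ℝ} (h : Tendsto a UU (𝓝 b)) (hC : ∀ n, a n ≤ C) : b ≤ C :=
  le_of_tendsto h (Eventually.of_forall hC)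

lemma EH.lim {a : ℕ → E m → ℝ} (h : EH a) : ∃ b, LH b ∧ UC a b := by
  have h1 : ∀ x, ∃ b, Tendsto (fun n => a n x) UU (𝓝 b) := by
    intro x
    obtain ⟨C, _, hC⟩ := h ‖x‖
    exact bdd_lim fun n => (hC n x le_rfl).1
  choose b hb using h1
  have hL : ∀ R C, (∀ n x, ‖x‖ ≤ R → ∀ y, ‖y‖ ≤ R → |a n x - a n y| ≤ C * √‖x - y‖) →
      ∀ x y, ‖x‖ ≤ R → ‖y‖ ≤ R → |b x - b y| ≤ C * √‖x - y‖ := by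
    intro R C hC x y hx hy
    exact lim_le ((hb x).sub (hb y)).abs fun n => hC n x hx y hy
  refine ⟨b, fun R => ?_, fun R e he => ?_⟩
  · obtain ⟨C, C0, hC⟩ := h R
    exact ⟨C, C0, hL R C fun n x hx => (hC n x hx).2⟩
  · obtain ⟨C, C0, hC⟩ := h R
    have hb' := hL R C fun n x hx => (hC n x hx).2
    set d : ℝ := (e / (3 * (C + 1))) ^ 2 with hd
    have hd0 : 0 < d := by positivity
    have hsd : ∀ t, t ≤ d → C * √t ≤ e / 3 := by
      intro t ht
      have h2 : √t ≤ e / (3 * (C + 1)) := by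
        rw [← Real.sqrt_sq (show 0 ≤ e / (3 * (C + 1)) by positivity)]
        exact Real.sqrt_le_sqrt ht
      calc C * √t ≤ (C + 1) * (e / (3 * (C + 1))) := by gcongr; linarith
        _ = e / 3 := by field_simp
    obtain ⟨t, hts, htf, htc⟩ := (isCompact_closedBall (0 : E m) R).finite_cover_balls hd0
    have h3 : ∀ᶠ n in (UU : Filter ℕ), ∀ z ∈ t, |a n z - b z| < e / 3 := by
      rw [Filter.eventually_all_finite htf]
      intro z _
      have := Metric.tendsto_nhds.1 (hb z) (e / 3) (by positivity)
      simpa only [Real.dist_eq] using this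
    filter_upwards [h3] with n hn x hx
    have hxc := htc (show x ∈ Metric.closedBall (0 : E m) R by simpa using hx)
    simp only [mem_iUnion, Metric.mem_ball, exists_prop, dist_eq_norm] at hxc
    obtain ⟨z, hz, hxz⟩ := hxc
    have hzR : ‖z‖ ≤ R := by simpa using hts hz
    have a1 := ((hC n x hx).2 z hzR).trans (hsd _ hxz.le)
    have a2 := (hb' x z hx hzR).trans (hsd _ hxz.le)
    have a3 := hn z hz
    rw [abs_le] at *
    rw [abs_lt] at a3
    constructor <;> linarith [a1.1, a1.2, a2.1, a2.2, a3.1, a3.2]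

lemma EH.add {a b : ℕ → E m → ℝ} (ha : EH a) (hb : EH b) : EH fun n x => a n x + b n x := by
  intro R
  obtain ⟨C, h0, h1⟩ := ha R
  obtain ⟨D, g0, g1⟩ := hb R
  refine ⟨C + D, by positivity, fun n x hx => ⟨?_, fun y hy => ?_⟩⟩
  · have := abs_add_le (a n x) (b n x)
    have := (h1 n x hx).1
    have := (g1 n x hx).1
    linarith
  · have := abs_add_le (a n x - a n y) (b n x - b n y)
    have h3 := (h1 n x hx).2 y hy
    have h4 := (g1 n x hx).2 y hy
    rw [show a n x + b n x - (a n y + b n y) = a n x - a n y + (b n x - b n y) by ring]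
    linarith

lemma EH.mul_seq {a : ℕ → E m → ℝ} (ha : EH a) {c : ℕ → ℝ} {L : ℝ} (hc : ∀ n, |c n| ≤ L) :
    EH fun n x => c n * a n x := by
  have hL : 0 ≤ L := (abs_nonneg _).trans (hc 0)
  intro R
  obtain ⟨C, h0, h1⟩ := ha R
  refine ⟨L * C, by positivity, fun n x hx => ⟨?_, fun y hy => ?_⟩⟩
  · rw [abs_mul]
    exact mul_le_mul (hc n) (h1 n x hx).1 (abs_nonneg _) hL
  · rw [← mul_sub, abs_mul, mul_assoc]
    exact mul_le_mul (hc n) ((h1 n x hx).2 y hy) (abs_nonneg _) hL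

lemma EH.of_seq {c : ℕ → ℝ} {L : ℝ} (hc : ∀ n, |c n| ≤ L) : EH fun n (_ : E m) => c n := by
  have hL : 0 ≤ L := (abs_nonneg _).trans (hc 0)
  intro R
  exact ⟨L, hL, fun n x _ => ⟨hc n, fun y _ => by simp; positivity⟩⟩

lemma EH.of_lip {a : ℕ → E m → ℝ} (ha : ∀ R : ℝ, ∃ C : ℝ, 0 ≤ C ∧ ∀ n x, ‖x‖ ≤ R → |a n x| ≤ C ∧
    ∀ y, ‖y‖ ≤ R → |a n x - a n y| ≤ C * ‖x - y‖) : EH a := by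
  intro R
  obtain ⟨C, C0, hC⟩ := ha R
  refine ⟨C + C * √(2 * R), by positivity, fun n x hx => ⟨?_, fun y hy => ?_⟩⟩
  · have := (hC n x hx).1
    have : 0 ≤ C * √(2 * R) := by positivity
    linarith
  · refine ((hC n x hx).2 y hy).trans ?_
    have h2 : ‖x - y‖ ≤ 2 * R := (norm_sub_le x y).trans (by linarith)
    have h3 : ‖x - y‖ ≤ √(2 * R) * √‖x - y‖ := by
      calc ‖x - y‖ = √‖x - y‖ * √‖x - y‖ := (Real.mul_self_sqrt (norm_nonneg _)).symm
        _ ≤ _ := by gcongr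
    have h4 : 0 ≤ C * √‖x - y‖ := by positivity
    nlinarith [mul_le_mul_of_nonneg_left h3 C0]

lemma EH_J {w : ℝ → ℝ} (hwm : Measurable w) {κ : E m → ℝ} (hκ : Ker κ) {r : ℝ} (hr0 : 0 ≤ r)
    (hr : r ≤ 1) (hw : ∀ s ∈ Ioc 0 r, |w s| ≤ 1) {h : ℕ → E m → ℝ} (hh : ∀ n, Continuous (h n))
    (hb : ∀ R : ℝ, ∃ C : ℝ, 0 ≤ C ∧ ∀ n x, ‖x‖ ≤ R → |h n x| ≤ C) :
    EH fun n => J w κ r (h n) := by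
  intro R
  obtain ⟨C, C0, hC⟩ := hb (R + 1)
  have k1 := mass_nonneg κ
  have k2 := hc_nonneg κ
  refine ⟨mass κ * C + hc κ * C, by positivity, fun n x hx => ⟨?_, fun y hy => ?_⟩⟩
  · have h2 := J_bound hκ hr0 hr (h := h n) x hw
      (ball_hB (hC n) x (by simpa using hx))
    have h3 : 1 * (mass κ * C) * r ≤ mass κ * C := by
      have : 0 ≤ mass κ * C := by positivity
      nlinarith
    have : 0 ≤ hc κ * C := by positivity
    linarith
  · have h2 := J_hoelder hwm hκ hr0 hr (hh n) hw zero_le_one (convex_closedBall 0 R)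
      (ball_hB (hC n)) (x := x) (y := y) (by simpa using hx) (by simpa using hy)
    refine h2.trans ?_
    have : 0 ≤ mass κ * C * √‖x - y‖ := by positivity
    nlinarith

lemma J_lim {w : ℝ → ℝ} (hwm : Measurable w) {κ : E m → ℝ} (hκ : Ker κ) {r : ℝ} (hr0 : 0 ≤ r)
    (hr : r ≤ 1) (hw : ∀ s ∈ Ioc 0 r, |w s| ≤ 1) {h : ℕ → E m → ℝ} (hh : ∀ n, Continuous (h n))
    {b : E m → ℝ} (hb : Continuous b) (hu : UC h b) (x : E m) :
    Tendsto (fun n => J w κ r (h n) x) UU (𝓝 (J w κ r b x)) := by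
  rw [Metric.tendsto_nhds]
  intro e he
  have k1 := mass_nonneg κ
  filter_upwards [hu (‖x‖ + 1) (e / (2 * (mass κ + 1))) (by positivity)] with n hn
  rw [Real.dist_eq, ← J_sub hwm hκ hr0 (hh n) hb (dom_of_bounded hκ hr (hh n) hw)
    (dom_of_bounded hκ hr hb hw)]
  refine lt_of_le_of_lt (J_bound hκ hr0 hr x hw
    (ball_hB (h := fun y => h n y - b y) hn x (by simp))) ?_
  have h2 : mass κ * (e / (2 * (mass κ + 1))) ≤ e / 2 := by
    calc _ ≤ (mass κ + 1) * (e / (2 * (mass κ + 1))) := by gcongr; linarith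
      _ = e / 2 := by field_simp
  have h3 : 0 ≤ mass κ * (e / (2 * (mass κ + 1))) := by positivity
  nlinarith

lemma T_le {a b : E m → ℝ} (ha : Continuous a) (hb : Continuous b) (x : E m)
    (h : ∀ k r, KR k r → T k r a x = T k r b x) : a x ≤ b x := by
  by_contra hc
  push Not at hc
  have hcont : Continuous fun y => a y - b y := ha.sub hb
  have h0 : 0 < a x - b x := by linarith
  obtain ⟨δ, δ0, hδ⟩ := Metric.eventually_nhds_iff.1 (hcont.continuousAt.eventually
    (lt_mem_nhds (half_lt_self h0)))
  set e := (a x - b x) / 2 with he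
  have e0 : 0 < e := by positivity
  set r : ℝ := min 1 (δ / 2) with hr
  have r0 : 0 < r := by positivity
  have H : KR (1 / r ^ 2) r := ⟨r0, min_le_left _ _, by field_simp⟩
  have h1 := h _ _ H
  have h2 := J_sub H.wtT.hm ker_eta r0.le ha hb (dom_of_bounded ker_eta H.r1 ha H.wtT.b)
    (dom_of_bounded ker_eta H.r1 hb H.wtT.b) x
  unfold T at h1
  rw [h1, sub_self] at h2
  have hV : ∀ s, 0 ≤ s → s ≤ r → 0 < V (eta m) s (fun y => a y - b y) x := by
    intro s s0 hs
    have h3 : V (eta m) s (fun _ => e) x ≤ V (eta m) s (fun y => a y - b y) x := by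
      unfold V
      refine integral_mono (V_integrable ker_eta continuous_const s x)
        (V_integrable ker_eta hcont s x) fun z => ?_
      by_cases hz : 1 < ‖z‖
      · simp [ker_eta.supp z hz]
      · push Not at hz
        refine mul_le_mul_of_nonneg_left (hδ (y := x - s • z) ?_).le (eta_nonneg z)
        rw [dist_eq_norm, sub_sub_cancel_left, norm_neg, norm_smul, Real.norm_eq_abs, abs_of_nonneg s0]
        have : r ≤ δ / 2 := min_le_right _ _
        nlinarith [norm_nonneg z]
    rw [V_const] at h3
    have := Ie_pos (m := m)
    unfold Ie at this
    have : 0 < (∫ z, eta m z) * e := by positivity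
    linarith
  have h4 : 0 < J (fun s => s * (1 - 1 / r ^ 2 * s ^ 2)) (eta m) r (fun y => a y - b y) x := by
    unfold J
    refine intervalIntegral.intervalIntegral_pos_of_pos_on ?_ (fun s hs => ?_) r0
    · refine Continuous.intervalIntegrable ?_ _ _
      have := V_cont_s ker_eta hcont x
      fun_prop
    · have h5 := hV s hs.1.le hs.2.le
      have h6 : 0 < 1 - 1 / r ^ 2 * s ^ 2 := by
        have h7 : s ^ 2 < r ^ 2 := by have := hs.1; have := hs.2; gcongr
        rw [one_div_mul_eq_div, sub_pos, div_lt_one (by positivity)]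
        exact h7
      have := hs.1
      positivity
  linarith

end limit
end EPP

namespace EPP
section limit2
variable {m : ℕ}
open Topology Set MeasureTheory

lemma pd_rep {k r : ℝ} (H : KR k r) {v g : E m → ℝ} (hv : Differentiable ℝ v) (hg : Continuous g)
    (h : ∀ x, Mr m * v x = 2 * k * Q r v x - T k r g x) (i : Fin m) (x : E m) :
    Mr m * pd i v x = 2 * k * J (fun _ => 1) (pd i (rho m)) r v x
      - J (fun s => 1 - k * s ^ 2) (pd i (eta m)) r g x := by
  have hq := wtQ H.r0 H.r1
  have dQ : Differentiable ℝ (Q r v) := fun x =>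
    (hq.J_c1 ker_rho hv.continuous x).differentiableAt
  have dT : Differentiable ℝ (T k r g) := fun x => (H.wtT.J_c1 ker_eta hg x).differentiableAt
  have e : (fun x => Mr m * v x) = fun x => 2 * k * Q r v x - T k r g x := funext h
  have e1 := congrArg (pd i) e
  rw [pd_const_mul hv, pd_sub (u := fun x => 2 * k * Q r v x) (dQ.const_mul _) dT,
    pd_const_mul dQ] at e1
  have e2 := congrFun e1 x
  simp only at e2
  rw [e2, T, Q, hq.J_pd ker_rho hv.continuous, H.wtT.J_pd ker_eta hg]

lemma KR11 : KR 1 1 := ⟨one_pos, le_rfl, by norm_num⟩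

lemma limit_core {v : ℕ → E m → ℝ} (hv : ∀ n, ContDiff ℝ 2 (v n)) {φ g : E m → ℝ}
    (h1 : UC v φ) (h2 : UC (fun n => lap (v n)) g) (hφ : LH φ) (hg : LH g) :
    ContDiff ℝ 2 φ ∧ (∀ i x, Tendsto (fun n => pd i (v n) x) UU (𝓝 (pd i φ x))) ∧
      ∀ x, lap φ x = g x := by
  have hvc : ∀ n, Continuous (v n) := fun n => (hv n).continuous
  have hlc : ∀ n, Continuous (lap (v n)) := fun n => continuous_lap (hv n)
  have hM := Mr_pos (m := m)
  have hrep : ∀ k r, KR k r → ∀ x, Mr m * φ x = 2 * k * Q r φ x - T k r g x := by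
    intro k r H x
    have hq := wtQ H.r0 H.r1
    have a1 := J_lim hq.hm ker_rho H.r0.le H.r1 hq.b hvc hφ.cont h1 x
    have a2 := J_lim H.wtT.hm ker_eta H.r0.le H.r1 H.wtT.b hlc hg.cont h2 x
    have a3 := (h1.tendsto x).const_mul (Mr m)
    have a4 := (a1.const_mul (2 * k)).sub a2
    refine tendsto_nhds_unique a3 (a4.congr fun n => ?_)
    exact (rep H (hv n) x).symm
  have hC : ContDiff ℝ 2 φ := by
    have e : φ = fun x => (Mr m)⁻¹ * (2 * 1 * Q 1 φ x - T 1 1 g x) := by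
      funext x; rw [← hrep 1 1 KR11 x]; field_simp
    rw [e]
    exact contDiff_const.mul ((contDiff_const.mul (Q_c2 one_pos le_rfl hφ)).sub (T_c2 KR11 hg))
  refine ⟨hC, fun i x => ?_, fun x => ?_⟩
  · have H := KR11
    have hq := wtQ H.r0 H.r1
    have a1 := J_lim hq.hm1 (ker_rho.pd i) H.r0.le H.r1 hq.b1 hvc hφ.cont h1 x
    have a2 := J_lim H.wtT.hm1 (ker_eta.pd i) H.r0.le H.r1 H.wtT.b1 hlc hg.cont h2 x
    have a4 := ((a1.const_mul (2 * 1)).sub a2).const_mul (Mr m)⁻¹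
    rw [← pd_rep H (diff_of_two hC) hg.cont (hrep 1 1 H) i x, inv_mul_cancel_left₀ hM.ne'] at a4
    refine a4.congr fun n => ?_
    rw [← pd_rep H (diff_of_two (hv n)) (hlc n) (rep H (hv n)) i x, inv_mul_cancel_left₀ hM.ne']
  · have e : ∀ k r, KR k r → T k r (lap φ) x = T k r g x := by
      intro k r H
      have b1 := rep H hC x
      have b2 := hrep k r H x
      linarith
    have hl := continuous_lap hC
    exact le_antisymm (T_le hl hg.cont x e) (T_le hg.cont hl x fun k r H => (e k r H).symm)

set_option maxHeartbeats 1000000 in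
lemma exist_sol (hm : 1 ≤ m) {θ α f₀ : ℝ} (hθ : 1 < θ) (hα : 0 < α) (hf₀ : 0 < f₀) {f : E m → ℝ}
    (hf : LocallyLipschitz f) (hH1 : H1 f α f₀) :
    ∃ (lam : ℝ) (φ : E m → ℝ) (C : ℝ), ContDiff ℝ 2 φ ∧ (∀ x, -C ≤ φ x) ∧
      ∀ x, -(1 / 2) * lap φ x + 1 / θ * ‖fderiv ℝ φ x‖ ^ θ = f x - lam := by
  have hM := Mr_pos (m := m)
  have hf0 : ∀ x, 0 ≤ f x := fun x => le_trans (by positivity) (hH1 x).1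
  obtain ⟨v, ε, l, hv, hε, hε1, hv0, heq, ⟨L, hL⟩, hG, C, hC⟩ := approx_data hm hθ hα hf₀ hf hH1
  have hvc : ∀ n, Continuous (v n) := fun n => (hv n).continuous
  have hlc : ∀ n, Continuous (lap (v n)) := fun n => continuous_lap (hv n)
  have EHv : EH v := by
    refine EH.of_lip fun R => ?_
    obtain ⟨G, G0, hG⟩ := hG R
    refine ⟨G + G * |R|, by positivity, fun n x hx => ⟨?_, fun y hy => ?_⟩⟩
    · have R0 : 0 ≤ R := (norm_nonneg x).trans hx
      have := mvt_ball (hv n) (hG n) hx (y := 0) (by simpa using R0)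
      rw [hv0, sub_zero, sub_zero] at this
      rw [abs_of_nonneg R0]
      nlinarith
    · have := mvt_ball (hv n) (hG n) hx hy
      have h3 : 0 ≤ G * |R| * ‖x - y‖ := by positivity
      linarith
  have hpow : ∀ R, ∃ B, 0 ≤ B ∧ ∀ n (x : E m), ‖x‖ ≤ R → |‖fderiv ℝ (v n) x‖ ^ θ| ≤ B := by
    intro R
    obtain ⟨G, G0, hG⟩ := hG R
    refine ⟨G ^ θ, by positivity, fun n x hx => ?_⟩
    rw [abs_of_nonneg (by positivity)]
    have := hG n x hx
    gcongr
  have EHf : EH fun n (x : E m) => min (f x) n := by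
    refine EH.of_lip fun R => ?_
    obtain ⟨K, K0, hK⟩ := lip_ball hf R
    obtain ⟨B, B0, hB⟩ := exists_bound_ball hf.continuous R
    refine ⟨K + B, by positivity, fun n x hx => ⟨?_, fun y hy => ?_⟩⟩
    · have b1 : 0 ≤ min (f x) (n : ℝ) := le_min (hf0 x) (Nat.cast_nonneg n)
      rw [abs_of_nonneg b1]
      have := min_le_left (f x) (n : ℝ)
      have := (abs_le.1 (hB x hx)).2
      linarith
    · have b1 := abs_min_sub_le (f x) (f y) n
      have b2 := hK x y hx hy
      have : 0 ≤ B * ‖x - y‖ := by positivity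
      linarith
  -- bound on the Laplacians
  have hlb : ∀ R : ℝ, ∃ B : ℝ, 0 ≤ B ∧ ∀ n (x : E m), ‖x‖ ≤ R → |lap (v n) x| ≤ B := by
    intro R
    obtain ⟨B1, B10, h1⟩ := EHv R
    obtain ⟨B2, B20, h2⟩ := EHf R
    obtain ⟨B3, B30, h3⟩ := hpow R
    have L0 : 0 ≤ L := (abs_nonneg _).trans (hL 0)
    refine ⟨2 * (B1 + L + 1 / θ * B3 + B2), by positivity, fun n x hx => ?_⟩
    have c1 : |ε n * v n x| ≤ 1 * B1 := by
      rw [abs_mul]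
      exact mul_le_mul (hε1 n) (h1 n x hx).1 (abs_nonneg _) zero_le_one
    have c2 := (h2 n x hx).1
    have c3 : |1 / θ * ‖fderiv ℝ (v n) x‖ ^ θ| ≤ 1 / θ * B3 := by
      rw [abs_mul, abs_of_pos (show 0 < 1 / θ by positivity)]
      exact mul_le_mul_of_nonneg_left (h3 n x hx) (by positivity)
    have c4 := hL n
    rw [heq, abs_mul, abs_two]
    rw [abs_le] at c1 c2 c3 c4
    have : |ε n * v n x + l n + 1 / θ * ‖fderiv ℝ (v n) x‖ ^ θ - min (f x) n|
        ≤ B1 + L + 1 / θ * B3 + B2 := by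
      rw [abs_le]
      constructor <;> linarith [c1.1, c1.2, c2.1, c2.2, c3.1, c3.2, c4.1, c4.2]
    linarith
  have hvb : ∀ R : ℝ, ∃ B : ℝ, 0 ≤ B ∧ ∀ n (x : E m), ‖x‖ ≤ R → |v n x| ≤ B := by
    intro R
    obtain ⟨B1, B10, h1⟩ := EHv R
    exact ⟨B1, B10, fun n x hx => (h1 n x hx).1⟩
  have EHp : ∀ i, EH fun n => pd i (v n) := by
    intro i
    have H := KR11
    have hq := wtQ H.r0 H.r1
    have a1 := EH_J hq.hm1 (ker_rho.pd i) H.r0.le H.r1 hq.b1 hvc hvb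
    have a2 := EH_J H.wtT.hm1 (ker_eta.pd i) H.r0.le H.r1 H.wtT.b1 hlc hlb
    have a3 := ((a1.mul_seq (c := fun _ => 2 * 1) (L := |2 * 1|) (fun _ => le_rfl)).add
      (a2.mul_seq (c := fun _ => -1) (L := |-1|) (fun _ => le_rfl))).mul_seq
      (c := fun _ => (Mr m)⁻¹) (L := |(Mr m)⁻¹|) (fun _ => le_rfl)
    convert! a3 using 1
    funext n x
    have := pd_rep H (diff_of_two (hv n)) (hlc n) (rep H (hv n)) i x
    rw [eq_inv_mul_iff_mul_eq₀ hM.ne', this]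
    ring
  have EHn : EH fun n x => ‖fderiv ℝ (v n) x‖ ^ θ := by
    intro R
    obtain ⟨G, G0, hG⟩ := hG R
    obtain ⟨B, B0, hB⟩ := hpow R
    choose D D0 hD using fun i => EHp i R
    have S0 : 0 ≤ ∑ i, D i := Finset.sum_nonneg fun i _ => D0 i
    refine ⟨B + θ * G ^ (θ - 1) * ∑ i, D i, by positivity, fun n x hx => ⟨?_, fun y hy => ?_⟩⟩
    · have := hB n x hx
      have : 0 ≤ θ * G ^ (θ - 1) * ∑ i, D i := by positivity
      linarith
    · have d1 := rpow_lip hθ (a := ‖fderiv ℝ (v n) x‖) (b := ‖fderiv ℝ (v n) y‖) (R := G)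
        ⟨norm_nonneg _, hG n x hx⟩ ⟨norm_nonneg _, hG n y hy⟩
      have d2 : |‖fderiv ℝ (v n) x‖ - ‖fderiv ℝ (v n) y‖| ≤ (∑ i, D i) * √‖x - y‖ := by
        refine (abs_norm_sub_norm_le _ _).trans ?_
        rw [fderiv_eq_gl, fderiv_eq_gl, gl_sub, Finset.sum_mul]
        exact (norm_gl_le _).trans (Finset.sum_le_sum fun i _ => (hD i n x hx).2 y hy)
      have d3 : θ * G ^ (θ - 1) * |‖fderiv ℝ (v n) x‖ - ‖fderiv ℝ (v n) y‖|
          ≤ θ * G ^ (θ - 1) * ((∑ i, D i) * √‖x - y‖) :=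
        mul_le_mul_of_nonneg_left d2 (by positivity)
      have d4 : 0 ≤ B * √‖x - y‖ := by positivity
      linarith
  have EHl : EH fun n => lap (v n) := by
    have a3 := (((EHv.mul_seq hε1).add (EH.of_seq (m := m) hL)).add
      ((EHn.mul_seq (c := fun _ => 1 / θ) (L := |1 / θ|) (fun _ => le_rfl)).add
      (EHf.mul_seq (c := fun _ => -1) (L := |-1|) (fun _ => le_rfl)))).mul_seq
      (c := fun _ => 2) (L := |2|) (fun _ => le_rfl)
    convert! a3 using 1
    funext n x
    rw [heq]; ring
  obtain ⟨φ, hφ, uφ⟩ := EHv.lim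
  obtain ⟨g, hg, ug⟩ := EHl.lim
  obtain ⟨lam, hlam⟩ := bdd_lim hL
  obtain ⟨hφ2, hpd, hlap⟩ := limit_core hv uφ ug hφ hg
  have hat : (UU : Filter ℕ) ≤ atTop := Nat.hyperfilter_le_atTop
  refine ⟨lam, φ, C, hφ2, fun x => ?_, fun x => ?_⟩
  · refine ge_of_tendsto (uφ.tendsto x) ?_
    filter_upwards [hC.filter_mono hat] with n hn
    exact hn x
  · have t1 : Tendsto (fun n => fderiv ℝ (v n) x) UU (𝓝 (fderiv ℝ φ x)) := by
      simp only [fderiv_eq_gl]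
      unfold gl
      exact tendsto_finsetSum _ fun i _ => (hpd i x).smul_const _
    have t2 := (t1.norm.rpow_const (Or.inr (by linarith : 0 ≤ θ))).const_mul (1 / θ)
    have t3 := (hε.mono_left hat).mul (uφ.tendsto x)
    have t4 : Tendsto (fun n : ℕ => min (f x) (n : ℝ)) UU (𝓝 (f x)) := by
      refine Tendsto.congr' ?_ tendsto_const_nhds
      filter_upwards [(tendsto_natCast_atTop_atTop.eventually_ge_atTop (f x)).filter_mono hat]
        with n hn
      exact (min_eq_left hn).symm
    have t5 := (((t3.add hlam).add t2).sub t4).const_mul 2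
    have t6 := ug.tendsto x
    have e := tendsto_nhds_unique t6 (t5.congr fun n => (heq n x).symm)
    rw [hlap x, e]
    ring

end limit2
end EPP

namespace EPP
section lipgrad
variable {m : ℕ}
open Topology Set MeasureTheory

lemma ae_aff {g : E m → ℝ} (hg : ∀ᵐ p, DifferentiableAt ℝ g p) (c : E m) {s : ℝ} (hs : s ≠ 0) :
    ∀ᵐ z, DifferentiableAt ℝ g (c - s • z) := by
  rw [ae_iff] at hg ⊢
  have h1 : volume ((fun z : E m => c - z) ⁻¹' {p | ¬ DifferentiableAt ℝ g p}) = 0 :=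
    (Measure.measurePreserving_sub_left volume c).quasiMeasurePreserving.preimage_null hg
  have h2 := Measure.addHaar_preimage_smul volume hs
    ((fun z : E m => c - z) ⁻¹' {p | ¬ DifferentiableAt ℝ g p})
  rw [h1, mul_zero] at h2
  exact h2

lemma lip_grad {f : E m → ℝ} (hf : LocallyLipschitz f) {R K : ℝ} (hK0 : 0 ≤ K)
    (hK : ∀ p, ‖p‖ < R + 1 → DifferentiableAt ℝ f p → ‖fderiv ℝ f p‖ ≤ K) {x y : E m}
    (hx : ‖x‖ ≤ R) (hy : ‖y‖ ≤ R) : |f x - f y| ≤ K * ‖x - y‖ := by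
  obtain ⟨L, hL⟩ := (hf.locallyLipschitzOn
    (s := Metric.closedBall (0 : E m) (R + 1))).exists_lipschitzOnWith_of_compact
    (isCompact_closedBall 0 (R + 1))
  obtain ⟨g, hg, hgf⟩ := hL.extend_real
  have hgf' : ∀ p, ‖p‖ < R + 1 → g =ᶠ[𝓝 p] f := by
    intro p hp
    filter_upwards [Metric.isOpen_ball.mem_nhds (show p ∈ Metric.ball (0 : E m) (R + 1) by simpa using hp)]
      with q hq
    exact (hgf (Metric.ball_subset_closedBall hq)).symm
  have hgK : ∀ p, ‖p‖ < R + 1 → DifferentiableAt ℝ g p → ‖fderiv ℝ g p‖ ≤ K := by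
    intro p hp hd
    rw [(hgf' p hp).fderiv_eq]
    exact hK p hp ((hgf' p hp).differentiableAt_iff.1 hd)
  have hae := hg.ae_differentiableAt (μ := (volume : Measure (E m)))
  have hI := Ie_pos (m := m)
  set w := x - y with hw
  have key : ∀ s ∈ Ioo (0:ℝ) 1, |V (eta m) s g x - V (eta m) s g y| ≤ Ie m * (K * ‖w‖) := by
    intro s hs
    have hd : ∀ t ∈ Icc (0:ℝ) 1, HasDerivAt (fun t : ℝ => V (eta m) s g (y + t • w))
        (∫ z, eta m z * fderiv ℝ g (y + t • w - s • z) w) t := by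
      intro t ht
      have := hasDerivAt_integral_of_dominated_loc_of_lip (μ := (volume : Measure (E m))) (s := univ)
        (F := fun (t : ℝ) z => eta m z * g (y + t • w - s • z))
        (F' := fun z => eta m z * fderiv ℝ g (y + t • w - s • z) w) (x₀ := t)
        (bound := fun z => eta m z * (L * ‖w‖)) univ_mem
        (Eventually.of_forall fun t => (V_integrable ker_eta hg.continuous s _).aestronglyMeasurable)
        (V_integrable ker_eta hg.continuous s _) ?_ ?_ (ker_eta.integrable.mul_const _) ?_
      · exact this.2
      · refine (ker_eta.cont.measurable.mul ?_).aestronglyMeasurable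
        exact (measurable_fderiv_apply_const ℝ g w).comp (by fun_prop)
      · refine Eventually.of_forall fun z => ?_
        refine LipschitzOnWith.of_dist_le_mul fun t1 _ t2 _ => ?_
        have h0 := eta_nonneg z
        have h1 := hg.dist_le_mul (y + t1 • w - s • z) (y + t2 • w - s • z)
        rw [Real.dist_eq, dist_eq_norm, show y + t1 • w - s • z - (y + t2 • w - s • z)
          = (t1 - t2) • w by module, norm_smul] at h1
        rw [Real.coe_nnabs, abs_of_nonneg (by positivity), Real.dist_eq, Real.dist_eq, ← mul_sub,
          abs_mul, abs_of_nonneg h0]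
        rw [Real.norm_eq_abs] at h1
        calc _ ≤ eta m z * (L * (|t1 - t2| * ‖w‖)) := by gcongr
          _ = _ := by ring
      · filter_upwards [ae_aff hae (y + t • w) hs.1.ne'] with z hz
        have h1 : HasDerivAt (fun t : ℝ => y + t • w - s • z) w t := by
          have := (((hasDerivAt_id t).smul_const w).const_add y).sub_const (s • z)
          simpa using this
        exact (hz.hasFDerivAt.comp_hasDerivAt t h1).const_mul _
    have hb : ∀ t ∈ Icc (0:ℝ) 1, ‖∫ z, eta m z * fderiv ℝ g (y + t • w - s • z) w‖
        ≤ Ie m * (K * ‖w‖) := by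
      intro t ht
      unfold Ie
      rw [← integral_mul_const]
      refine norm_integral_le_of_norm_le (ker_eta.integrable.mul_const _) ?_
      filter_upwards [ae_aff hae (y + t • w) hs.1.ne'] with z hz
      rw [norm_mul, Real.norm_eq_abs, abs_of_nonneg (eta_nonneg z)]
      by_cases hz1 : 1 < ‖z‖
      · simp [ker_eta.supp z hz1]
      · push Not at hz1
        refine mul_le_mul_of_nonneg_left ?_ (eta_nonneg z)
        refine ((fderiv ℝ g _).le_opNorm w).trans ?_
        refine mul_le_mul_of_nonneg_right (hgK _ ?_ hz) (norm_nonneg _)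
        have h1 : ‖y + t • w‖ ≤ R := by
          have := (convex_closedBall (0 : E m) R) (x := y) (y := x) (by simpa using hy)
            (by simpa using hx) (a := 1 - t) (b := t) (by linarith [ht.2]) ht.1 (by ring)
          rw [show y + t • w = (1 - t) • y + t • x by rw [hw]; module]
          simpa using this
        have h2 : ‖s • z‖ < 1 := by
          rw [norm_smul, Real.norm_eq_abs, abs_of_pos hs.1]
          have := hs.1
          have := hs.2
          nlinarith [norm_nonneg z]
        exact (norm_sub_le _ _).trans_lt (by linarith)
    have := (convex_Icc (0:ℝ) 1).norm_image_sub_le_of_norm_hasDerivWithin_le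
      (fun t ht => (hd t ht).hasDerivWithinAt) hb (x := 0) (y := 1) (by simp) (by simp)
    simpa [hw] using this
  have hc : ∀ p, Tendsto (fun s => V (eta m) s g p) (𝓝[>] 0) (𝓝 (Ie m * g p)) := by
    intro p
    have := (V_cont_s ker_eta hg.continuous p).tendsto 0
    rw [V_zero] at this
    exact this.mono_left nhdsWithin_le_nhds
  have hfin := le_of_tendsto ((hc x).sub (hc y)).abs (b := Ie m * (K * ‖w‖)) (by
    filter_upwards [Ioo_mem_nhdsGT one_pos] with s hs
    exact key s hs)
  rw [← mul_sub, abs_mul, abs_of_pos hI] at hfin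
  have h5 := le_of_mul_le_mul_left hfin hI
  rwa [← hgf (show x ∈ Metric.closedBall (0 : E m) (R + 1) by simp; linarith),
    ← hgf (show y ∈ Metric.closedBall (0 : E m) (R + 1) by simp; linarith)] at h5

lemma lip_H0 {f : E m → ℝ} {α f₀ : ℝ} (hα : 0 < α) (hf₀ : 0 < f₀) (h0 : H0 f α f₀) {R : ℝ}
    (hR : 0 ≤ R) {x y : E m} (hx : ‖x‖ ≤ R) (hy : ‖y‖ ≤ R) :
    |f x - f y| ≤ 2 * f₀ * (2 + R) ^ α * ‖x - y‖ := by
  refine lip_grad h0.1 (by positivity) (fun p hp hd => ?_) hx hy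
  have h1 : (1:ℝ) ≤ (2 + R) ^ α := Real.one_le_rpow (by linarith) hα.le
  rw [← norm_gradient]
  rcases le_or_gt 1 α with ha | ha
  · refine ((h0.2.2 p hd).1 ha).trans ?_
    have h2 : ‖p‖ ^ (α - 1) ≤ (2 + R) ^ (α - 1) := by gcongr; linarith
    have h3 : (2 + R) ^ (α - 1) ≤ (2 + R) ^ α :=
      Real.rpow_le_rpow_of_exponent_le (by linarith) (by linarith)
    nlinarith
  · refine ((h0.2.2 p hd).2 ha).trans ?_
    nlinarith

end lipgrad
end EPP

namespace EPP
section growth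
variable {m : ℕ}
open Topology Set

lemma grad_growth (hm : 1 ≤ m) {θ α f₀ lam : ℝ} (hθ : 1 < θ) (hα : 0 < α) (hf₀ : 0 < f₀)
    {f φ : E m → ℝ} (h0 : H0 f α f₀) (h1 : H1 f α f₀) (hφ : ContDiff ℝ 2 φ)
    (heq : ∀ x, -(1 / 2) * lap φ x + 1 / θ * ‖fderiv ℝ φ x‖ ^ θ = f x - lam) :
    ∃ G, 0 ≤ G ∧ ∀ y, ‖fderiv ℝ φ y‖ ≤ G * (1 + ‖y‖) ^ (α / θ) := by
  obtain ⟨C, C1, hC⟩ := bernstein hm hθ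
  have hθ0 : 0 < θ := by linarith
  set A : ℝ := (2 * f₀ + |lam|) * 4 ^ α + 1 with hA
  have hA1 : 1 ≤ A := by
    have : 0 ≤ (2 * f₀ + |lam|) * 4 ^ α := by positivity
    linarith
  refine ⟨C * A, by positivity, fun y => ?_⟩
  set t : ℝ := 1 + ‖y‖ with ht
  have ht1 : 1 ≤ t := by have := norm_nonneg y; linarith
  have ht0 : 0 < t := by linarith
  set P : ℝ := A * t ^ (α / θ) with hP
  have htp : 1 ≤ t ^ (α / θ) := Real.one_le_rpow ht1 (by positivity)
  have hta : 1 ≤ t ^ α := Real.one_le_rpow ht1 hα.le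
  have hP1 : 1 ≤ P := one_le_mul_of_one_le_of_one_le hA1 htp
  have hPθ : A * t ^ α ≤ P ^ θ := by
    rw [hP, Real.mul_rpow (by positivity) (by positivity), ← Real.rpow_mul ht0.le,
      div_mul_cancel₀ _ hθ0.ne']
    refine mul_le_mul_of_nonneg_right ?_ (by positivity)
    exact Real.self_le_rpow_of_one_le hA1 hθ.le
  have hPθ2 : P ^ θ ≤ P ^ (2 * θ - 1) := Real.rpow_le_rpow_of_exponent_le hP1 (by linarith)
  have h4t : ∀ s : ℝ, 0 ≤ s → s ≤ 4 * t → s ^ α ≤ 4 ^ α * t ^ α := by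
    intro s hs hst
    rw [← Real.mul_rpow (by norm_num) ht0.le]
    gcongr
  have h4 : (1:ℝ) ≤ 4 ^ α := Real.one_le_rpow (by norm_num) hα.le
  have h4' : (1:ℝ) ≤ 4 ^ α * t ^ α := one_le_mul_of_one_le_of_one_le h4 hta
  have hnx : ∀ (x : E m) (d : ℝ), ‖x - y‖ ≤ d → ‖x‖ ≤ ‖y‖ + d := by
    intro x d hx
    have := norm_add_le (x - y) y
    rw [sub_add_cancel] at this
    linarith
  have hfin : ∀ s : ℝ, s ≤ (2 * f₀ + |lam|) * (4 ^ α * t ^ α) → s ≤ P ^ θ := by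
    intro s hs
    refine hs.trans (le_trans ?_ hPθ)
    rw [← mul_assoc]
    exact mul_le_mul_of_nonneg_right (by linarith) (by positivity)
  have := hC φ (fun x => f x - lam) 0 P y hφ le_rfl hP1 (fun x => ?_) (fun x hx => ?_)
    (fun x z hx hz => ?_)
  · rw [mul_assoc]; exact this
  · rw [← heq x]; ring
  · refine hfin _ ?_
    have a1 := hnx x 1 hx
    have a2 := h4t ‖x‖ (norm_nonneg x) (by linarith)
    have a3 := (h1 x).2
    have a4 : 0 ≤ f x := le_trans (by positivity) (h1 x).1
    have a5 : |f x - lam| ≤ f x + |lam| := by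
      have := abs_sub (f x) lam
      rw [abs_of_nonneg a4] at this
      exact this
    rw [zero_mul, sub_zero]
    have a6 : f₀ * (‖x‖ ^ α + 1) ≤ f₀ * (2 * (4 ^ α * t ^ α)) := by gcongr; linarith
    have a7 : |lam| * 1 ≤ |lam| * (4 ^ α * t ^ α) := by gcongr
    linarith
  · rw [show f x - lam - (f z - lam) = f x - f z by ring]
    refine (lip_H0 hα hf₀ h0 (R := ‖y‖ + 2) (by positivity) (hnx x 2 hx) (hnx z 2 hz)).trans ?_
    refine mul_le_mul_of_nonneg_right (le_trans (hfin _ ?_) hPθ2) (norm_nonneg _)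
    have a2 := h4t (2 + (‖y‖ + 2)) (by positivity) (by have := norm_nonneg y; linarith)
    have a7 : 0 ≤ |lam| * (4 ^ α * t ^ α) := by positivity
    have a8 : 2 * f₀ * (2 + (‖y‖ + 2)) ^ α ≤ 2 * f₀ * (4 ^ α * t ^ α) := by gcongr
    linarith

lemma upper_growth {β G : ℝ} (hβ : 0 < β) (hG : 0 ≤ G) {φ : E m → ℝ} (hφ : ContDiff ℝ 2 φ)
    (h : ∀ y, ‖fderiv ℝ φ y‖ ≤ G * (1 + ‖y‖) ^ β) :
    ∃ D, 0 ≤ D ∧ ∀ y, φ y ≤ D * (1 + ‖y‖ ^ (β + 1)) := by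
  refine ⟨|φ 0| + G * 2 ^ (β + 1), by positivity, fun y => ?_⟩
  have h1 := mvt_ball hφ (R := ‖y‖) (G := G * (1 + ‖y‖) ^ β) (fun x hx => (h x).trans (by gcongr))
    (x := y) (y := 0) le_rfl (by simp)
  rw [sub_zero] at h1
  have h2 : (1 + ‖y‖) ^ β * ‖y‖ ≤ (1 + ‖y‖) ^ (β + 1) := by
    rw [Real.rpow_add (by positivity), Real.rpow_one]
    gcongr; linarith
  have h3 : (1 + ‖y‖) ^ (β + 1) ≤ 2 ^ (β + 1) * (1 + ‖y‖ ^ (β + 1)) := by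
    have h4 : 0 ≤ ‖y‖ ^ (β + 1) := by positivity
    rcases le_total ‖y‖ 1 with hy | hy
    · calc (1 + ‖y‖) ^ (β + 1) ≤ 2 ^ (β + 1) := by gcongr; linarith
        _ ≤ _ := le_mul_of_one_le_right (by positivity) (by linarith)
    · calc (1 + ‖y‖) ^ (β + 1) ≤ (2 * ‖y‖) ^ (β + 1) := by gcongr; linarith
        _ = 2 ^ (β + 1) * ‖y‖ ^ (β + 1) := Real.mul_rpow (by norm_num) (norm_nonneg y)
        _ ≤ _ := by gcongr; linarith
  have h5 : 0 ≤ ‖y‖ ^ (β + 1) := by positivity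
  have h6 := le_abs_self (φ y - φ 0)
  have h7 := le_abs_self (φ 0)
  have h8 : G * ((1 + ‖y‖) ^ β * ‖y‖) ≤ G * (2 ^ (β + 1) * (1 + ‖y‖ ^ (β + 1))) :=
    mul_le_mul_of_nonneg_left (h2.trans h3) hG
  have h9 : 0 ≤ |φ 0| * ‖y‖ ^ (β + 1) := by positivity
  linarith

lemma lower_growth {θ α f₀ lam C : ℝ} (hθ : 1 < θ) (hα : 0 < α) (hf₀ : 0 < f₀)
    {f φ : E m → ℝ} (h1 : H1 f α f₀) (hφ : ContDiff ℝ 2 φ) (hC : ∀ x, -C ≤ φ x)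
    (heq : ∀ x, -(1 / 2) * lap φ x + 1 / θ * ‖fderiv ℝ φ x‖ ^ θ = f x - lam) :
    ∃ a D, 0 < a ∧ ∀ y, a * ‖y‖ ^ (α / θ + 1) - D ≤ φ y := by
  have hθ0 : 0 < θ := by linarith
  set β := α / θ with hβ
  have hβ0 : 0 < β := by positivity
  have hβα : β * θ = α := div_mul_cancel₀ _ hθ0.ne'
  have hβα' : β ≤ α := by nlinarith
  set κ : ℝ := min (1 / 2) (f₀⁻¹ / (2 * (m + 2))) with hκ
  have κ0 : 0 < κ := by positivity
  have κ1 : κ ≤ 1 / 2 := min_le_left _ _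
  have κ2 : κ * (m + 2) ≤ f₀⁻¹ / 2 := by
    have : κ ≤ f₀⁻¹ / (2 * (m + 2)) := min_le_right _ _
    calc κ * (m + 2) ≤ f₀⁻¹ / (2 * (m + 2)) * (m + 2) := by gcongr
      _ = _ := by field_simp
  set R : ℝ := 1 + (2 * f₀ * |lam| + 1) ^ (1 / α) with hR
  have R1 : 1 ≤ R := by
    have : 0 ≤ (2 * f₀ * |lam| + 1) ^ (1 / α) := by positivity
    linarith
  have big : ∀ y0 : E m, 2 * R ≤ ‖y0‖ → -C + κ * (‖y0‖ / 2) ^ (β + 1) ≤ φ y0 := by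
    intro y0 hy0
    set r := ‖y0‖ / 2 with hr
    have hrR : R ≤ r := by linarith
    have r1 : 1 ≤ r := by linarith
    have r0 : 0 < r := by linarith
    by_contra hcon
    push Not at hcon
    set K : ℝ := κ * r ^ (β - 1) with hK
    have K0 : 0 < K := by positivity
    have Kr : K * r = κ * r ^ β := by
      rw [hK, mul_assoc, ← Real.rpow_add_one r0.ne', sub_add_cancel]
    have Kr2 : K * r ^ 2 = κ * r ^ (β + 1) := by
      rw [pow_two, ← mul_assoc, Kr, mul_assoc, ← Real.rpow_add_one r0.ne']
    set w : E m → ℝ := fun x => φ x + K * ‖x - y0‖ ^ 2 with hw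
    have hn : ContDiff ℝ 2 (fun x : E m => K * ‖x - y0‖ ^ 2) :=
      contDiff_const.mul (contDiff_normsq y0)
    have hw2 : ContDiff ℝ 2 w := hφ.add hn
    obtain ⟨x1, hx1, hmin⟩ := (isCompact_closedBall y0 r).exists_isMinOn
      ⟨y0, Metric.mem_closedBall_self r0.le⟩ hw2.continuous.continuousOn
    have hle : w x1 ≤ w y0 := hmin (Metric.mem_closedBall_self r0.le)
    have hwy : w y0 = φ y0 := by simp [hw]
    have hx1r : ‖x1 - y0‖ ≤ r := by simpa [dist_eq_norm] using hx1
    have hintg : ‖x1 - y0‖ < r := by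
      refine lt_of_le_of_ne hx1r fun he => ?_
      have h2 : w x1 = φ x1 + K * r ^ 2 := by simp only [hw]; rw [he]
      have := hC x1
      linarith
    have hloc : IsLocalMin w x1 := by
      refine hmin.isLocalMin ?_
      exact Filter.mem_of_superset (Metric.isOpen_ball.mem_nhds
        (show x1 ∈ Metric.ball y0 r by simpa [dist_eq_norm] using hintg)) Metric.ball_subset_closedBall
    obtain ⟨d1, d2⟩ := isLocalMin_lap hw2 hloc
    have e2 : lap w x1 = lap φ x1 + K * (2 * m) := by
      rw [hw, lap_add hφ hn, lap_const_mul (contDiff_normsq y0), lap_normsq]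
    have e1 : ‖fderiv ℝ φ x1‖ ≤ 2 * κ * r ^ β := by
      have e3 : fderiv ℝ w x1 = fderiv ℝ φ x1 + K • fderiv ℝ (fun x : E m => ‖x - y0‖ ^ 2) x1 := by
        have b1 := diff_of_two hφ x1
        have b2 := (diff_of_two (contDiff_normsq y0)) x1
        rw [hw, fderiv_fun_add b1 (b2.const_mul K), fderiv_const_mul b2]
      rw [d1] at e3
      rw [eq_neg_of_add_eq_zero_left e3.symm, norm_neg, norm_smul, norm_fderiv_normsq,
        Real.norm_eq_abs, abs_of_pos K0]
      calc K * (2 * ‖x1 - y0‖) ≤ K * (2 * r) := by gcongr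
        _ = _ := by rw [mul_left_comm, Kr]; ring
    have ra : 0 < r ^ α := by positivity
    have e4 : ‖fderiv ℝ φ x1‖ ^ θ ≤ 2 * κ * r ^ α := by
      calc ‖fderiv ℝ φ x1‖ ^ θ ≤ (2 * κ * r ^ β) ^ θ := by gcongr
        _ = (2 * κ) ^ θ * r ^ α := by
          rw [Real.mul_rpow (by positivity) (by positivity), ← Real.rpow_mul r0.le, hβα]
        _ ≤ 2 * κ * r ^ α := by
          refine mul_le_mul_of_nonneg_right ?_ ra.le
          have := Real.rpow_le_rpow_of_exponent_ge (x := 2 * κ) (by positivity) (by linarith) hθ.le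
          rwa [Real.rpow_one] at this
    have e5 : 1 / θ * ‖fderiv ℝ φ x1‖ ^ θ ≤ 2 * κ * r ^ α := by
      have : 1 / θ ≤ 1 := by rw [div_le_one hθ0]; exact hθ.le
      calc 1 / θ * ‖fderiv ℝ φ x1‖ ^ θ ≤ 1 * ‖fderiv ℝ φ x1‖ ^ θ := by gcongr
        _ ≤ _ := by rw [one_mul]; exact e4
    have e6 : K * m ≤ κ * m * r ^ α := by
      have : r ^ (β - 1) ≤ r ^ α := Real.rpow_le_rpow_of_exponent_le r1 (by linarith)
      calc K * m = κ * m * r ^ (β - 1) := by rw [hK]; ring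
        _ ≤ _ := by gcongr
    have e7 : r ≤ ‖x1‖ := by
      have := norm_sub_norm_le y0 x1
      rw [norm_sub_rev] at this
      linarith
    have e8 : f₀⁻¹ * r ^ α ≤ f x1 := by
      refine le_trans ?_ (h1 x1).1
      have : r ^ α ≤ ‖x1‖ ^ α := by gcongr
      gcongr; linarith
    have e9 := heq x1
    have e10 : (κ * (m + 2)) * r ^ α ≤ f₀⁻¹ / 2 * r ^ α := by gcongr
    have e11 : f₀⁻¹ * r ^ α ≤ 2 * |lam| := by
      have := le_abs_self lam
      linarith
    have e12 : 2 * f₀ * |lam| + 1 ≤ r ^ α := by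
      have h3 : (2 * f₀ * |lam| + 1) ^ (1 / α) ≤ r := by linarith
      calc 2 * f₀ * |lam| + 1 = ((2 * f₀ * |lam| + 1) ^ (1 / α)) ^ α := by
            rw [← Real.rpow_mul (by positivity), one_div_mul_cancel hα.ne', Real.rpow_one]
        _ ≤ r ^ α := by gcongr
    rw [inv_mul_le_iff₀ hf₀] at e11
    linarith
  refine ⟨κ * (1 / 2) ^ (β + 1), C + κ * R ^ (β + 1), by positivity, fun y => ?_⟩
  have hy : κ * (1 / 2) ^ (β + 1) * ‖y‖ ^ (β + 1) = κ * (‖y‖ / 2) ^ (β + 1) := by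
    rw [mul_assoc, ← Real.mul_rpow (by norm_num) (norm_nonneg y)]
    congr 2; ring
  rw [hy]
  have hR0 : 0 ≤ κ * R ^ (β + 1) := by positivity
  rcases le_total (2 * R) ‖y‖ with h | h
  · have := big y h
    linarith
  · have h2 : κ * (‖y‖ / 2) ^ (β + 1) ≤ κ * R ^ (β + 1) := by gcongr; linarith
    have := hC y
    linarith

end growth
end EPP

theorem stmt12 (m : ℕ) (hm : 1 ≤ m) (θ : ℝ) (hθ : 1 < θ) (α f₀ : ℝ) (hα : 0 < α) (hf₀ : 0 < f₀)
    (f : EuclideanSpace ℝ (Fin m) → ℝ) (hH0 : H0 f α f₀) (hH1 : H1 f α f₀) :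
    ∃ lam : ℝ, ∃ φ, IsSolution θ f lam φ ∧ MemPhi (α / θ + 1) φ := by
  obtain ⟨lam, φ, C, hφ, hC, heq⟩ := EPP.exist_sol hm hθ hα hf₀ hH0.1 hH1
  obtain ⟨G, G0, hG⟩ := EPP.grad_growth hm hθ hα hf₀ hH0 hH1 hφ heq
  obtain ⟨D, D0, hD⟩ := EPP.upper_growth (div_pos hα (by linarith)) G0 hφ hG
  obtain ⟨a, B, a0, hB⟩ := EPP.lower_growth hθ hα hf₀ hH1 hφ hC heq
  refine ⟨lam, φ, ⟨hφ, fun y => ?_⟩, hφ, 2 + D + |B| + a⁻¹, ?_, fun y => ⟨?_, ?_⟩⟩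
  · rw [EPP.norm_gradient]; exact heq y
  · have : 0 ≤ |B| := abs_nonneg B
    have : 0 < a⁻¹ := by positivity
    linarith
  · have h1 : (2 + D + |B| + a⁻¹)⁻¹ ≤ a := by
      rw [inv_le_comm₀ (by positivity) a0]
      have : 0 ≤ |B| := abs_nonneg B
      linarith
    have h2 : (2 + D + |B| + a⁻¹)⁻¹ * ‖y‖ ^ (α / θ + 1) ≤ a * ‖y‖ ^ (α / θ + 1) := by gcongr
    have h3 := hB y
    have h4 := le_abs_self B
    have : 0 < a⁻¹ := by positivity
    linarith
  · refine (hD y).trans ?_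
    gcongr
    have : 0 ≤ |B| := abs_nonneg B
    have : 0 < a⁻¹ := by positivity
    linarith
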